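/- Let D be a domain in ℝ^n, n ≥ 3, let φ: (0,∞) → (0,∞) be a nondecreasing function satisfying ∫₁^∞ (t/φ(t))^{1/(n−2)} dt < ∞, and let p > n−1. Then every open discrete map f: D → ℝ^n of finite distortion of Orlicz–Sobolev class W^{1,φ}_loc with N(f,D) < ∞ is a lower Q-mapping with respect to the p-modulus at every point x₀ ∈ closure(D), with Q(x) = N(f,D) · K_{I,α}(x,f)^{(p−n+1)/(n−1)}, where α := p/(p−n+1). -/

import Mathlib

open MeasureTheory Metric Set Filter Function
open scoped ENNReal NNReal Topology

noncomputable section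

abbrev En (n : ℕ) := EuclideanSpace ℝ (Fin n)

/-- A `k`-dimensional surface in `ℝⁿ`: a continuous map from an open subset of `ℝᵏ`. -/
structure Surface (k n : ℕ) where
  dom : Set (EuclideanSpace ℝ (Fin k))
  isOpen_dom : IsOpen dom
  toFun : EuclideanSpace ℝ (Fin k) → En n
  contOn : ContinuousOn toFun dom

namespace Surface

def image {k n : ℕ} (S : Surface k n) : Set (En n) := S.toFun '' S.dom

/-- Multiplicity function `N(y,S)`. -/
def mult {k n : ℕ} (S : Surface k n) (y : En n) : ℝ≥0∞ :=
  ((S.dom ∩ S.toFun ⁻¹' {y}).encard : ℕ∞)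

/-- Surface integral `∫_S ρ dA = ∫ ρ(y) N(y,S) dH^k(y)`. -/
def sIntegral {k n : ℕ} (S : Surface k n) (ρ : En n → ℝ≥0∞) : ℝ≥0∞ :=
  ∫⁻ y, ρ y * S.mult y ∂(μH[(k : ℝ)])

end Surface

/-- Admissibility of `ρ` for a family of `k`-dimensional surfaces. -/
def admissibleS {k n : ℕ} (Γ : Set (Surface k n)) (ρ : En n → ℝ≥0∞) : Prop :=
  Measurable ρ ∧ ∀ S ∈ Γ, 1 ≤ S.sIntegral (fun y => ρ y ^ (k : ℝ))

/-- `p`-modulus of a family of `k`-dimensional surfaces. -/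
def surfModulus {k n : ℕ} (p : ℝ) (Γ : Set (Surface k n)) : ℝ≥0∞ :=
  ⨅ (ρ : En n → ℝ≥0∞) (_ : admissibleS Γ ρ), ∫⁻ x, ρ x ^ p

/-- A curve in `ℝⁿ` (a 1-dimensional surface, parametrized on `[0,1]`). -/
structure Curve (n : ℕ) where
  toFun : ℝ → En n
  contOn : ContinuousOn toFun (Icc 0 1)

namespace Curve

def image {n : ℕ} (γ : Curve n) : Set (En n) := γ.toFun '' Icc 0 1

def mult {n : ℕ} (γ : Curve n) (y : En n) : ℝ≥0∞ :=
  ((Icc (0:ℝ) 1 ∩ γ.toFun ⁻¹' {y}).encard : ℕ∞)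

def cIntegral {n : ℕ} (γ : Curve n) (ρ : En n → ℝ≥0∞) : ℝ≥0∞ :=
  ∫⁻ y, ρ y * γ.mult y ∂(μH[1])

end Curve

/-- `Γ(A,B,C)`: curves joining `A` and `B` in `C`. -/
def curveFamily (n : ℕ) (A B C : Set (En n)) : Set (Curve n) :=
  {γ | γ.toFun 0 ∈ A ∧ γ.toFun 1 ∈ B ∧ γ.image ⊆ C}

def admissibleC {n : ℕ} (Γ : Set (Curve n)) (ρ : En n → ℝ≥0∞) : Prop :=
  Measurable ρ ∧ ∀ γ ∈ Γ, 1 ≤ γ.cIntegral ρ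

/-- `p`-modulus of a curve family. -/
def curveModulus {n : ℕ} (p : ℝ) (Γ : Set (Curve n)) : ℝ≥0∞ :=
  ⨅ (ρ : En n → ℝ≥0∞) (_ : admissibleC Γ ρ), ∫⁻ x, ρ x ^ p

def curveImage {n : ℕ} (f : En n → En n) (Γ : Set (Curve n)) : Set (Curve n) :=
  {γ' | ∃ γ ∈ Γ, ∀ t ∈ Icc (0:ℝ) 1, γ'.toFun t = f (γ.toFun t)}

def surfImage {k n : ℕ} (f : En n → En n) (Γ : Set (Surface k n)) : Set (Surface k n) :=
  {S' | ∃ S ∈ Γ, S'.dom = S.dom ∧ ∀ z ∈ S.dom, S'.toFun z = f (S.toFun z)}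

/-- Extensive admissibility w.r.t. the `p`-modulus. -/
def extAdmissible {k n : ℕ} (p : ℝ) (Γ : Set (Surface k n)) (ρ : En n → ℝ≥0∞) : Prop :=
  Measurable ρ ∧
    surfModulus p {S | S ∈ Γ ∧ ¬ 1 ≤ S.sIntegral (fun y => ρ y ^ (k : ℝ))} = 0

/-- Family of intersections of the spheres `S(x₀,r)`, `r ∈ (ε,r₀)`, with `D`,
viewed as injectively parametrized `(n-1)`-surfaces. -/
def sphereFamily (n : ℕ) (D : Set (En n)) (x₀ : En n) (ε r₀ : ℝ) : Set (Surface (n-1) n) :=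
  {S | ∃ r ∈ Ioo ε r₀, InjOn S.toFun S.dom ∧ S.image = sphere x₀ r ∩ D}

/-- `f` is a lower `Q`-mapping at `x₀` with respect to the `p`-modulus. -/
def IsLowerQMapAt (n : ℕ) (D : Set (En n)) (Q : En n → ℝ≥0∞) (p : ℝ)
    (f : En n → En n) (x₀ : En n) : Prop :=
  ∀ ε r₀ : ℝ, 0 < ε → ε < r₀ → (∃ x ∈ D, r₀ < dist x x₀) →
    ⨅ (ρ : En n → ℝ≥0∞) (_ : extAdmissible p (sphereFamily n D x₀ ε r₀) ρ),
        ∫⁻ x in D ∩ {x | ε < dist x x₀ ∧ dist x x₀ < r₀}, ρ x ^ p / Q x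
      ≤ surfModulus p (surfImage f (sphereFamily n D x₀ ε r₀))

/-- `Df` is the weak (distributional) derivative of `f` on the open set `D`
(so that `f ∈ W^{1,1}_loc(D)` with derivative `Df`). -/
def IsWeakDerivOn (n : ℕ) (D : Set (En n)) (f : En n → En n)
    (Df : En n → (En n →L[ℝ] En n)) : Prop :=
  LocallyIntegrableOn f D volume ∧
  LocallyIntegrableOn (fun x => ‖Df x‖) D volume ∧
  ∀ φ : En n → ℝ, ContDiff ℝ (⊤ : ℕ∞) φ → HasCompactSupport φ → tsupport φ ⊆ D →
    ∀ v : En n, ∫ x, fderiv ℝ φ x v • f x = - ∫ x, φ x • Df x v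

/-- Frobenius norm `|∇f| = (Σ_{i,j} (∂f_i/∂x_j)²)^{1/2}` of a matrix. -/
def frobNorm {n : ℕ} (A : En n →L[ℝ] En n) : ℝ :=
  Real.sqrt (∑ i : Fin n, ∑ j : Fin n, (A (EuclideanSpace.single j 1) i) ^ 2)

/-- Orlicz–Sobolev condition: `∫_G φ(|∇f|) dm < ∞` for every compact `G ⊆ D`. -/
def OrliczCond (n : ℕ) (D : Set (En n)) (φ : ℝ → ℝ)
    (Df : En n → (En n →L[ℝ] En n)) : Prop :=
  ∀ G : Set (En n), IsCompact G → G ⊆ D →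
    ∫⁻ x in G, ENNReal.ofReal (φ (frobNorm (Df x))) < ∞

/-- Smallest singular value `l(A)`. -/
def minStretch {n : ℕ} (A : En n →L[ℝ] En n) : ℝ :=
  sInf {r : ℝ | ∃ v : En n, ‖v‖ = 1 ∧ ‖A v‖ = r}

open scoped Classical in
/-- Inner dilatation of order `p` of the matrix `A = f'(x)`. -/
def innerDil {n : ℕ} (p : ℝ) (A : En n →L[ℝ] En n) : ℝ≥0∞ :=
  if LinearMap.det (A : En n →ₗ[ℝ] En n) ≠ 0 then
    ENNReal.ofReal (|LinearMap.det (A : En n →ₗ[ℝ] En n)| / (minStretch A) ^ p)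
  else if A = 0 then 1 else ∞

/-- `g` is a homeomorphism of `D` onto `G`. -/
def IsHomeoOn (n : ℕ) (D G : Set (En n)) (g : En n → En n) : Prop :=
  ContinuousOn g D ∧ InjOn g D ∧ g '' D = G ∧ ContinuousOn (invFunOn g D) G

/-- `g` is a quasiconformal homeomorphism of `D` onto `G`: it distorts the conformal
modulus of curve families lying in `D` by at most a fixed multiplicative constant. -/
def IsQCHomeo (n : ℕ) (D G : Set (En n)) (g : En n → En n) : Prop :=
  IsHomeoOn n D G g ∧
  ∃ K : ℝ≥0∞, 1 ≤ K ∧ K < ∞ ∧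
    ∀ Γ : Set (Curve n), (∀ γ ∈ Γ, γ.image ⊆ D) →
      curveModulus (n : ℝ) (curveImage g Γ) ≤ K * curveModulus (n : ℝ) Γ ∧
      curveModulus (n : ℝ) Γ ≤ K * curveModulus (n : ℝ) (curveImage g Γ)

/-- `D` has locally quasiconformal boundary. -/
def HasLocQCBoundary (n : ℕ) (D : Set (En n)) : Prop :=
  ∀ x₀ ∈ frontier D, ∃ U : Set (En n), IsOpen U ∧ x₀ ∈ U ∧
    ∃ φ : En n → En n, IsQCHomeo n U (ball 0 1) φ ∧
      ∃ i : Fin n, φ '' (frontier D ∩ U) = ball (0 : En n) 1 ∩ {x | x i = 0}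

/-- A regular domain: a bounded domain which can be mapped quasiconformally onto a
domain with locally quasiconformal boundary. -/
def IsRegularDomain (n : ℕ) (D : Set (En n)) : Prop :=
  IsOpen D ∧ IsConnected D ∧ Bornology.IsBounded D ∧
  ∃ (D₀ : Set (En n)) (g : En n → En n),
    IsOpen D₀ ∧ IsConnected D₀ ∧ HasLocQCBoundary n D₀ ∧ IsQCHomeo n D D₀ g

/-- A cut of the domain `D`: a Jordan `(n-1)`-surface in `D` separating `D`, with
`∂σ ∩ D = ∅` and `∂σ ∩ ∂D ≠ ∅`. -/
structure Cut (n : ℕ) (D : Set (En n)) where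
  surf : Surface (n-1) n
  inj : InjOn surf.toFun surf.dom
  subset : surf.image ⊆ D
  separates : ¬ IsPreconnected (D \ surf.image)
  bd_dom : (closure surf.image \ surf.image) ∩ D = ∅
  bd_frontier : ((closure surf.image \ surf.image) ∩ frontier D).Nonempty

def Cut.image {n : ℕ} {D : Set (En n)} (σ : Cut n D) : Set (En n) := σ.surf.image

/-- A chain of cuts of `D`, together with its associated domains `d_m` (the component of
`D \ σ_m` containing `σ_{m+1}`). -/
structure CutChain (n : ℕ) (D : Set (En n)) where
  cuts : ℕ → Cut n D
  domains : ℕ → Set (En n)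
  disj : ∀ i j, i ≠ j → Disjoint (closure (cuts i).image) (closure (cuts j).image)
  subset_domains : ∀ m, (cuts (m+1)).image ⊆ domains m
  domains_eq : ∀ m, ∀ x ∈ (cuts (m+1)).image,
      domains m = connectedComponentIn (D \ (cuts m).image) x
  sep : ∀ m, Disjoint ((cuts m).image) (domains (m+1)) ∧
      ∃ x ∈ (cuts m).image, (cuts m).image ⊆ connectedComponentIn (D \ (cuts (m+1)).image) x
  iInter_empty : ⋂ m, domains m = ∅

/-- Equivalence of chains of cuts. -/
def chainEquiv {n : ℕ} {D : Set (En n)} (c₁ c₂ : CutChain n D) : Prop :=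
  (∀ m, ∀ᶠ k in atTop, c₂.domains k ⊆ c₁.domains m) ∧
  (∀ k, ∀ᶠ m in atTop, c₁.domains m ⊆ c₂.domains k)

/-- An end of the domain `D`: an equivalence class of chains of cuts. -/
def DomainEnd (n : ℕ) (D : Set (En n)) :=
  {E : Set (CutChain n D) // ∃ c₀ : CutChain n D, E = {c | chainEquiv c₀ c}}

/-- A chain witnessing primality: `M(Γ(C,σ_m,D)) → 0` for some continuum `C ⊆ D`. -/
def IsPrimeChain {n : ℕ} {D : Set (En n)} (c : CutChain n D) : Prop :=
  ∃ C : Set (En n), IsCompact C ∧ IsConnected C ∧ C ⊆ D ∧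
    Tendsto (fun m => curveModulus (n : ℝ) (curveFamily n C (c.cuts m).image D))
      atTop (𝓝 0)

def IsPrimeEnd {n : ℕ} {D : Set (En n)} (K : DomainEnd n D) : Prop :=
  ∃ c ∈ K.1, IsPrimeChain c

def PrimeEnd (n : ℕ) (D : Set (En n)) := {K : DomainEnd n D // IsPrimeEnd K}

/-- The prime-end completion `closure(D)_P = D ⊔ {prime ends of D}` (as a set). -/
def PEC (n : ℕ) (D : Set (En n)) := {x : En n // x ∈ D} ⊕ PrimeEnd n D

/-- `dP` is a prime-end metric on `closure(D)_P`: it is induced, via a quasiconformal map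
`g₀` of a domain `D₀` with locally quasiconformal boundary onto `D`, together with its
natural bijective extension `h : closure D₀ → closure(D)_P`, by the Euclidean metric. -/
def IsPrimeEndMetric (n : ℕ) (D : Set (En n)) (dP : PEC n D → PEC n D → ℝ) : Prop :=
  ∃ (D₀ : Set (En n)) (g₀ : En n → En n) (h : En n → PEC n D),
    IsOpen D₀ ∧ IsConnected D₀ ∧ HasLocQCBoundary n D₀ ∧
    IsQCHomeo n D₀ D g₀ ∧
    BijOn h (closure D₀) univ ∧
    (∀ x ∈ D₀, ∃ hx : g₀ x ∈ D, h x = Sum.inl ⟨g₀ x, hx⟩) ∧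
    (∀ b ∈ closure D₀ \ D₀, ∀ P : PrimeEnd n D, h b = Sum.inr P →
      ∀ c ∈ P.1.1, ∀ m, ∀ᶠ x in 𝓝[D₀] b, g₀ x ∈ c.domains m) ∧
    (∀ x ∈ closure D₀, ∀ y ∈ closure D₀, dP (h x) (h y) = dist x y)

/-- Finite mean oscillation of a locally integrable function at `x₀`. -/
def FMOAt (n : ℕ) (g : En n → ℝ) (x₀ : En n) : Prop :=
  ∃ C : ℝ, ∀ᶠ ε in 𝓝[>] (0:ℝ),
    ⨍ x in ball x₀ ε, |g x - ⨍ y in ball x₀ ε, g y| ≤ C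

/-- Spherical mean `q_{x₀}(r) = (ω_{n-1} r^{n-1})⁻¹ ∫_{|x-x₀|=r} g dH^{n-1}`. -/
def sphMean (n : ℕ) (g : En n → ℝ) (x₀ : En n) (r : ℝ) : ℝ :=
  (∫ x in sphere x₀ r, g x ∂(μH[(n : ℝ) - 1])) /
    ((μH[(n : ℝ) - 1] (sphere (0 : En n) 1)).toReal * r ^ (n - 1))

/-- The set `X ⊆ ℝⁿ`, with Euclidean metric and Lebesgue measure, is `β`-Ahlfors regular. -/
def IsAhlforsRegular (n : ℕ) (X : Set (En n)) (β : ℝ) : Prop :=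
  ∃ C : ℝ≥0∞, 1 ≤ C ∧ C < ∞ ∧ ∀ x₀ ∈ X, ∀ R : ℝ, 0 < R → R < diam X →
    ENNReal.ofReal (R ^ β) / C ≤ volume (X ∩ ball x₀ R) ∧
    volume (X ∩ ball x₀ R) ≤ C * ENNReal.ofReal (R ^ β)

/-- `ρ` is an upper gradient of `u` on `X`. -/
def IsUpperGradientOn (n : ℕ) (X : Set (En n)) (ρ : En n → ℝ≥0∞) (u : En n → ℝ) : Prop :=
  ∀ x ∈ X, ∀ y ∈ X, ∀ γ ∈ curveFamily n {x} {y} X,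
    ENNReal.ofReal |u x - u y| ≤ Curve.cIntegral γ ρ

/-- `X ⊆ ℝⁿ` (with Euclidean metric and Lebesgue measure) supports a `(1;p)`-Poincaré
inequality. -/
def PoincareIneq (n : ℕ) (X : Set (En n)) (p : ℝ) : Prop :=
  ∃ C τ : ℝ, 1 ≤ C ∧ 0 < τ ∧ ∀ x₀ ∈ X, ∀ r : ℝ, 0 < r → ∀ u : En n → ℝ,
    ContinuousOn u X → (∃ M, ∀ x ∈ X, |u x| ≤ M) →
    ∀ ρ : En n → ℝ≥0∞, Measurable ρ → IsUpperGradientOn n X ρ u →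
      (⨍ x in X ∩ ball x₀ r, |u x - ⨍ y in X ∩ ball x₀ r, u y|) ≤
        C * diam (X ∩ ball x₀ r) *
          (((∫⁻ x in X ∩ ball x₀ (τ * r), ρ x ^ p) /
            volume (X ∩ ball x₀ (τ * r))).toReal) ^ (1 / p)

/-- `g` is a nonnegative measurable function of class `L^s_loc(ℝⁿ)`. -/
def LocLpNonneg (n : ℕ) (g : En n → ℝ) (s : ℝ) : Prop :=
  Measurable g ∧ (∀ x, 0 ≤ g x) ∧
    ∀ K : Set (En n), IsCompact K → ∫⁻ x in K, ENNReal.ofReal (g x) ^ s < ∞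

/-- `F : closure(D)_P → closure(D')_P` extends `f : D → D'`. -/
def ExtendsToPEC (n : ℕ) (D D' : Set (En n)) (f : En n → En n)
    (F : PEC n D → PEC n D') : Prop :=
  ∀ (x : En n) (hx : x ∈ D), ∃ hfx : f x ∈ D', F (Sum.inl ⟨x, hx⟩) = Sum.inl ⟨f x, hfx⟩

/-- Continuity of `F` with respect to prime-end metrics. -/
def ContPEC {n : ℕ} {D D' : Set (En n)} (dP : PEC n D → PEC n D → ℝ)
    (dP' : PEC n D' → PEC n D' → ℝ) (F : PEC n D → PEC n D') : Prop :=
  ∀ q₀ : PEC n D, ∀ ε : ℝ, 0 < ε → ∃ δ : ℝ, 0 < δ ∧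
    ∀ q : PEC n D, dP q₀ q < δ → dP' (F q₀) (F q) < ε

/-- `F` is a homeomorphism w.r.t. prime-end metrics. -/
def HomeoPEC {n : ℕ} {D D' : Set (En n)} (dP : PEC n D → PEC n D → ℝ)
    (dP' : PEC n D' → PEC n D' → ℝ) (F : PEC n D → PEC n D') : Prop :=
  Bijective F ∧ ContPEC dP dP' F ∧
    ∀ q₀ : PEC n D, ∀ ε : ℝ, 0 < ε → ∃ δ : ℝ, 0 < δ ∧
      ∀ q : PEC n D, dP' (F q₀) (F q) < δ → dP q₀ q < ε

/-- Equicontinuity of a family of maps between prime-end completions. -/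
def EquicontPEC {n : ℕ} {D D' : Set (En n)} (dP : PEC n D → PEC n D → ℝ)
    (dP' : PEC n D' → PEC n D' → ℝ) (𝓕 : Set (PEC n D → PEC n D')) : Prop :=
  ∀ q₀ : PEC n D, ∀ ε : ℝ, 0 < ε → ∃ δ : ℝ, 0 < δ ∧
    ∀ F ∈ 𝓕, ∀ q : PEC n D, dP q₀ q < δ → dP' (F q₀) (F q) < ε

/-- Normality of a family: every sequence has a uniformly convergent subsequence. -/
def NormalPEC {n : ℕ} {D D' : Set (En n)} (dP : PEC n D → PEC n D → ℝ)
    (dP' : PEC n D' → PEC n D' → ℝ) (𝓕 : Set (PEC n D → PEC n D')) : Prop :=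
  ∀ g : ℕ → (PEC n D → PEC n D'), (∀ k, g k ∈ 𝓕) →
    ∃ φ : ℕ → ℕ, StrictMono φ ∧ ∃ F : PEC n D → PEC n D',
      ∀ ε : ℝ, 0 < ε → ∀ᶠ k in atTop, ∀ q, dP' (g (φ k) q) (F q) < ε

/-- `∂D'` is strongly accessible with respect to the `α`-modulus. -/
def StronglyAccessibleBoundary (n : ℕ) (D' : Set (En n)) (α : ℝ) : Prop :=
  ∀ y₀ ∈ frontier D', ∀ U : Set (En n), IsOpen U → y₀ ∈ U →
    ∃ (E V : Set (En n)) (δ : ℝ), IsCompact E ∧ E ⊆ D' ∧ IsOpen V ∧ y₀ ∈ V ∧ V ⊆ U ∧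
      0 < δ ∧ ∀ F : Set (En n), IsCompact F → IsConnected F → F ⊆ D' →
        (F ∩ frontier U).Nonempty → (F ∩ frontier V).Nonempty →
        ENNReal.ofReal δ ≤ curveModulus α (curveFamily n E F D')

open scoped Convolution

/-- A truncated Riesz-type potential: the integral over scales of the means of `g`. -/
def ballPotential {d : ℕ} (R : ℝ) (g : En d → ℝ≥0∞) (x : En d) : ℝ≥0∞ :=
  2 * ∫⁻ s in Ioo 0 R, (volume (ball (0 : En d) s))⁻¹ * ∫⁻ z in ball x (2 * s), g z

theorem volume_ball_mul {d : ℕ} (x : En d) {r : ℝ} (hr : 0 < r) (s : ℝ) :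
    volume (ball x (r * s)) = ENNReal.ofReal (r ^ d) * volume (ball (0 : En d) s) := by
  simpa using Measure.addHaar_ball_mul_of_pos (volume : Measure (En d)) x hr s

theorem lintegral_homothety {d : ℕ} {g : En d → ℝ≥0∞} (hg : Measurable g) (x : En d) {t : ℝ}
    (ht : 0 < t) :
    ∫⁻ w, g (x + t • (w - x)) = ENNReal.ofReal ((t ^ d)⁻¹) * ∫⁻ z, g z := by
  have h1 : ∀ w, g (x + t • (w - x)) = g ((x - t • x) + t • w) := fun w => by
    congr 1; rw [smul_sub]; abel
  simp_rw [h1]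
  have h2 := lintegral_map (μ := (volume : Measure (En d)))
    (f := fun z => g ((x - t • x) + z)) (g := fun w : En d => t • w)
    (by fun_prop) (by fun_prop)
  rw [← h2, Measure.map_addHaar_smul _ ht.ne', lintegral_smul_measure,
    lintegral_add_left_eq_self]
  simp [abs_of_pos ht]

theorem lintegral_Ioo_mul_right {R : ℝ} (hR : 0 < R) {F : ℝ → ℝ≥0∞} (hF : Measurable F) :
    ENNReal.ofReal R * ∫⁻ t in Ioo 0 1, F (t * R) = ∫⁻ s in Ioo 0 R, F s := by
  have h := lintegral_map (μ := volume) (f := (Ioo 0 R).indicator F) (g := fun t => t * R)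
    (hF.indicator measurableSet_Ioo) (by fun_prop)
  have h2 : ∀ t, (Ioo 0 R).indicator F (t * R) = (Ioo 0 1).indicator (fun t => F (t * R)) t := by
    intro t
    have : t * R ∈ Ioo 0 R ↔ t ∈ Ioo (0 : ℝ) 1 := by
      simp only [mem_Ioo]
      constructor
      · rintro ⟨h1, h2⟩
        exact ⟨pos_of_mul_pos_left h1 hR.le, by nlinarith⟩
      · rintro ⟨h1, h2⟩
        exact ⟨by positivity, by nlinarith⟩
    by_cases ht : t ∈ Ioo (0 : ℝ) 1
    · rw [indicator_of_mem ht, indicator_of_mem (this.2 ht)]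
    · rw [indicator_of_notMem ht, indicator_of_notMem (fun h => ht (this.1 h))]
  simp_rw [h2] at h
  rw [lintegral_indicator measurableSet_Ioo, lintegral_indicator measurableSet_Ioo] at h
  rw [← h, ← lintegral_indicator measurableSet_Ioo,
      Real.map_volume_mul_right hR.ne', lintegral_smul_measure,
    lintegral_indicator measurableSet_Ioo, smul_eq_mul, ← mul_assoc,
    ← ENNReal.ofReal_mul hR.le, abs_of_pos (inv_pos.2 hR), mul_inv_cancel₀ hR.ne']
  simp

theorem measurable_setLIntegral_ball {d : ℕ} {g : En d → ℝ≥0∞} (hg : Measurable g) :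
    Measurable (fun p : En d × ℝ => ∫⁻ z in ball p.1 (2 * p.2), g z) := by
  have h : ∀ p : En d × ℝ, ∫⁻ z in ball p.1 (2 * p.2), g z =
      ∫⁻ z, {q : (En d × ℝ) × En d | dist q.2 q.1.1 < 2 * q.1.2}.indicator
        (fun q => g q.2) (p, z) := by
    intro p
    rw [← lintegral_indicator measurableSet_ball]
    rfl
  simp_rw [h]
  apply Measurable.lintegral_prod_right'
  apply Measurable.indicator (by fun_prop)
  exact measurableSet_lt (by fun_prop) (by fun_prop)

theorem measurable_volume_ball_inv {d : ℕ} :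
    Measurable (fun s : ℝ => (volume (ball (0 : En d) s))⁻¹) := by
  apply Measurable.inv
  apply Monotone.measurable
  intro a b hab
  exact measure_mono (ball_subset_ball hab)

theorem measurable_ballPotential {d : ℕ} {g : En d → ℝ≥0∞} (hg : Measurable g) (R : ℝ) :
    Measurable (ballPotential R g) := by
  unfold ballPotential
  apply Measurable.const_mul
  apply Measurable.lintegral_prod_right' (f := fun p : En d × ℝ =>
    (volume (ball (0 : En d) p.2))⁻¹ * ∫⁻ z in ball p.1 (2 * p.2), g z)
  exact (measurable_volume_ball_inv.comp measurable_snd).mul (measurable_setLIntegral_ball hg)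

theorem ballPotential_mono {d : ℕ} {g h : En d → ℝ≥0∞} (hgh : ∀ z, g z ≤ h z) {R R' : ℝ}
    (hR : R ≤ R') (x : En d) : ballPotential R g x ≤ ballPotential R' h x := by
  unfold ballPotential
  gcongr
  exact hgh _

theorem measurable_setLIntegral_ball_radius {d : ℕ} (g : En d → ℝ≥0∞) (x : En d) :
    Measurable (fun s : ℝ => ∫⁻ z in ball x (2 * s), g z) := by
  apply Monotone.measurable
  intro a b hab
  exact lintegral_mono_set (ball_subset_ball (by linarith))

theorem measurable_potential_integrand {d : ℕ} (g : En d → ℝ≥0∞) (x : En d) :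
    Measurable (fun s : ℝ => (volume (ball (0 : En d) s))⁻¹ *
      ∫⁻ z in ball x (2 * s), g z) := by
  apply Measurable.mul
  · exact measurable_volume_ball_inv
  · exact measurable_setLIntegral_ball_radius g x

theorem ballPotential_add {d : ℕ} {g h : En d → ℝ≥0∞} (hg : Measurable g) (R : ℝ)
    (x : En d) :
    ballPotential R (fun z => g z + h z) x = ballPotential R g x + ballPotential R h x := by
  unfold ballPotential
  have hm := measurable_potential_integrand g x
  rw [← mul_add, ← lintegral_add_left hm]
  congr 1
  apply lintegral_congr
  intro s
  rw [← mul_add, lintegral_add_left hg]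

theorem ballPotential_const_mul {d : ℕ} {g : En d → ℝ≥0∞} (hg : Measurable g) (c : ℝ≥0∞) (R : ℝ)
    (x : En d) : ballPotential R (fun z => c * g z) x = c * ballPotential R g x := by
  unfold ballPotential
  simp_rw [lintegral_const_mul c hg]
  have hm := measurable_potential_integrand g x
  rw [mul_left_comm c, ← lintegral_const_mul c hm]
  congr 1
  apply lintegral_congr
  intro s
  ring

theorem ballPotential_tsum {d : ℕ} {g : ℕ → En d → ℝ≥0∞} (hg : ∀ k, Measurable (g k)) (R : ℝ)
    (x : En d) : ballPotential R (fun z => ∑' k, g k z) x = ∑' k, ballPotential R (g k) x := by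
  unfold ballPotential
  rw [ENNReal.tsum_mul_left, ← lintegral_tsum]
  · congr 1
    apply lintegral_congr
    intro s
    rw [lintegral_tsum (fun k => (hg k).aemeasurable), ENNReal.tsum_mul_left]
  · intro k
    exact (measurable_potential_integrand (g k) x).aemeasurable

theorem volume_ball_pos_ne_zero {d : ℕ} {s : ℝ} (hs : 0 < s) : volume (ball (0 : En d) s) ≠ 0 :=
  (measure_ball_pos _ _ hs).ne'

theorem volume_ball_ne_top {d : ℕ} (x : En d) (s : ℝ) : volume (ball x s) ≠ ∞ :=
  measure_ball_lt_top.ne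

/-- Averaged oscillation on a ball is controlled by the potential of the gradient. -/
theorem lintegral_enorm_sub_le_ballPotential {d : ℕ} {F : Type*} [NormedAddCommGroup F]
    [NormedSpace ℝ F] {u : En d → F} {c : En d} {R : ℝ} (hR : 0 < R)
    (hu : ContDiffOn ℝ 1 u (ball c R)) {g : En d → ℝ≥0∞} (hg : Measurable g)
    (hug : ∀ z ∈ ball c R, ‖fderiv ℝ u z‖ₑ ≤ g z) {x : En d} (hx : x ∈ ball c R) :
    ∫⁻ w in ball c R, ‖u w - u x‖ₑ ≤
      volume (ball (0 : En d) R) * ballPotential R ((ball c R).indicator g) x := by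
  set g' := (ball c R).indicator g with hg'
  have hg'm : Measurable g' := hg.indicator measurableSet_ball
  have step1 : ∀ w ∈ ball c R, ‖u w - u x‖ₑ ≤
      ENNReal.ofReal (2 * R) * ∫⁻ t in Ioo (0 : ℝ) 1, g' (x + t • (w - x)) := by
    intro w hw
    let γ : ℝ → En d := fun t => x + t • (w - x)
    have hγB : ∀ t ∈ Icc (0 : ℝ) 1, γ t ∈ ball c R := fun t ht =>
      (convex_ball c R).add_smul_sub_mem hx hw ht
    have hγ : ContDiff ℝ 1 γ := by fun_prop
    have hγd : ∀ t, HasDerivAt γ (w - x) t := fun t => by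
      have h := ((hasDerivAt_id' t).smul_const (w - x)).const_add x
      rwa [one_smul] at h
    have h := enorm_sub_le_lintegral_deriv_of_contDiffOn_Icc (f := u ∘ γ) (a := 0) (b := 1)
      (hu.comp hγ.contDiffOn hγB) zero_le_one
    have e1 : (u ∘ γ) 1 = u w := by simp [γ]
    have e0 : (u ∘ γ) 0 = u x := by simp [γ]
    rw [e1, e0] at h
    refine h.trans ?_
    rw [← restrict_Ioo_eq_restrict_Icc, ← lintegral_const_mul _ (by fun_prop)]
    apply setLIntegral_mono' measurableSet_Ioo
    intro t ht
    have hz := hγB t ⟨ht.1.le, ht.2.le⟩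
    have hd : HasFDerivAt u (fderiv ℝ u (γ t)) (γ t) :=
      ((hu.contDiffAt (isOpen_ball.mem_nhds hz)).differentiableAt one_ne_zero).hasFDerivAt
    rw [(hd.comp_hasDerivAt t (hγd t)).deriv]
    have h3 : ‖w - x‖ₑ ≤ ENNReal.ofReal (2 * R) := by
      rw [← ofReal_norm]
      apply ENNReal.ofReal_le_ofReal
      rw [← dist_eq_norm]
      have := dist_triangle_right w x c
      have h4 := mem_ball.1 hw
      have h5 := mem_ball.1 hx
      linarith
    calc ‖(fderiv ℝ u (γ t)) (w - x)‖ₑ ≤ ‖fderiv ℝ u (γ t)‖ₑ * ‖w - x‖ₑ :=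
          ContinuousLinearMap.le_opENorm _ _
      _ ≤ g (γ t) * ENNReal.ofReal (2 * R) := by gcongr; exact hug _ hz
      _ = ENNReal.ofReal (2 * R) * g' (γ t) := by
          rw [mul_comm, hg', indicator_of_mem hz]
  have hjm : Measurable (fun p : En d × ℝ => g' (x + p.2 • (p.1 - x))) := by fun_prop
  have step2 : ∀ t ∈ Ioo (0 : ℝ) 1, ∫⁻ w in ball c R, g' (x + t • (w - x)) ≤
      volume (ball (0 : En d) R) * ((volume (ball (0 : En d) (t * R)))⁻¹ *
        ∫⁻ z in ball x (2 * (t * R)), g' z) := by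
    intro t ht
    have h1 : ∫⁻ w in ball c R, g' (x + t • (w - x)) ≤
        ∫⁻ w, (ball x (2 * (t * R))).indicator g' (x + t • (w - x)) := by
      rw [← lintegral_indicator measurableSet_ball]
      apply lintegral_mono
      intro w
      by_cases hw : w ∈ ball c R
      · rw [indicator_of_mem hw]
        refine (indicator_of_mem (s := ball x (2 * (t * R))) ?_ g').ge
        rw [mem_ball, dist_eq_norm, add_sub_cancel_left, norm_smul, Real.norm_eq_abs,
          abs_of_pos ht.1, ← dist_eq_norm]
        have := dist_triangle_right w x c
        have h4 := mem_ball.1 hw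
        have h5 := mem_ball.1 hx
        nlinarith [ht.1]
      · rw [indicator_of_notMem hw]; exact zero_le
    refine h1.trans ?_
    rw [lintegral_homothety (hg'm.indicator measurableSet_ball) x ht.1,
      lintegral_indicator measurableSet_ball]
    apply le_of_eq
    rw [← mul_assoc (volume (ball (0 : En d) R))]
    congr 1
    rw [volume_ball_mul 0 ht.1 R, ENNReal.mul_inv (by left; simp [ht.1]) (by left; simp),
      mul_left_comm, ENNReal.mul_inv_cancel (volume_ball_pos_ne_zero hR) (volume_ball_ne_top _ _),
      mul_one, ENNReal.ofReal_inv_of_pos (pow_pos ht.1 d)]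
  calc ∫⁻ w in ball c R, ‖u w - u x‖ₑ
      ≤ ∫⁻ w in ball c R, ENNReal.ofReal (2 * R) *
          ∫⁻ t in Ioo (0 : ℝ) 1, g' (x + t • (w - x)) :=
        setLIntegral_mono' measurableSet_ball step1
    _ = ENNReal.ofReal (2 * R) * ∫⁻ w in ball c R,
          ∫⁻ t in Ioo (0 : ℝ) 1, g' (x + t • (w - x)) :=
        lintegral_const_mul _ hjm.lintegral_prod_right'
    _ = ENNReal.ofReal (2 * R) * ∫⁻ t in Ioo (0 : ℝ) 1, ∫⁻ w in ball c R,
          g' (x + t • (w - x)) := by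
        rw [lintegral_lintegral_swap hjm.aemeasurable]
    _ ≤ ENNReal.ofReal (2 * R) * ∫⁻ t in Ioo (0 : ℝ) 1, (volume (ball (0 : En d) R) *
          ((volume (ball (0 : En d) (t * R)))⁻¹ * ∫⁻ z in ball x (2 * (t * R)), g' z)) := by
        gcongr _ * ?_
        exact setLIntegral_mono' measurableSet_Ioo step2
    _ = volume (ball (0 : En d) R) * ballPotential R g' x := by
        have hm := measurable_potential_integrand g' x
        rw [lintegral_const_mul' _ _ (volume_ball_ne_top _ _), ballPotential,
          ← lintegral_Ioo_mul_right hR hm, ENNReal.ofReal_mul zero_le_two]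
        simp only [ENNReal.ofReal_ofNat]
        exact mul_left_comm _ _ _ |>.trans (by ring)

theorem enorm_sub_le_ballPotential_add {d : ℕ} {F : Type*} [NormedAddCommGroup F]
    [NormedSpace ℝ F] {u : En d → F} {c : En d} {R : ℝ} (hR : 0 < R)
    (hu : ContDiffOn ℝ 1 u (ball c R)) {g : En d → ℝ≥0∞} (hg : Measurable g)
    (hug : ∀ z ∈ ball c R, ‖fderiv ℝ u z‖ₑ ≤ g z) {x y : En d} (hx : x ∈ ball c R)
    (hy : y ∈ ball c R) :
    ‖u x - u y‖ₑ ≤ ballPotential R ((ball c R).indicator g) x +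
      ballPotential R ((ball c R).indicator g) y := by
  have hV : volume (ball c R) = volume (ball (0 : En d) R) := by
    rw [Measure.addHaar_ball_center]
  have hx' := lintegral_enorm_sub_le_ballPotential hR hu hg hug hx
  have hy' := lintegral_enorm_sub_le_ballPotential hR hu hg hug hy
  have hm : AEMeasurable (fun w => ‖u w - u x‖ₑ) (volume.restrict (ball c R)) :=
    ((hu.continuousOn.sub continuousOn_const).aestronglyMeasurable measurableSet_ball).enorm
  have key : volume (ball (0 : En d) R) * ‖u x - u y‖ₑ ≤ volume (ball (0 : En d) R) *
      (ballPotential R ((ball c R).indicator g) x +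
        ballPotential R ((ball c R).indicator g) y) := by
    calc volume (ball (0 : En d) R) * ‖u x - u y‖ₑ = ∫⁻ w in ball c R, ‖u x - u y‖ₑ := by
          rw [setLIntegral_const, hV, mul_comm]
      _ ≤ ∫⁻ w in ball c R, (‖u w - u x‖ₑ + ‖u w - u y‖ₑ) := by
          apply lintegral_mono
          intro w
          have : u x - u y = -(u w - u x) + (u w - u y) := by abel
          calc ‖u x - u y‖ₑ ≤ ‖-(u w - u x)‖ₑ + ‖u w - u y‖ₑ := by
                rw [this]; exact enorm_add_le _ _
            _ = _ := by rw [enorm_neg]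
      _ = _ := lintegral_add_left' hm _
      _ ≤ _ := by rw [mul_add]; exact add_le_add hx' hy'
  exact (ENNReal.mul_le_mul_iff_right (volume_ball_pos_ne_zero hR) (volume_ball_ne_top _ _)).1 key

/-- The potential inequality passes to limits of smooth maps. -/
theorem enorm_sub_le_ballPotential_of_tendsto {d : ℕ} {F : Type*} [NormedAddCommGroup F]
    [NormedSpace ℝ F] {u : En d → F} {v : ℕ → En d → F} {c : En d} {R : ℝ} (hR : 0 < R)
    (hv : ∀ k, ContDiffOn ℝ 1 (v k) (ball c R)) {h : En d → ℝ≥0∞} {g : ℕ → En d → ℝ≥0∞}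
    (hh : Measurable h) (hg : ∀ k, Measurable (g k))
    (hvg : ∀ k, ∀ z ∈ ball c R, ‖fderiv ℝ (v k) z‖ₑ ≤ h z + g k z)
    (hlim : ∀ z ∈ ball c R, Tendsto (fun k => v k z) atTop (𝓝 (u z)))
    {x y : En d} (hx : x ∈ ball c R) (hy : y ∈ ball c R)
    (hgx : Tendsto (fun k => ballPotential R ((ball c R).indicator (g k)) x) atTop (𝓝 0))
    (hgy : Tendsto (fun k => ballPotential R ((ball c R).indicator (g k)) y) atTop (𝓝 0)) :
    ‖u x - u y‖ₑ ≤ ballPotential R ((ball c R).indicator h) x +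
      ballPotential R ((ball c R).indicator h) y := by
  have h1 : Tendsto (fun k => ‖v k x - v k y‖ₑ) atTop (𝓝 ‖u x - u y‖ₑ) :=
    ((hlim x hx).sub (hlim y hy)).enorm
  have split : ∀ k w, ballPotential R ((ball c R).indicator (fun z => h z + g k z)) w =
      ballPotential R ((ball c R).indicator h) w +
        ballPotential R ((ball c R).indicator (g k)) w := by
    intro k w
    rw [← ballPotential_add (hh.indicator measurableSet_ball)]
    congr 1
    exact indicator_add _ _ _
  have h2 : Tendsto (fun k => (ballPotential R ((ball c R).indicator h) x +
        ballPotential R ((ball c R).indicator (g k)) x) +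
      (ballPotential R ((ball c R).indicator h) y +
        ballPotential R ((ball c R).indicator (g k)) y)) atTop
      (𝓝 ((ballPotential R ((ball c R).indicator h) x + 0) +
        (ballPotential R ((ball c R).indicator h) y + 0))) :=
    (hgx.const_add _).add (hgy.const_add _)
  rw [add_zero, add_zero] at h2
  refine le_of_tendsto_of_tendsto' h1 h2 (fun k => ?_)
  rw [← split, ← split]
  exact enorm_sub_le_ballPotential_add hR (hv k) (hh.add (hg k)) (hvg k) hx hy

theorem lintegral_ballPotential_le {d : ℕ} {g : En d → ℝ≥0∞} (hg : Measurable g) (R : ℝ) :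
    ∫⁻ x, ballPotential R g x ≤ ENNReal.ofReal (2 * 2 ^ d * R) * ∫⁻ z, g z := by
  unfold ballPotential
  have hm : Measurable (fun p : En d × ℝ =>
      (volume (ball (0 : En d) p.2))⁻¹ * ∫⁻ z in ball p.1 (2 * p.2), g z) :=
    (measurable_volume_ball_inv.comp measurable_snd).mul (measurable_setLIntegral_ball hg)
  rw [lintegral_const_mul _ hm.lintegral_prod_right', lintegral_lintegral_swap hm.aemeasurable]
  have key : ∀ s ∈ Ioo 0 R, ∫⁻ x : En d, (volume (ball (0 : En d) s))⁻¹ *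
      ∫⁻ z in ball x (2 * s), g z ≤ ENNReal.ofReal (2 ^ d) * ∫⁻ z, g z := by
    intro s hs
    have hjm : Measurable (fun q : En d × En d =>
        {q : En d × En d | dist q.2 q.1 < 2 * s}.indicator (fun q => g q.2) q) :=
      Measurable.indicator (by fun_prop) (measurableSet_lt (by fun_prop) (by fun_prop))
    have h1 : ∀ x : En d, ∫⁻ z in ball x (2 * s), g z =
        ∫⁻ z, {q : En d × En d | dist q.2 q.1 < 2 * s}.indicator (fun q => g q.2) (x, z) := by
      intro x
      rw [← lintegral_indicator measurableSet_ball]; rfl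
    simp_rw [h1]
    rw [lintegral_const_mul _ hjm.lintegral_prod_right',
      lintegral_lintegral_swap hjm.aemeasurable]
    have h2 : ∀ z : En d, ∫⁻ x, {q : En d × En d | dist q.2 q.1 < 2 * s}.indicator
        (fun q => g q.2) (x, z) = volume (ball (0 : En d) (2 * s)) * g z := by
      intro z
      have : ∀ x : En d, {q : En d × En d | dist q.2 q.1 < 2 * s}.indicator
          (fun q => g q.2) (x, z) = (ball z (2 * s)).indicator (fun _ => g z) x := by
        intro x
        simp only [indicator, mem_ofPred_eq, mem_ball, dist_comm]
      simp_rw [this]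
      rw [lintegral_indicator measurableSet_ball, setLIntegral_const,
        Measure.addHaar_ball_center, mul_comm]
    simp_rw [h2]
    rw [lintegral_const_mul _ hg, volume_ball_mul 0 two_pos, ← mul_assoc, mul_left_comm,
      ENNReal.inv_mul_cancel (volume_ball_pos_ne_zero hs.1) (volume_ball_ne_top _ _), mul_one]
  calc 2 * ∫⁻ s in Ioo 0 R, ∫⁻ x : En d, (volume (ball (0 : En d) s))⁻¹ *
        ∫⁻ z in ball x (2 * s), g z
      ≤ 2 * ∫⁻ s in Ioo 0 R, ENNReal.ofReal (2 ^ d) * ∫⁻ z, g z := by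
        gcongr _ * ?_
        exact setLIntegral_mono' measurableSet_Ioo key
    _ = _ := by
        rw [setLIntegral_const, Real.volume_Ioo, sub_zero, ENNReal.ofReal_mul (by positivity),
          ENNReal.ofReal_mul zero_le_two]
        simp only [ENNReal.ofReal_ofNat]
        ring

theorem ae_tendsto_ballPotential {d : ℕ} {g : ℕ → En d → ℝ≥0∞} (hg : ∀ k, Measurable (g k))
    (hsum : ∑' k, ∫⁻ z, g k z ≠ ∞) (R : ℝ) :
    ∀ᵐ x, Tendsto (fun k => ballPotential R (g k) x) atTop (𝓝 0) := by
  have h1 : ∫⁻ x, ∑' k, ballPotential R (g k) x ≠ ∞ := by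
    rw [lintegral_tsum (fun k => (measurable_ballPotential (hg k) R).aemeasurable)]
    refine ne_top_of_le_ne_top (ENNReal.mul_ne_top (ENNReal.ofReal_ne_top
      (r := 2 * 2 ^ d * R)) hsum) ?_
    rw [← ENNReal.tsum_mul_left]
    exact ENNReal.tsum_le_tsum fun k => lintegral_ballPotential_le (hg k) R
  filter_upwards [ae_lt_top (Measurable.tsum fun k =>
    measurable_ballPotential (hg k) R) h1] with x hx
  exact ENNReal.tendsto_atTop_zero_of_tsum_ne_top hx.ne

theorem ballPotential_le_of_mean_le {d : ℕ} {g : En d → ℝ≥0∞} {x : En d} {R : ℝ} {κ : ℝ≥0∞}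
    (h : ∀ s, 0 < s → s < 2 * R → ∫⁻ z in ball x s, g z ≤ κ * volume (ball (0 : En d) s)) :
    ballPotential R g x ≤ ENNReal.ofReal (2 * 2 ^ d * R) * κ := by
  unfold ballPotential
  have key : ∀ s ∈ Ioo 0 R, (volume (ball (0 : En d) s))⁻¹ * ∫⁻ z in ball x (2 * s), g z ≤
      ENNReal.ofReal (2 ^ d) * κ := by
    intro s hs
    calc _ ≤ (volume (ball (0 : En d) s))⁻¹ * (κ * volume (ball (0 : En d) (2 * s))) := by
          gcongr
          exact h _ (by linarith [hs.1]) (by linarith [hs.2])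
      _ = _ := by
          rw [volume_ball_mul 0 two_pos, mul_left_comm κ, mul_left_comm, mul_left_comm _ κ,
            ENNReal.inv_mul_cancel (volume_ball_pos_ne_zero hs.1) (volume_ball_ne_top _ _),
            mul_one]
  calc _ ≤ 2 * ∫⁻ s in Ioo 0 R, ENNReal.ofReal (2 ^ d) * κ := by
        gcongr _ * ?_
        exact setLIntegral_mono' measurableSet_Ioo key
    _ = _ := by
        rw [setLIntegral_const, Real.volume_Ioo, sub_zero, ENNReal.ofReal_mul (by positivity),
          ENNReal.ofReal_mul zero_le_two]
        simp only [ENNReal.ofReal_ofNat]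
        ring

theorem volume_ball_eq_ofReal_pow_mul {d : ℕ} (x : En d) {s : ℝ} (hs : 0 < s) :
    volume (ball x s) = ENNReal.ofReal (s ^ d) * volume (ball (0 : En d) 1) := by
  simpa using volume_ball_mul x hs 1

theorem ballPotential_indicator_le {m : ℕ} (hm : 2 ≤ m) {E : Set (En m)} (hE : MeasurableSet E)
    (hEfin : volume E ≠ ∞) (R : ℝ) (x : En m) :
    ballPotential R (E.indicator 1) x ≤
      2 * (2 ^ m + (volume (ball (0 : En m) 1))⁻¹) * volume E ^ ((1 : ℝ) / m) := by
  have hm0 : (0 : ℝ) < m := by positivity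
  set ω := volume (ball (0 : En m) 1) with hω
  have hω0 : ω ≠ 0 := volume_ball_pos_ne_zero one_pos
  have hωt : ω ≠ ∞ := volume_ball_ne_top _ _
  have hint : ∀ s, ∫⁻ z in ball x (2 * s), E.indicator 1 z = volume (E ∩ ball x (2 * s)) := by
    intro s
    rw [lintegral_indicator_one hE, Measure.restrict_apply hE]
  unfold ballPotential
  simp_rw [hint]
  rw [mul_assoc]
  gcongr _ * ?_
  rcases eq_or_ne (volume E) 0 with h0 | h0
  · have : ∀ s, volume (E ∩ ball x (2 * s)) = 0 := fun s => measure_mono_null inter_subset_left h0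
    simp [this]
  set v := (volume E).toReal with hv
  have hv0 : 0 < v := ENNReal.toReal_pos h0 hEfin
  have hvE : volume E = ENNReal.ofReal v := (ENNReal.ofReal_toReal hEfin).symm
  set τ : ℝ := v ^ ((1 : ℝ) / m) with hτ
  have hτ0 : 0 < τ := Real.rpow_pos_of_pos hv0 _
  have hτm : τ ^ m = v := by
    rw [hτ, ← Real.rpow_natCast, ← Real.rpow_mul hv0.le, one_div, inv_mul_cancel₀ hm0.ne',
      Real.rpow_one]
  have hτE : volume E ^ ((1 : ℝ) / m) = ENNReal.ofReal τ := by
    rw [hvE, ENNReal.ofReal_rpow_of_pos hv0]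
  have hsub : Ioo 0 R ⊆ Ioc 0 τ ∪ Ioi τ := fun s hs => by
    rcases le_or_gt s τ with h | h
    · exact Or.inl ⟨hs.1, h⟩
    · exact Or.inr h
  have b1 : ∀ s ∈ Ioc 0 τ, (volume (ball (0 : En m) s))⁻¹ * volume (E ∩ ball x (2 * s)) ≤
      2 ^ m := by
    intro s hs
    calc _ ≤ (volume (ball (0 : En m) s))⁻¹ * volume (ball x (2 * s)) := by
          gcongr; exact inter_subset_right
      _ = 2 ^ m := by
          rw [volume_ball_mul x two_pos, mul_left_comm, ENNReal.inv_mul_cancel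
            (volume_ball_pos_ne_zero hs.1) (volume_ball_ne_top _ _), mul_one,
            ENNReal.ofReal_pow zero_le_two]
          simp
  have b2 : ∀ s ∈ Ioi τ, (volume (ball (0 : En m) s))⁻¹ * volume (E ∩ ball x (2 * s)) ≤
      ω⁻¹ * ENNReal.ofReal v * ENNReal.ofReal (s ^ (-(m : ℝ))) := by
    intro s hs
    have hs0 : 0 < s := hτ0.trans hs
    rw [volume_ball_eq_ofReal_pow_mul 0 hs0, ENNReal.mul_inv (by left; simp [hs0])
      (by left; simp), ← ENNReal.ofReal_inv_of_pos (by positivity), Real.rpow_neg hs0.le,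
      Real.rpow_natCast, ← hvE]
    calc _ ≤ ENNReal.ofReal (s ^ m)⁻¹ * ω⁻¹ * volume E := by gcongr; exact inter_subset_left
      _ = _ := by ring
  have hm1 : (1 : ℝ) < m := by exact_mod_cast hm
  have b3 : ∫⁻ s in Ioi τ, ENNReal.ofReal (s ^ (-(m : ℝ))) ≤
      ENNReal.ofReal (τ ^ (1 - (m : ℝ))) := by
    rw [← ofReal_integral_eq_lintegral_ofReal
      (integrableOn_Ioi_rpow_of_lt (by linarith) hτ0)
      ((ae_restrict_mem measurableSet_Ioi).mono fun s hs => Real.rpow_nonneg (hτ0.trans hs).le _),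
      integral_Ioi_rpow_of_lt (by linarith) hτ0]
    apply ENNReal.ofReal_le_ofReal
    have e : -(m : ℝ) + 1 = 1 - m := by ring
    rw [e, neg_div, ← div_neg, div_le_iff₀ (by linarith)]
    have h2 : (2 : ℝ) ≤ m := by exact_mod_cast hm
    nlinarith [Real.rpow_pos_of_pos hτ0 (1 - (m : ℝ))]
  calc ∫⁻ s in Ioo 0 R, (volume (ball (0 : En m) s))⁻¹ * volume (E ∩ ball x (2 * s))
      ≤ ∫⁻ s in Ioc 0 τ ∪ Ioi τ, (volume (ball (0 : En m) s))⁻¹ *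
          volume (E ∩ ball x (2 * s)) := lintegral_mono_set hsub
    _ ≤ _ := lintegral_union_le _ _ _
    _ ≤ (∫⁻ s in Ioc 0 τ, 2 ^ m) + ∫⁻ s in Ioi τ, ω⁻¹ * ENNReal.ofReal v *
          ENNReal.ofReal (s ^ (-(m : ℝ))) :=
        add_le_add (setLIntegral_mono' measurableSet_Ioc b1)
          (setLIntegral_mono' measurableSet_Ioi b2)
    _ ≤ 2 ^ m * ENNReal.ofReal τ + ω⁻¹ * ENNReal.ofReal v * ENNReal.ofReal (τ ^ (1 - (m : ℝ))) := by
        rw [setLIntegral_const, Real.volume_Ioc, sub_zero,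
          lintegral_const_mul' _ _ (ENNReal.mul_ne_top (ENNReal.inv_ne_top.2 hω0)
            ENNReal.ofReal_ne_top)]
        gcongr
    _ = _ := by
        rw [hτE, add_mul, mul_assoc ω⁻¹, ← ENNReal.ofReal_mul hv0.le]
        congr 3
        rw [Real.rpow_sub hτ0, Real.rpow_one, Real.rpow_natCast, hτm]
        field_simp

/-- The weight attached to the dyadic levels of `h`. -/
def levelWeight {d : ℕ} (a : ℕ → ℝ≥0∞) (h : En d → ℝ≥0∞) (z : En d) : ℝ≥0∞ :=
  1 + ∑' k, a k * {w | 2 ^ k < h w ∧ h w ≤ 2 ^ (k + 1)}.indicator 1 z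

theorem measurableSet_level {d : ℕ} {h : En d → ℝ≥0∞} (hh : Measurable h) (k : ℕ) :
    MeasurableSet {w | 2 ^ k < h w ∧ h w ≤ 2 ^ (k + 1)} :=
  (measurableSet_lt measurable_const hh).inter (measurableSet_le hh measurable_const)

theorem measurable_levelWeight {d : ℕ} {a : ℕ → ℝ≥0∞} {h : En d → ℝ≥0∞} (hh : Measurable h) :
    Measurable (levelWeight a h) := by
  unfold levelWeight
  have h1 : ∀ k, Measurable fun z => a k *
      {w | 2 ^ k < h w ∧ h w ≤ 2 ^ (k + 1)}.indicator (1 : En d → ℝ≥0∞) z := fun k =>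
    (measurable_one.indicator (measurableSet_level hh k)).const_mul _
  exact measurable_const.add (Measurable.tsum h1)

theorem le_one_add_tsum_level {d : ℕ} {h : En d → ℝ≥0∞} (hfin : ∀ z, h z ≠ ∞) (z : En d) :
    h z ≤ 1 + ∑' k, 2 ^ (k + 1) * {w | 2 ^ k < h w ∧ h w ≤ 2 ^ (k + 1)}.indicator 1 z := by
  rcases le_or_gt (h z) 1 with h1 | h1
  · exact h1.trans le_self_add
  have ex : ∃ k : ℕ, h z ≤ 2 ^ k := by
    obtain ⟨k, hk⟩ := ENNReal.exists_nat_gt (hfin z)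
    refine ⟨k, hk.le.trans ?_⟩
    exact_mod_cast (Nat.lt_two_pow_self (n := k)).le
  classical
  have hk := Nat.find_spec ex
  have hmin := fun j => Nat.find_min ex (m := j)
  generalize Nat.find ex = K at hk hmin
  obtain ⟨k, rfl⟩ : ∃ k, K = k + 1 := by
    refine Nat.exists_eq_succ_of_ne_zero ?_
    intro h0
    rw [h0, pow_zero] at hk
    exact absurd hk (not_le.2 h1)
  have hz : z ∈ {w | 2 ^ k < h w ∧ h w ≤ 2 ^ (k + 1)} :=
    ⟨not_le.1 (hmin k (Nat.lt_succ_self k)), hk⟩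
  calc h z ≤ 2 ^ (k + 1) * {w | 2 ^ k < h w ∧ h w ≤ 2 ^ (k + 1)}.indicator 1 z := by
        rw [indicator_of_mem hz]; simpa using hk
    _ ≤ _ := ENNReal.le_tsum (f := fun k => 2 ^ (k + 1) *
        {w | 2 ^ k < h w ∧ h w ≤ 2 ^ (k + 1)}.indicator 1 z) k
    _ ≤ _ := le_add_self

/-- The Hölder constant for the dyadic sums. -/
def dyadicConst (m : ℕ) (a : ℕ → ℝ≥0∞) : ℝ≥0∞ :=
  (∑' k, (2 ^ (k + 1) * (a k ^ ((1 : ℝ) / m))⁻¹) ^ ((m : ℝ) / (m - 1))) ^ (1 / ((m : ℝ) / (m - 1)))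

theorem tsum_level_le {m : ℕ} (hm : 2 ≤ m) {a : ℕ → ℝ≥0∞} (ha0 : ∀ k, a k ≠ 0)
    (hat : ∀ k, a k ≠ ∞) (b : ℕ → ℝ≥0∞) :
    ∑' k, 2 ^ (k + 1) * b k ^ ((1 : ℝ) / m) ≤
      dyadicConst m a * (∑' k, a k * b k) ^ ((1 : ℝ) / m) := by
  have hm1 : (1 : ℝ) < m := by exact_mod_cast hm
  have hm0 : (0 : ℝ) < m := by linarith
  have hc : ((m : ℝ) / (m - 1)).HolderConjugate m :=
    (Real.HolderConjugate.conjExponent hm1).symm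
  have key := ENNReal.lintegral_mul_le_Lp_mul_Lq Measure.count hc
    (f := fun k : ℕ => 2 ^ (k + 1) * (a k ^ ((1 : ℝ) / m))⁻¹)
    (g := fun k : ℕ => (a k * b k) ^ ((1 : ℝ) / m)) (by fun_prop) (by fun_prop)
  simp only [lintegral_count, Pi.mul_apply] at key
  have e1 : ∀ k, 2 ^ (k + 1) * (a k ^ ((1 : ℝ) / m))⁻¹ * (a k * b k) ^ ((1 : ℝ) / m) =
      2 ^ (k + 1) * b k ^ ((1 : ℝ) / m) := by
    intro k
    rw [ENNReal.mul_rpow_of_nonneg _ _ (by positivity), mul_assoc, ← mul_assoc _⁻¹,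
      ENNReal.inv_mul_cancel, one_mul]
    · simp [ENNReal.rpow_eq_zero_iff, ha0 k, hat k]
    · exact ENNReal.rpow_ne_top_of_nonneg (by positivity) (hat k)
  have e2 : ∀ k, ((a k * b k) ^ ((1 : ℝ) / m)) ^ (m : ℝ) = a k * b k := by
    intro k
    rw [← ENNReal.rpow_mul, one_div, inv_mul_cancel₀ hm0.ne', ENNReal.rpow_one]
  simp only [e1, e2] at key
  exact key

/-- The constant in the Orlicz oscillation estimate. -/
def oscConst (m : ℕ) (a : ℕ → ℝ≥0∞) : ℝ≥0∞ :=
  2 * (2 ^ m + (volume (ball (0 : En m) 1))⁻¹) * (1 + dyadicConst m a)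

theorem ballPotential_le_levelWeight {m : ℕ} (hm : 2 ≤ m) {a : ℕ → ℝ≥0∞} (ha0 : ∀ k, a k ≠ 0)
    (hat : ∀ k, a k ≠ ∞) {h : En m → ℝ≥0∞} (hh : Measurable h) (hfin : ∀ z, h z ≠ ∞) (R : ℝ)
    (c x : En m) :
    ballPotential R ((ball c R).indicator h) x ≤
      oscConst m a * (∫⁻ z in ball c R, levelWeight a h z) ^ ((1 : ℝ) / m) := by
  set B := ball c R
  have hB : MeasurableSet B := measurableSet_ball
  set E : ℕ → Set (En m) := fun k => {w | 2 ^ k < h w ∧ h w ≤ 2 ^ (k + 1)} with hEdef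
  have hE : ∀ k, MeasurableSet (E k) := measurableSet_level hh
  set κ : ℝ≥0∞ := 2 * (2 ^ m + (volume (ball (0 : En m) 1))⁻¹) with hκ
  have hm0 : (0 : ℝ) ≤ 1 / (m : ℝ) := by positivity
  have hpt : ∀ z, B.indicator h z ≤
      B.indicator 1 z + ∑' k, 2 ^ (k + 1) * (B ∩ E k).indicator 1 z := by
    intro z
    by_cases hz : z ∈ B
    · have e : ∀ k, (B ∩ E k).indicator (1 : En m → ℝ≥0∞) z = (E k).indicator 1 z := by
        intro k
        by_cases hk : z ∈ E k
        · have hk' : z ∈ B ∩ E k := ⟨hz, hk⟩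
          rw [indicator_of_mem hk, indicator_of_mem hk']
        · have hk' : z ∉ B ∩ E k := fun h => hk h.2
          rw [indicator_of_notMem hk, indicator_of_notMem hk']
      rw [indicator_of_mem hz, indicator_of_mem hz]
      simp_rw [e]
      exact le_one_add_tsum_level hfin z
    · rw [indicator_of_notMem hz]; exact zero_le
  have hθ : ∫⁻ z in B, levelWeight a h z = volume B + ∑' k, a k * volume (B ∩ E k) := by
    unfold levelWeight
    rw [lintegral_add_left measurable_const, setLIntegral_const, one_mul, lintegral_tsum]
    · congr 1
      apply tsum_congr
      intro k
      rw [lintegral_const_mul _ (measurable_one.indicator (hE k)), lintegral_indicator_one (hE k),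
        Measure.restrict_apply (hE k), inter_comm]
    · intro k
      exact ((measurable_one.indicator (hE k)).const_mul _).aemeasurable
  have hBt : volume B ≠ ∞ := volume_ball_ne_top _ _
  calc ballPotential R (B.indicator h) x
      ≤ ballPotential R (fun z => B.indicator 1 z +
          ∑' k, 2 ^ (k + 1) * (B ∩ E k).indicator 1 z) x := ballPotential_mono hpt le_rfl x
    _ = ballPotential R (B.indicator 1) x + ∑' k, 2 ^ (k + 1) *
          ballPotential R ((B ∩ E k).indicator 1) x := by
        rw [ballPotential_add (measurable_one.indicator hB), ballPotential_tsum]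
        · congr 1
          apply tsum_congr
          intro k
          exact ballPotential_const_mul (measurable_one.indicator (hB.inter (hE k))) _ _ _
        · intro k
          exact (measurable_one.indicator (hB.inter (hE k))).const_mul _
    _ ≤ κ * volume B ^ ((1 : ℝ) / m) + ∑' k, 2 ^ (k + 1) *
          (κ * volume (B ∩ E k) ^ ((1 : ℝ) / m)) := by
        gcongr with k
        · exact ballPotential_indicator_le hm hB hBt R x
        · exact ballPotential_indicator_le hm (hB.inter (hE k))
            (ne_top_of_le_ne_top hBt (measure_mono inter_subset_left)) R x
    _ = κ * (volume B ^ ((1 : ℝ) / m) + ∑' k, 2 ^ (k + 1) * volume (B ∩ E k) ^ ((1 : ℝ) / m)) := by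
        rw [mul_add, ← ENNReal.tsum_mul_left]
        congr 2
        ext k
        ring
    _ ≤ κ * ((∫⁻ z in B, levelWeight a h z) ^ ((1 : ℝ) / m) + dyadicConst m a *
          (∫⁻ z in B, levelWeight a h z) ^ ((1 : ℝ) / m)) := by
        gcongr _ * (?_ + ?_)
        · rw [hθ]; gcongr; exact le_self_add
        · refine (tsum_level_le hm ha0 hat _).trans ?_
          gcongr
          rw [hθ]; exact le_add_self
    _ = _ := by rw [oscConst]; ring

/-- Convergence of the dyadic series under the integral condition on `φ`. -/
theorem dyadicConst_ne_top {n : ℕ} (hn : 3 ≤ n) {φ : ℝ → ℝ} (hφ_pos : ∀ t : ℝ, 0 < t → 0 < φ t)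
    (hφ_mono : ∀ s t : ℝ, 0 < s → s ≤ t → φ s ≤ φ t)
    (hφ_int : ∫⁻ t in Ioi (1 : ℝ), ENNReal.ofReal ((t / φ t) ^ (1 / ((n : ℝ) - 2))) < ∞) :
    dyadicConst (n - 1) (fun k => ENNReal.ofReal (φ (2 ^ k))) ≠ ∞ := by
  have hn' : ((n - 1 : ℕ) : ℝ) = n - 1 := by rw [Nat.cast_sub (by omega)]; simp
  have hn3 : (3 : ℝ) ≤ n := by exact_mod_cast hn
  set β : ℝ := 1 / ((n : ℝ) - 2) with hβ
  have hβ0 : 0 < β := by rw [hβ]; apply one_div_pos.2; linarith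
  have hq : ((n - 1 : ℕ) : ℝ) / ((n - 1 : ℕ) - 1) = 1 + β := by
    rw [hn', hβ]
    have : (n : ℝ) - 2 ≠ 0 := by linarith
    have h2 : (n : ℝ) - 1 - 1 = n - 2 := by ring
    rw [h2]; field_simp; ring
  unfold dyadicConst
  rw [hq]
  apply ENNReal.rpow_ne_top_of_nonneg (by positivity)
  set A : ℕ → ℝ := fun k => (2 ^ (k + 1)) ^ (1 + β) * (φ (2 ^ k)) ^ (-β) with hA
  have hAeq : ∀ k : ℕ, (2 ^ (k + 1) * (ENNReal.ofReal (φ (2 ^ k)) ^ ((1 : ℝ) / (n - 1 : ℕ)))⁻¹) ^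
      (1 + β) = ENNReal.ofReal (A k) := by
    intro k
    have hp : 0 < φ (2 ^ k) := hφ_pos _ (by positivity)
    have e : (2 : ℝ≥0∞) ^ (k + 1) = ENNReal.ofReal (2 ^ (k + 1)) := by
      rw [ENNReal.ofReal_pow zero_le_two]; simp
    rw [e, ENNReal.ofReal_rpow_of_pos hp, ← ENNReal.ofReal_inv_of_pos (Real.rpow_pos_of_pos hp _),
      ← ENNReal.ofReal_mul (by positivity), ENNReal.ofReal_rpow_of_pos (by positivity),
      Real.mul_rpow (by positivity) (by positivity), ← Real.rpow_neg hp.le,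
      ← Real.rpow_mul hp.le, hn']
    congr 3
    rw [hβ]
    have : (n : ℝ) - 2 ≠ 0 := by linarith
    have : (n : ℝ) - 1 ≠ 0 := by linarith
    field_simp
    ring
  simp_rw [hAeq]
  rw [tsum_eq_zero_add' ENNReal.summable]
  apply ENNReal.add_ne_top.2 ⟨ENNReal.ofReal_ne_top, ?_⟩
  have hterm : ∀ k : ℕ, ENNReal.ofReal (A (k + 1)) ≤ ENNReal.ofReal (2 ^ (2 + 2 * β)) *
      ∫⁻ t in Ioc (2 ^ k : ℝ) (2 ^ (k + 1)), ENNReal.ofReal ((t / φ t) ^ β) := by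
    intro k
    have hp : 0 < φ (2 ^ (k + 1)) := hφ_pos _ (by positivity)
    have hlow : ∀ t ∈ Ioc (2 ^ k : ℝ) (2 ^ (k + 1)),
        ENNReal.ofReal ((2 ^ k / φ (2 ^ (k + 1))) ^ β) ≤ ENNReal.ofReal ((t / φ t) ^ β) := by
      intro t ht
      have ht0 : 0 < t := lt_trans (by positivity) ht.1
      have := hφ_pos t ht0
      apply ENNReal.ofReal_le_ofReal
      apply Real.rpow_le_rpow (by positivity) _ hβ0.le
      exact div_le_div₀ ht0.le ht.1.le this (hφ_mono _ _ ht0 ht.2)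
    calc ENNReal.ofReal (A (k + 1)) = ENNReal.ofReal (2 ^ (2 + 2 * β)) *
          (ENNReal.ofReal ((2 ^ k / φ (2 ^ (k + 1))) ^ β) *
              ENNReal.ofReal (2 ^ (k + 1) - 2 ^ k)) := by
          rw [← ENNReal.ofReal_mul (by positivity), ← ENNReal.ofReal_mul (by positivity)]
          congr 1
          simp only [hA]
          rw [Real.div_rpow (by positivity) hp.le, Real.rpow_neg hp.le]
          have e1 : ((2 : ℝ) ^ (k + 1) - 2 ^ k) = 2 ^ k := by ring
          have e2 : ((2 : ℝ) ^ (k + 1 + 1)) = 2 ^ k * 2 ^ (2 : ℝ) := by norm_num; ring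
          rw [e1, e2, Real.mul_rpow (by positivity) (by positivity), ← Real.rpow_mul zero_le_two,
            Real.rpow_add (by positivity), Real.rpow_one]
          ring_nf
      _ = ENNReal.ofReal (2 ^ (2 + 2 * β)) * ∫⁻ t in Ioc (2 ^ k : ℝ) (2 ^ (k + 1)),
            ENNReal.ofReal ((2 ^ k / φ (2 ^ (k + 1))) ^ β) := by
          rw [setLIntegral_const, Real.volume_Ioc]
      _ ≤ _ := by
          gcongr _ * ?_
          exact setLIntegral_mono' measurableSet_Ioc hlow
  refine ne_top_of_le_ne_top ?_ (ENNReal.tsum_le_tsum hterm)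
  rw [ENNReal.tsum_mul_left]
  apply ENNReal.mul_ne_top ENNReal.ofReal_ne_top
  have hdisj : Pairwise (Disjoint on fun k : ℕ => Ioc (2 ^ k : ℝ) (2 ^ (k + 1))) :=
    Monotone.pairwise_disjoint_on_Ioc_succ (f := fun k : ℕ => (2 ^ k : ℝ))
      (pow_right_mono₀ one_le_two)
  rw [← lintegral_iUnion (fun _ => measurableSet_Ioc) hdisj]
  refine ne_top_of_le_ne_top hφ_int.ne (lintegral_mono_set ?_)
  intro t ht
  obtain ⟨k, hk⟩ := mem_iUnion.1 ht
  exact lt_of_le_of_lt (one_le_pow₀ one_le_two) hk.1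

theorem exists_cover_of_osc {m : ℕ} (hm : 0 < m) {X : Type*} [PseudoEMetricSpace X] {u : En m → X}
    {Ω Z : Set (En m)} (hΩ : IsOpen Ω) (hZΩ : Z ⊆ Ω) (hZ : volume Z = 0) {θ : En m → ℝ≥0∞}
    (hθ : ∫⁻ z in Ω, θ z ≠ ∞) {C : ℝ≥0∞} {N : ℕ} {τ : ℝ} (hτ : 1 < τ)
    (hN : IsEmpty (Besicovitch.SatelliteConfig (En m) N τ))
    (hu : ∀ c R, 0 < R → ball c R ⊆ Ω → ∀ x ∈ ball c R, ∀ y ∈ ball c R,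
      edist (u x) (u y) ≤ C * (∫⁻ z in ball c R, θ z) ^ ((1 : ℝ) / m))
    {ε : ℝ≥0∞} (hε : ε ≠ 0) :
    ∃ S : Set Z, S.Countable ∧ ∃ t : Z → Set X, u '' Z ⊆ ⋃ b : S, t b ∧
      (∀ b, ediam (t b) ≤ C * ε ^ ((1 : ℝ) / m)) ∧
      ∑' b : S, ediam (t b) ^ (m : ℝ) ≤ C ^ (m : ℝ) * (N * ε) := by
  set ν := (volume.restrict Ω).withDensity θ with hν
  have : IsFiniteMeasure ν := isFiniteMeasure_withDensity hθ
  have hνZ : ν Z = 0 := by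
    apply withDensity_absolutelyContinuous
    exact Measure.absolutelyContinuous_of_le Measure.restrict_le_self hZ
  obtain ⟨O, hZO, hO, hνO⟩ := Set.exists_isOpen_le_add Z ν hε
  rw [hνZ, zero_add] at hνO
  have hr : ∀ b : Z, ∃ r : ℝ, 0 < r ∧ r ≤ 1 ∧ closedBall (b : En m) r ⊆ O ∩ Ω := by
    intro b
    obtain ⟨r, hr0, hr⟩ := Metric.nhds_basis_closedBall.mem_iff.1
      ((hO.inter hΩ).mem_nhds ⟨hZO b.2, hZΩ b.2⟩)
    exact ⟨min r 1, by positivity, min_le_right _ _,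
      (closedBall_subset_closedBall (min_le_left _ _)).trans hr⟩
  choose r hr0 hr1 hrO using hr
  let q : Besicovitch.BallPackage Z (En m) :=
    { c := fun b => b, r := r, rpos := hr0, r_bound := 1, r_le := hr1 }
  obtain ⟨s, hsd, hsc⟩ := Besicovitch.exist_disjoint_covering_families hτ hN q
  have hsc' : ∀ i, (s i).Countable := fun i =>
    (hsd i).countable_of_nonempty_interior fun b _ =>
      ⟨q.c b, mem_interior_iff_mem_nhds.2 (closedBall_mem_nhds _ (q.rpos b))⟩
  have hνB : ∀ b : Z, ν (ball (b : En m) (r b)) = ∫⁻ z in ball (b : En m) (r b), θ z := by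
    intro b
    rw [hν, withDensity_apply _ measurableSet_ball, Measure.restrict_restrict measurableSet_ball,
      inter_eq_left.2 (ball_subset_closedBall.trans ((hrO b).trans inter_subset_right))]
  have hd : ∀ b : Z, ediam (u '' ball (b : En m) (r b)) ≤
      C * ν (ball (b : En m) (r b)) ^ ((1 : ℝ) / m) := by
    intro b
    apply Metric.ediam_le
    rintro _ ⟨x, hx, rfl⟩ _ ⟨y, hy, rfl⟩
    rw [hνB]
    exact hu _ _ (hr0 b) (ball_subset_closedBall.trans ((hrO b).trans inter_subset_right)) x hx y hy
  have hm0 : (0 : ℝ) < m := by exact_mod_cast hm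
  refine ⟨⋃ i, s i, countable_iUnion hsc', fun b => u '' ball (b : En m) (r b), ?_, ?_, ?_⟩
  · rintro _ ⟨z, hz, rfl⟩
    have := hsc (mem_range_self (⟨z, hz⟩ : Z))
    simp only [mem_iUnion] at this ⊢
    obtain ⟨i, b, hb, hzb⟩ := this
    exact ⟨⟨b, mem_iUnion.2 ⟨i, hb⟩⟩, mem_image_of_mem _ hzb⟩
  · intro b
    refine (hd b).trans ?_
    gcongr
    exact (measure_mono (ball_subset_closedBall.trans ((hrO b).trans inter_subset_left))).trans hνO
  · have hd2 : ∀ b : Z, ediam (u '' ball (b : En m) (r b)) ^ (m : ℝ) ≤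
        C ^ (m : ℝ) * ν (ball (b : En m) (r b)) := by
      intro b
      calc _ ≤ (C * ν (ball (b : En m) (r b)) ^ ((1 : ℝ) / m)) ^ (m : ℝ) := by
            gcongr; exact hd b
        _ = _ := by
            rw [ENNReal.mul_rpow_of_nonneg _ _ hm0.le, ← ENNReal.rpow_mul, one_div,
              inv_mul_cancel₀ hm0.ne', ENNReal.rpow_one]
    have hone : ∀ i, ∑' b : s i, ediam (u '' ball ((b : Z) : En m) (r b)) ^ (m : ℝ) ≤
        C ^ (m : ℝ) * ε := by
      intro i
      have := (hsc' i).to_subtype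
      calc _ ≤ ∑' b : s i, C ^ (m : ℝ) * ν (ball ((b : Z) : En m) (r b)) :=
            ENNReal.tsum_le_tsum fun b => hd2 b
        _ = C ^ (m : ℝ) * ν (⋃ b : s i, ball ((b : Z) : En m) (r b)) := by
            rw [ENNReal.tsum_mul_left, measure_iUnion _ fun _ => measurableSet_ball]
            intro b b' hbb
            exact (hsd i b.2 b'.2 (fun h => hbb (Subtype.ext h))).mono
              ball_subset_closedBall ball_subset_closedBall
        _ ≤ _ := by
            gcongr
            refine (measure_mono (iUnion_subset fun b => ?_)).trans hνO
            exact ball_subset_closedBall.trans ((hrO b).trans inter_subset_left)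
    calc _ ≤ ∑' i, ∑' b : s i, ediam (u '' ball ((b : Z) : En m) (r b)) ^ (m : ℝ) :=
          ENNReal.tsum_iUnion_le_tsum (fun b : Z => ediam (u '' ball (b : En m) (r b)) ^ (m : ℝ)) s
      _ ≤ ∑' i : Fin N, C ^ (m : ℝ) * ε := ENNReal.tsum_le_tsum hone
      _ = _ := by
          rw [tsum_fintype, Finset.sum_const, Finset.card_univ, Fintype.card_fin, nsmul_eq_mul]
          ring

/-- Null sets have null images under maps satisfying a Rado–Reichelderfer condition. -/
theorem hausdorffMeasure_image_eq_zero_of_osc {m : ℕ} (hm : 0 < m) {X : Type*} [EMetricSpace X]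
    [MeasurableSpace X] [BorelSpace X] {u : En m → X}
    {Ω Z : Set (En m)} (hΩ : IsOpen Ω) (hZΩ : Z ⊆ Ω) (hZ : volume Z = 0) {θ : En m → ℝ≥0∞}
    (hθ : ∫⁻ z in Ω, θ z ≠ ∞) {C : ℝ≥0∞} (hC : C ≠ ∞)
    (hu : ∀ c R, 0 < R → ball c R ⊆ Ω → ∀ x ∈ ball c R, ∀ y ∈ ball c R,
      edist (u x) (u y) ≤ C * (∫⁻ z in ball c R, θ z) ^ ((1 : ℝ) / m)) :
    μH[(m : ℝ)] (u '' Z) = 0 := by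
  obtain ⟨N, τ, hτ, hN⟩ := HasBesicovitchCovering.no_satelliteConfig (α := En m)
  have hm0 : (0 : ℝ) < m := by exact_mod_cast hm
  have hlim : Tendsto (fun k : ℕ => ((k : ℝ≥0∞) + 1)⁻¹) atTop (𝓝 0) := by
    have := (tendsto_add_atTop_iff_nat 1).2 ENNReal.tendsto_inv_nat_nhds_zero
    simpa using this
  have hε : ∀ k : ℕ, ((k : ℝ≥0∞) + 1)⁻¹ ≠ 0 := fun k => by
    rw [Ne, ENNReal.inv_eq_zero]
    exact ENNReal.add_ne_top.2 ⟨ENNReal.natCast_ne_top k, ENNReal.one_ne_top⟩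
  have H := fun k => exists_cover_of_osc hm hΩ hZΩ hZ hθ hτ hN hu (hε k)
  choose S hS t ht hdiam hsum using H
  have : ∀ k, Countable (S k) := fun k => (hS k).to_subtype
  have hr : Tendsto (fun k : ℕ => C * ((k : ℝ≥0∞) + 1)⁻¹ ^ ((1 : ℝ) / m)) atTop (𝓝 0) := by
    have h1 := (ENNReal.continuous_rpow_const (y := (1 : ℝ) / m)).tendsto 0 |>.comp hlim
    rw [ENNReal.zero_rpow_of_pos (by positivity)] at h1
    simpa using ENNReal.Tendsto.const_mul h1 (Or.inr hC)
  have h := Measure.hausdorffMeasure_le_liminf_tsum (m : ℝ) (u '' Z) (l := atTop) _ hr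
    (fun k (b : S k) => t k b) (Eventually.of_forall fun k b => hdiam k b)
    (Eventually.of_forall ht)
  refine le_antisymm (h.trans ?_) zero_le
  have h2 : Tendsto (fun k : ℕ => C ^ (m : ℝ) * (N * ((k : ℝ≥0∞) + 1)⁻¹)) atTop (𝓝 0) := by
    have := ENNReal.Tendsto.const_mul (ENNReal.Tendsto.const_mul hlim
      (Or.inr (ENNReal.natCast_ne_top N)))
      (Or.inr (ENNReal.rpow_ne_top_of_nonneg hm0.le hC) : (N : ℝ≥0∞) * 0 ≠ 0 ∨ C ^ (m : ℝ) ≠ ∞)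
    simpa using this
  rw [← h2.liminf_eq]
  exact liminf_le_liminf (Eventually.of_forall hsum)

/-- Bump functions at the origin with outer radius `r / (k + 2)`. -/
def smallBump {d : ℕ} {r : ℝ} (hr : 0 < r) (k : ℕ) : ContDiffBump (0 : En d) where
  rIn := r / (k + 2) / 2
  rOut := r / (k + 2)
  rIn_pos := by positivity
  rIn_lt_rOut := half_lt_self (by positivity)

theorem smallBump_rOut_lt {d : ℕ} {r : ℝ} (hr : 0 < r) (k : ℕ) :
    (smallBump (d := d) hr k).rOut < r := by
  have h : (0 : ℝ) ≤ k := k.cast_nonneg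
  change r / (k + 2) < r
  rw [div_lt_iff₀ (by positivity)]
  nlinarith

theorem tendsto_smallBump_rOut {d : ℕ} {r : ℝ} (hr : 0 < r) :
    Tendsto (fun k => (smallBump (d := d) hr k).rOut) atTop (𝓝 0) := by
  have h := (tendsto_add_atTop_iff_nat 2).2 (tendsto_const_div_atTop_nhds_zero_nat r)
  refine h.congr fun k => ?_
  change r / ((k + 2 : ℕ) : ℝ) = r / (k + 2)
  push_cast; rfl

theorem fderiv_convolution_apply {d : ℕ} {ψ : En d → ℝ} (hψ : ContDiff ℝ (⊤ : ℕ∞) ψ)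
    (hc : HasCompactSupport ψ) {F : Type*} [NormedAddCommGroup F] [NormedSpace ℝ F] {g : En d → F}
    (hg : LocallyIntegrable g) (x v : En d) :
    fderiv ℝ (ψ ⋆[ContinuousLinearMap.lsmul ℝ ℝ] g) x v =
      - ∫ t, fderiv ℝ (fun t => ψ (x - t)) t v • g t := by
  have hψ1 : ContDiff ℝ 1 ψ := hψ.of_le (by exact_mod_cast le_top)
  rw [(hc.hasFDerivAt_convolution_left (ContinuousLinearMap.lsmul ℝ ℝ) hψ1 hg x).fderiv,
    convolution_def, ContinuousLinearMap.integral_apply]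
  · simp only [ContinuousLinearMap.precompL_apply, ContinuousLinearMap.lsmul_apply]
    rw [← integral_sub_left_eq_self _ volume x, ← integral_neg]
    congr 1
    ext1 t
    have hd : DifferentiableAt ℝ ψ (x - t) := (hψ1.differentiable one_ne_zero) _
    have h1 : HasFDerivAt (fun t => ψ (x - t)) (-(fderiv ℝ ψ (x - t))) t := by
      have h2 : HasFDerivAt (fun t => x - t) (-(ContinuousLinearMap.id ℝ (En d))) t :=
        (hasFDerivAt_id t).const_sub x
      have h3 := hd.hasFDerivAt.comp t h2
      rw [ContinuousLinearMap.comp_neg, ContinuousLinearMap.comp_id] at h3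
      exact h3
    rw [h1.fderiv, sub_sub_cancel]
    simp
  · exact (hc.fderiv (𝕜 := ℝ)).convolutionExists_left _ (hψ1.continuous_fderiv one_ne_zero) hg x

theorem tsupport_comp_sub_subset {d : ℕ} (b : ContDiffBump (0 : En d)) (x : En d) :
    tsupport (fun t => b.normed volume (x - t)) ⊆ closedBall x b.rOut := by
  apply closure_minimal _ isClosed_closedBall
  intro t ht
  have h : x - t ∈ support (b.normed volume) := ht
  rw [b.support_normed_eq] at h
  rw [mem_closedBall, dist_comm, dist_eq_norm]
  exact (mem_ball_zero_iff.1 h).le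

theorem hasCompactSupport_comp_sub {d : ℕ} (b : ContDiffBump (0 : En d)) (x : En d) :
    HasCompactSupport (fun t => b.normed volume (x - t)) :=
  HasCompactSupport.of_support_subset_isCompact (isCompact_closedBall x b.rOut)
    (subset_tsupport _ |>.trans (tsupport_comp_sub_subset b x))

theorem contDiff_comp_sub {d : ℕ} (b : ContDiffBump (0 : En d)) (x : En d) :
    ContDiff ℝ (⊤ : ℕ∞) (fun t => b.normed volume (x - t)) :=
  b.contDiff_normed.comp (contDiff_const.sub contDiff_id)

/-- Derivative of a mollification, tested against the original function. -/
theorem fderiv_mollify_apply {d : ℕ} (b : ContDiffBump (0 : En d)) {F : Type*}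
    [NormedAddCommGroup F] [NormedSpace ℝ F] {f : En d → F} {K : Set (En d)}
    (hg : Integrable (K.indicator f)) {x : En d} (hx : closedBall x b.rOut ⊆ K)
    (v : En d) :
    fderiv ℝ (b.normed volume ⋆[ContinuousLinearMap.lsmul ℝ ℝ] (K.indicator f)) x v =
      - ∫ t, fderiv ℝ (fun t => b.normed volume (x - t)) t v • f t := by
  rw [fderiv_convolution_apply b.contDiff_normed b.hasCompactSupport_normed hg.locallyIntegrable]
  congr 2
  ext1 t
  by_cases ht : t ∈ K
  · rw [indicator_of_mem ht]
  · have h1 : t ∉ tsupport (fun t => b.normed volume (x - t)) := fun h =>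
      ht (hx (tsupport_comp_sub_subset b x h))
    have h2 : fderiv ℝ (fun t => b.normed volume (x - t)) t = 0 :=
      image_eq_zero_of_notMem_tsupport fun h => h1 (tsupport_fderiv_subset ℝ h)
    rw [h2]; simp

theorem tendsto_mollify {d : ℕ} {F : Type*} [NormedAddCommGroup F] [NormedSpace ℝ F]
    [CompleteSpace F] {f : En d → F} {r : ℝ} (hr : 0 < r) {K : Set (En d)}
    (hg : Integrable (K.indicator f)) {x : En d} (hx : K ∈ 𝓝 x) (hf : ContinuousAt f x) :
    Tendsto (fun k => ((smallBump hr k).normed volume ⋆[ContinuousLinearMap.lsmul ℝ ℝ]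
      (K.indicator f)) x) atTop (𝓝 (f x)) := by
  have h1 : K.indicator f =ᶠ[𝓝 x] f := by
    filter_upwards [hx] with y hy using indicator_of_mem hy f
  have h2 : Tendsto (K.indicator f) (𝓝 x) (𝓝 (f x)) := hf.tendsto.congr' h1.symm
  exact ContDiffBump.convolution_tendsto_right (g := fun _ => K.indicator f) (k := fun _ => x)
    (tendsto_smallBump_rOut hr) (Eventually.of_forall fun _ => hg.aestronglyMeasurable)
    (h2.comp tendsto_snd) tendsto_const_nhds

theorem exists_const_along_of_integral_eq_zero {d : ℕ} {D : Set (En d)} (hD : IsOpen D)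
    {f : En d → En d} (hf : ContinuousOn f D) {v : En d}
    (h0 : ∀ ψ : En d → ℝ, ContDiff ℝ (⊤ : ℕ∞) ψ → HasCompactSupport ψ → tsupport ψ ⊆ D →
      ∫ x, fderiv ℝ ψ x v • f x = 0) {c : En d} (hc : c ∈ D) :
    ∃ δ > 0, ∀ s : ℝ, |s| < δ → f (c + s • v) = f c := by
  obtain ⟨R, hR, hRD⟩ := Metric.nhds_basis_closedBall.mem_iff.1 (hD.mem_nhds hc)
  have hr : 0 < R / 2 := half_pos hR
  set K := closedBall c R with hK
  have hg : Integrable (K.indicator f) := by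
    rw [integrable_indicator_iff isClosed_closedBall.measurableSet]
    exact (hf.mono hRD).integrableOn_compact (isCompact_closedBall c R)
  have hsub : ∀ x ∈ ball c (R / 2), ∀ k, closedBall x (smallBump (d := d) hr k).rOut ⊆ K := by
    intro x hx k
    apply closedBall_subset_closedBall'
    have := smallBump_rOut_lt (d := d) hr k
    have := mem_ball.1 hx
    linarith
  set F : ℕ → En d → En d := fun k =>
    (smallBump hr k).normed volume ⋆[ContinuousLinearMap.lsmul ℝ ℝ] (K.indicator f) with hF
  have hd : ∀ k, ∀ x ∈ ball c (R / 2), fderiv ℝ (F k) x v = 0 := by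
    intro k x hx
    simp only [hF]
    rw [fderiv_mollify_apply _ hg (hsub x hx k),
      h0 _ (contDiff_comp_sub _ x) (hasCompactSupport_comp_sub _ x)
        ((tsupport_comp_sub_subset _ x).trans ((hsub x hx k).trans hRD)), neg_zero]
  have hsm : ∀ k, Differentiable ℝ (F k) := fun k =>
    (((smallBump hr k).hasCompactSupport_normed).contDiff_convolution_left (n := 1) _
      (smallBump hr k).contDiff_normed hg.locallyIntegrable).differentiable (by norm_num)
  obtain ⟨δ, hδ, hδv⟩ : ∃ δ > 0, ∀ s : ℝ, |s| < δ → c + s • v ∈ ball c (R / 2) := by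
    have hcont : Continuous fun s : ℝ => c + s • v := by fun_prop
    have := hcont.continuousAt.preimage_mem_nhds (x := (0 : ℝ))
      (t := ball c (R / 2)) (by simpa using ball_mem_nhds c hr)
    obtain ⟨δ, hδ, h⟩ := Metric.mem_nhds_iff.1 this
    exact ⟨δ, hδ, fun s hs => h (by simpa [dist_eq_norm] using hs)⟩
  refine ⟨δ, hδ, fun s hs => ?_⟩
  have hcst : ∀ k, F k (c + s • v) = F k c := by
    intro k
    have hγ : ∀ t : ℝ,
        HasDerivAt (fun t : ℝ => F k (c + t • v)) (fderiv ℝ (F k) (c + t • v) v) t := by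
      intro t
      have h1 : HasDerivAt (fun t : ℝ => c + t • v) v t := by
        have h := ((hasDerivAt_id' t).smul_const v).const_add c
        rwa [one_smul] at h
      exact (hsm k _).hasFDerivAt.comp_hasDerivAt t h1
    have := (convex_ball (0 : ℝ) δ).is_const_of_fderivWithin_eq_zero (𝕜 := ℝ)
      (f := fun t : ℝ => F k (c + t • v))
          (fun t _ => (hγ t).differentiableAt.differentiableWithinAt)
      (fun t ht => by
        rw [fderivWithin_of_isOpen isOpen_ball ht]
        ext
        simp only [fderiv_eq_smul_deriv, zero_apply, (hγ t).deriv]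
        rw [hd k _ (hδv t (by simpa using ht))]; simp)
      (x := s) (y := 0) (by simpa using hs) (by simpa using hδ)
    simpa using this
  have hlim : ∀ x ∈ ball c (R / 2), Tendsto (fun k => F k x) atTop (𝓝 (f x)) := by
    intro x hx
    have hxK : K ∈ 𝓝 x := mem_of_superset (isOpen_ball.mem_nhds hx)
      (ball_subset_closedBall.trans (closedBall_subset_closedBall (by linarith)))
    exact tendsto_mollify hr hg hxK (hf.continuousAt (mem_of_superset hxK hRD))
  refine tendsto_nhds_unique (hlim _ (hδv s hs)) ?_
  simp_rw [hcst]
  exact hlim c (mem_ball_self hr)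

theorem not_const_along_of_discrete {d : ℕ} {D : Set (En d)} {f : En d → En d}
    (hf_discrete : ∀ y : En d, ∀ x ∈ D ∩ f ⁻¹' {y},
      ∃ U : Set (En d), IsOpen U ∧ x ∈ U ∧ U ∩ (D ∩ f ⁻¹' {y}) = {x}) (hD : IsOpen D)
    {v : En d} (hv : v ≠ 0) {c : En d} (hc : c ∈ D)
    (h : ∃ δ > 0, ∀ s : ℝ, |s| < δ → f (c + s • v) = f c) : False := by
  obtain ⟨δ, hδ, h⟩ := h
  obtain ⟨U, hU, hcU, hUe⟩ := hf_discrete (f c) c ⟨hc, rfl⟩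
  have hcont : Tendsto (fun s : ℝ => c + s • v) (𝓝[≠] 0) (𝓝 c) := by
    have : Continuous fun s : ℝ => c + s • v := by fun_prop
    have := this.tendsto 0
    simp only [zero_smul, add_zero] at this
    exact this.mono_left nhdsWithin_le_nhds
  have h1 : ∀ᶠ s in 𝓝[≠] (0 : ℝ), c + s • v ∈ U ∩ D :=
    hcont ((hU.inter hD).mem_nhds ⟨hcU, hc⟩)
  have h2 : ∀ᶠ s in 𝓝[≠] (0 : ℝ), |s| < δ := by
    apply nhdsWithin_le_nhds
    filter_upwards [ball_mem_nhds (0 : ℝ) hδ] with s hs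
    simpa using hs
  obtain ⟨s, hs⟩ := (h1.and (h2.and self_mem_nhdsWithin)).exists
  have : c + s • v ∈ U ∩ (D ∩ f ⁻¹' {f c}) := ⟨hs.1.1, hs.1.2, h s hs.2.1⟩
  rw [hUe, mem_singleton_iff, add_eq_left, smul_eq_zero] at this
  exact this.elim hs.2.2 hv

theorem integrable_smul_weakDeriv {d : ℕ} {D : Set (En d)} (hD : IsOpen D) (hDne : D.Nonempty)
    {f : En d → En d} (hf : ContinuousOn f D)
    (hf_discrete : ∀ y : En d, ∀ x ∈ D ∩ f ⁻¹' {y},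
      ∃ U : Set (En d), IsOpen U ∧ x ∈ U ∧ U ∩ (D ∩ f ⁻¹' {y}) = {x})
    {Df : En d → (En d →L[ℝ] En d)} (hDf : IsWeakDerivOn d D f Df) (v : En d)
    {ψ : En d → ℝ} (hψ : ContDiff ℝ (⊤ : ℕ∞) ψ) (hψc : HasCompactSupport ψ)
    (hψD : tsupport ψ ⊆ D) : Integrable fun x => ψ x • Df x v := by
  rcases eq_or_ne v 0 with rfl | hv
  · simp
  by_contra hni
  obtain ⟨c, hc⟩ := hDne
  have hψ0 : ∫ x, fderiv ℝ ψ x v • f x = 0 := by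
    rw [hDf.2.2 ψ hψ hψc hψD v, integral_undef hni, neg_zero]
  refine not_const_along_of_discrete hf_discrete hD hv hc
    (exists_const_along_of_integral_eq_zero hD hf (v := v) (fun η hη hηc hηD => ?_) hc)
  by_cases hi : Integrable fun x => η x • Df x v
  · have hsum : ¬ Integrable fun x => (η + ψ) x • Df x v := by
      intro h
      apply hni
      refine (h.sub hi).congr (Eventually.of_forall fun x => ?_)
      simp [add_smul]
    have hsD : tsupport (η + ψ) ⊆ D := (tsupport_add η ψ).trans (union_subset hηD hψD)
    have h1 := hDf.2.2 (η + ψ) (hη.add hψ) (hηc.add hψc) hsD v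
    rw [integral_undef hsum, neg_zero] at h1
    have hint : ∀ χ : En d → ℝ, ContDiff ℝ (⊤ : ℕ∞) χ → HasCompactSupport χ → tsupport χ ⊆ D →
        Integrable fun x => fderiv ℝ χ x v • f x := by
      intro χ hχ hχc hχD
      have hχ1 : ContDiff ℝ 1 χ := hχ.of_le (by exact_mod_cast le_top)
      have hcont : ContinuousOn (fun x => fderiv ℝ χ x v • f x) (tsupport χ) :=
        (((hχ1.continuous_fderiv one_ne_zero).clm_apply continuous_const).continuousOn).smul
          (hf.mono hχD)
      rw [← integrableOn_iff_integrable_of_support_subset (s := tsupport χ)]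
      · exact hcont.integrableOn_compact hχc
      · intro x hx
        by_contra hxs
        apply hx
        have : fderiv ℝ χ x = 0 :=
          image_eq_zero_of_notMem_tsupport fun h => hxs (tsupport_fderiv_subset ℝ h)
        simp [this]
    have hsplit : ∫ x, fderiv ℝ (η + ψ) x v • f x =
        (∫ x, fderiv ℝ η x v • f x) + ∫ x, fderiv ℝ ψ x v • f x := by
      rw [← integral_add (hint η hη hηc hηD) (hint ψ hψ hψc hψD)]
      congr 1
      ext1 x
      rw [fderiv_add (hη.differentiable (by simp) x) (hψ.differentiable (by simp) x)]
      simp [add_smul]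
    rw [hsplit, hψ0, add_zero] at h1
    exact h1
  · rw [hDf.2.2 η hη hηc hηD v, integral_undef hi, neg_zero]

theorem clm_eq_sum_smulRight {d : ℕ} (A : En d →L[ℝ] En d) :
    A = ∑ i : Fin d, (EuclideanSpace.proj i : En d →L[ℝ] ℝ).smulRight
      (A (EuclideanSpace.single i 1)) := by
  ext1 w
  have hw : w = ∑ i : Fin d, w i • EuclideanSpace.single i (1 : ℝ) := by
    have := (EuclideanSpace.basisFun (Fin d) ℝ).sum_repr w
    simpa using this.symm
  conv_lhs => rw [hw]
  rw [map_sum, sum_apply]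
  apply Finset.sum_congr rfl
  intro i _
  rw [map_smul]
  rfl

theorem integrable_clm_of_basis {d : ℕ} {μ : Measure (En d)} {A : En d → (En d →L[ℝ] En d)}
    (h : ∀ i, Integrable (fun x => A x (EuclideanSpace.single i 1)) μ) : Integrable A μ := by
  have hm : ∀ i : Fin d, AEStronglyMeasurable
      (fun x => (EuclideanSpace.proj i : En d →L[ℝ] ℝ).smulRight
        (A x (EuclideanSpace.single i 1))) μ := fun i =>
    (ContinuousLinearMap.smulRightL ℝ (En d) (En d)
      (EuclideanSpace.proj i : En d →L[ℝ] ℝ)).continuous.comp_aestronglyMeasurable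
      (h i).aestronglyMeasurable
  have hA : AEStronglyMeasurable A μ := by
    rw [show A = fun x => ∑ i : Fin d, (EuclideanSpace.proj i : En d →L[ℝ] ℝ).smulRight
      (A x (EuclideanSpace.single i 1)) from funext fun x => clm_eq_sum_smulRight (A x)]
    exact Finset.aestronglyMeasurable_fun_sum Finset.univ fun i _ => hm i
  have hg : Integrable (fun x => ∑ i : Fin d, ‖A x (EuclideanSpace.single i 1)‖) μ :=
    integrable_finsetSum Finset.univ fun i _ => (h i).norm
  refine hg.mono' hA (.of_forall fun x => ?_)
  refine ContinuousLinearMap.opNorm_le_bound _ (by positivity) fun w => ?_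
  conv_lhs => rw [clm_eq_sum_smulRight (A x), sum_apply]
  refine (norm_sum_le _ _).trans ?_
  rw [Finset.sum_mul]
  refine Finset.sum_le_sum fun i _ => ?_
  rw [ContinuousLinearMap.smulRight_apply, norm_smul, mul_comm]
  gcongr
  exact PiLp.norm_apply_le w i

theorem locallyIntegrableOn_weakDeriv {d : ℕ} {D : Set (En d)} (hD : IsOpen D)
    {f : En d → En d} (hf : ContinuousOn f D)
    (hf_discrete : ∀ y : En d, ∀ x ∈ D ∩ f ⁻¹' {y},
      ∃ U : Set (En d), IsOpen U ∧ x ∈ U ∧ U ∩ (D ∩ f ⁻¹' {y}) = {x})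
    {Df : En d → (En d →L[ℝ] En d)} (hDf : IsWeakDerivOn d D f Df) :
    LocallyIntegrableOn Df D := by
  have hv : ∀ v, LocallyIntegrableOn (fun x => Df x v) D := by
    intro v c hc
    obtain ⟨R, hR, hRD⟩ := Metric.nhds_basis_closedBall.mem_iff.1 (hD.mem_nhds hc)
    let b : ContDiffBump c := ⟨R / 2, R, half_pos hR, half_lt_self hR⟩
    have hb : tsupport b ⊆ D := by rw [b.tsupport_eq]; exact hRD
    have h1 := integrable_smul_weakDeriv hD ⟨c, hc⟩ hf hf_discrete hDf v b.contDiff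
      b.hasCompactSupport hb
    refine ⟨closedBall c (R / 2), mem_nhdsWithin_of_mem_nhds (closedBall_mem_nhds c (half_pos hR)),
      ?_⟩
    refine (h1.integrableOn (s := closedBall c (R / 2))).congr_fun (fun x hx => ?_)
      isClosed_closedBall.measurableSet
    have : b x = 1 := b.one_of_mem_closedBall hx
    simp [this]
  intro c hc
  choose s hs hint using fun i => hv (EuclideanSpace.single i 1) c hc
  refine ⟨⋂ i, s i, (Filter.iInter_mem).2 hs, ?_⟩
  exact integrable_clm_of_basis fun i => (hint i).mono_set (iInter_subset s i)

theorem norm_mollify_le {d : ℕ} {F : Type*} [NormedAddCommGroup F] [NormedSpace ℝ F]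
    (b : ContDiffBump (0 : En d)) (W : En d → F) (x : En d) :
    ‖(b.normed volume ⋆[ContinuousLinearMap.lsmul ℝ ℝ] W) x‖ ≤
      (b.normed volume ⋆[ContinuousLinearMap.lsmul ℝ ℝ] (fun z => ‖W z‖)) x := by
  rw [convolution_def, convolution_def]
  refine (norm_integral_le_integral_norm _).trans (le_of_eq ?_)
  congr 1
  ext1 t
  simp only [ContinuousLinearMap.lsmul_apply, norm_smul, smul_eq_mul]
  rw [Real.norm_of_nonneg (b.nonneg_normed t)]

theorem exists_mollify_close {d : ℕ} {F : Type*} [NormedAddCommGroup F] [NormedSpace ℝ F]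
    [CompleteSpace F] {r : ℝ} (hr : 0 < r) {W : En d → F} (hW : Integrable W) {ε : ℝ≥0∞}
    (hε : 0 < ε) (j : ℕ) : ∃ k, j ≤ k ∧
      ∫⁻ x, ‖((smallBump hr k).normed volume ⋆[ContinuousLinearMap.lsmul ℝ ℝ] W) x - W x‖ₑ
        < ε := by
  by_contra! hcon
  let N : En d → ℝ := fun z => ‖W z‖
  have hN : Integrable N := hW.norm
  let φ : ℕ → En d → ℝ := fun k => (smallBump hr k).normed volume
  have hφ : ∀ k, Integrable (φ k) := fun k => (smallBump hr k).integrable_normed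
  let u : ℕ → En d → F := fun k => φ k ⋆[ContinuousLinearMap.lsmul ℝ ℝ] W
  let w : ℕ → En d → ℝ := fun k => φ k ⋆[ContinuousLinearMap.lsmul ℝ ℝ] N
  have huint : ∀ k, Integrable (u k) := fun k => (hφ k).integrable_convolution _ hW
  have hwint : ∀ k, Integrable (w k) := fun k => (hφ k).integrable_convolution _ hN
  have hw0 : ∀ k x, 0 ≤ w k x := fun k x =>
    (norm_nonneg _).trans (norm_mollify_le (smallBump hr k) W x)
  have hrr : ∀ᶠ k in atTop, (smallBump (d := d) hr k).rOut ≤ 2 * (smallBump (d := d) hr k).rIn :=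
    .of_forall fun k => by simp [smallBump]; linarith
  have hu := ContDiffBump.ae_convolution_tendsto_right_of_locallyIntegrable
    (tendsto_smallBump_rOut (d := d) hr) hrr hW.locallyIntegrable
  have hw := ContDiffBump.ae_convolution_tendsto_right_of_locallyIntegrable
    (tendsto_smallBump_rOut (d := d) hr) hrr hN.locallyIntegrable
  set B : ℝ≥0∞ := ∫⁻ x, ‖W x‖ₑ with hB
  have hBtop : B ≠ ∞ := hW.2.ne
  have hwB : ∀ k, ∫⁻ x, ENNReal.ofReal (w k x) = B := by
    intro k
    rw [← ofReal_integral_eq_lintegral_ofReal (hwint k) (.of_forall (hw0 k)),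
      integral_convolution _ (hφ k) hN]
    simp only [ContinuousLinearMap.lsmul_apply]
    rw [(smallBump hr k).integral_normed, one_smul,
      ofReal_integral_eq_lintegral_ofReal hN (.of_forall fun x => norm_nonneg _)]
    simp only [N, ofReal_norm, hB]
  let a : ℕ → En d → ℝ≥0∞ := fun k x => ‖u k x - W x‖ₑ
  let b : ℕ → En d → ℝ≥0∞ := fun k x => ENNReal.ofReal (w k x) + ‖W x‖ₑ
  have ham : ∀ k, AEMeasurable (a k) := fun k => ((huint k).sub hW).aestronglyMeasurable.enorm
  have hbm : ∀ k, AEMeasurable (b k) := fun k =>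
    (hwint k).aemeasurable.ennreal_ofReal.add hW.aestronglyMeasurable.enorm
  have hab : ∀ k x, a k x ≤ b k x := fun k x => by
    refine (enorm_sub_le).trans (add_le_add ?_ le_rfl)
    rw [← ofReal_norm]
    exact ENNReal.ofReal_le_ofReal (norm_mollify_le (smallBump hr k) W x)
  have hbB : ∀ k, ∫⁻ x, b k x = B + B := fun k => by
    rw [lintegral_add_right' _ hW.aestronglyMeasurable.enorm, hwB]
  have hab_int : ∀ k, j ≤ k → ∫⁻ x, (b k x - a k x) ≤ B + B - ε := fun k hk => by
    have h1 : ∫⁻ x, a k x ≠ ∞ := ((lintegral_mono (hab k)).trans_lt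
      (by rw [hbB]; exact ENNReal.add_lt_top.2 ⟨hBtop.lt_top, hBtop.lt_top⟩)).ne
    rw [lintegral_sub' (ham k) h1 (.of_forall (hab k)), hbB]
    exact tsub_le_tsub_left (hcon k hk) _
  have hfatou : B + B ≤ B + B - ε := by
    calc B + B = ∫⁻ x, (‖W x‖ₑ + ‖W x‖ₑ) := by
          rw [lintegral_add_left' hW.aestronglyMeasurable.enorm]
      _ = ∫⁻ x, liminf (fun k => b k x - a k x) atTop := by
          apply lintegral_congr_ae
          filter_upwards [hu, hw] with x hux hwx
          have h1 : Tendsto (fun k => a k x) atTop (𝓝 0) := by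
            have := (hux.sub_const (W x)).enorm
            simpa [a, u] using this
          have h2 : Tendsto (fun k => b k x) atTop (𝓝 (‖W x‖ₑ + ‖W x‖ₑ)) := by
            have := (ENNReal.tendsto_ofReal hwx).add_const ‖W x‖ₑ
            simpa [b, w, N, ofReal_norm] using this
          have h3 := ENNReal.Tendsto.sub h2 h1 (.inr ENNReal.zero_ne_top)
          rw [tsub_zero] at h3
          exact h3.liminf_eq.symm
      _ ≤ liminf (fun k => ∫⁻ x, (b k x - a k x)) atTop :=
          lintegral_liminf_le' fun k => (hbm k).sub (ham k)
      _ ≤ B + B - ε := by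
          refine liminf_le_of_frequently_le' ?_
          exact (eventually_atTop.2 ⟨j, hab_int⟩).frequently
  have hpos : B + B ≠ 0 := by
    intro h0
    have h1 := hcon j le_rfl
    have h2 : ∫⁻ x, a j x ≤ B + B := (lintegral_mono (hab j)).trans_eq (hbB j)
    rw [h0] at h2
    exact absurd (h1.trans h2) (not_le.2 hε)
  exact absurd hfatou (not_le.2 (ENNReal.sub_lt_self
    (ENNReal.add_ne_top.2 ⟨hBtop, hBtop⟩) hpos hε.ne'))

theorem fderiv_mollify_eq {d : ℕ} {D : Set (En d)} {f : En d → En d}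
    {Df : En d → (En d →L[ℝ] En d)} (hDf : IsWeakDerivOn d D f Df) {K : Set (En d)}
    (hKD : K ⊆ D) (hfK : Integrable (K.indicator f)) (hDfK : Integrable (K.indicator Df))
    (b : ContDiffBump (0 : En d)) {x : En d} (hx : closedBall x b.rOut ⊆ K) :
    fderiv ℝ (b.normed volume ⋆[ContinuousLinearMap.lsmul ℝ ℝ] (K.indicator f)) x =
      (b.normed volume ⋆[ContinuousLinearMap.lsmul ℝ ℝ] (K.indicator Df)) x := by
  ext1 v
  have hsub := tsupport_comp_sub_subset b x
  have hcont : Continuous fun t => b.normed volume (x - t) := (contDiff_comp_sub b x).continuous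
  have hint : Integrable fun t => b.normed volume (x - t) • K.indicator Df t :=
    hDfK.locallyIntegrable.integrable_smul_left_of_hasCompactSupport hcont
      (hasCompactSupport_comp_sub b x)
  rw [fderiv_mollify_apply b hfK hx, hDf.2.2 _ (contDiff_comp_sub b x)
    (hasCompactSupport_comp_sub b x) ((hsub.trans hx).trans hKD) v, neg_neg,
    convolution_eq_swap]
  simp only [ContinuousLinearMap.lsmul_apply]
  rw [ContinuousLinearMap.integral_apply hint]
  congr 1
  ext1 t
  by_cases ht : t ∈ K
  · rw [indicator_of_mem ht]; rfl
  · have h1 : b.normed volume (x - t) = 0 :=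
      image_eq_zero_of_notMem_tsupport (f := fun t => b.normed volume (x - t))
        fun h => ht (hx (hsub h))
    simp [h1]

theorem integrable_indicator_of_integrableOn {d : ℕ} {F : Type*} [NormedAddCommGroup F]
    {K : Set (En d)} (hK : MeasurableSet K) {g : En d → F} (hg : IntegrableOn g K) :
    Integrable (K.indicator g) :=
  (integrable_indicator_iff hK).2 hg

theorem exists_smooth_approx {d : ℕ} {D : Set (En d)} {f : En d → En d} (hf : ContinuousOn f D)
    {Df : En d → (En d →L[ℝ] En d)} (hDf : IsWeakDerivOn d D f Df)
    (hloc : LocallyIntegrableOn Df D) {c : En d} {R : ℝ} (hR : 0 < R)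
    (hcD : closedBall c (2 * R) ⊆ D) :
    ∃ v : ℕ → En d → En d, (∀ k, ContDiff ℝ 1 (v k)) ∧
      (∀ x ∈ ball c R, Tendsto (fun k => v k x) atTop (𝓝 (f x))) ∧
      ∑' k, ∫⁻ z in ball c R, ‖fderiv ℝ (v k) z - Df z‖ₑ ≠ ∞ := by
  set K := closedBall c (2 * R) with hK
  have hfK : Integrable (K.indicator f) :=
    integrable_indicator_of_integrableOn measurableSet_closedBall
        ((hf.mono hcD).integrableOn_compact (isCompact_closedBall c _))
  have hDfK : Integrable (K.indicator Df) :=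
    integrable_indicator_of_integrableOn (F := En d →L[ℝ] En d) measurableSet_closedBall
        (hloc.integrableOn_compact_subset hcD (isCompact_closedBall c _))
  have hpos : ∀ j : ℕ, (0 : ℝ≥0∞) < 2⁻¹ ^ j := fun j => ENNReal.pow_pos (by simp) j
  choose κ hκ hκε using fun j => exists_mollify_close hR hDfK (hpos j) j
  have hκt : Tendsto κ atTop atTop := tendsto_atTop_mono hκ tendsto_id
  refine ⟨fun j => (smallBump hR (κ j)).normed volume ⋆[ContinuousLinearMap.lsmul ℝ ℝ]
    (K.indicator f), fun k => ?_, fun x hx => ?_, ?_⟩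
  · exact (smallBump hR (κ k)).hasCompactSupport_normed.contDiff_convolution_left _
      (smallBump hR (κ k)).contDiff_normed hfK.locallyIntegrable
  · have hxK : K ∈ 𝓝 x := mem_of_superset (isOpen_ball.mem_nhds hx)
      (ball_subset_closedBall.trans (closedBall_subset_closedBall (by linarith)))
    have hxD : ContinuousAt f x := (hf.mono hcD).continuousAt hxK
    exact (tendsto_mollify hR hfK hxK hxD).comp hκt
  · have hle : ∀ j, ∫⁻ z in ball c R, ‖fderiv ℝ ((smallBump hR (κ j)).normed volume
        ⋆[ContinuousLinearMap.lsmul ℝ ℝ] (K.indicator f)) z - Df z‖ₑ ≤ 2⁻¹ ^ j := by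
      intro j
      refine le_trans ?_ (hκε j).le
      refine le_trans (le_of_eq ?_) (setLIntegral_le_lintegral (ball c R) _)
      refine setLIntegral_congr_fun measurableSet_ball fun z hz => ?_
      have hzK : closedBall z (smallBump (d := d) hR (κ j)).rOut ⊆ K := by
        refine closedBall_subset_closedBall' ?_
        have := smallBump_rOut_lt (d := d) hR (κ j)
        have := mem_ball.1 hz
        linarith
      have hzK' : z ∈ K := hzK (mem_closedBall_self (smallBump hR (κ j)).rOut_pos.le)
      simp only [fderiv_mollify_eq hDf hcD hfK hDfK _ hzK, indicator_of_mem hzK']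
    refine ne_top_of_le_ne_top ?_ (ENNReal.tsum_le_tsum hle)
    rw [ENNReal.tsum_geometric, ENNReal.one_sub_inv_two, inv_inv]
    exact ENNReal.ofNat_ne_top

/-- `f` is approximable by smooth maps on balls of `D`, pointwise and with derivatives converging
fast in `L¹` to the measurable field `W`. -/
structure SmoothApprox {d : ℕ} (D : Set (En d)) (f : En d → En d)
    (W : En d → (En d →L[ℝ] En d)) : Prop where
  stronglyMeasurable : StronglyMeasurable W
  locallyIntegrableOn : LocallyIntegrableOn W D
  exists_approx : ∀ c R, 0 < R → closedBall c (2 * R) ⊆ D →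
    ∃ v : ℕ → En d → En d, (∀ k, ContDiff ℝ 1 (v k)) ∧
      (∀ x ∈ ball c R, Tendsto (fun k => v k x) atTop (𝓝 (f x))) ∧
      ∑' k, ∫⁻ z in ball c R, ‖fderiv ℝ (v k) z - W z‖ₑ ≠ ∞

theorem exists_smoothApprox {d : ℕ} {D : Set (En d)} (hD : IsOpen D) {f : En d → En d}
    (hf : ContinuousOn f D)
    (hf_discrete : ∀ y : En d, ∀ x ∈ D ∩ f ⁻¹' {y},
      ∃ U : Set (En d), IsOpen U ∧ x ∈ U ∧ U ∩ (D ∩ f ⁻¹' {y}) = {x})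
    {Df : En d → (En d →L[ℝ] En d)} (hDf : IsWeakDerivOn d D f Df) :
    ∃ W, SmoothApprox D f W ∧ Df =ᵐ[volume.restrict D] W := by
  have hloc := locallyIntegrableOn_weakDeriv hD hf hf_discrete hDf
  have hsm := hloc.aestronglyMeasurable
  have hae : Df =ᵐ[volume.restrict D] hsm.mk Df := hsm.ae_eq_mk
  refine ⟨hsm.mk Df, ⟨hsm.stronglyMeasurable_mk, ?_, ?_⟩, hae⟩
  · intro x hx
    obtain ⟨s, hs, hsi⟩ := hloc x hx
    refine ⟨s ∩ D, inter_mem hs self_mem_nhdsWithin, ?_⟩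
    refine (hsi.mono_set inter_subset_left).congr_fun_ae ?_
    exact ae_mono (Measure.restrict_mono inter_subset_right le_rfl) hae
  · intro c R hR hcD
    obtain ⟨v, hv, hlim, hsum⟩ := exists_smooth_approx hf hDf hloc hR hcD
    refine ⟨v, hv, hlim, ?_⟩
    convert hsum using 3 with k
    apply lintegral_congr_ae
    have hsub : ball c R ⊆ D :=
      (ball_subset_closedBall.trans (closedBall_subset_closedBall (by linarith))).trans hcD
    filter_upwards [ae_mono (Measure.restrict_mono hsub le_rfl) hae] with z hz
    rw [hz]

theorem enorm_sub_le_add_enorm_sub {F : Type*} [NormedAddCommGroup F] (a b c : F) :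
    ‖a - c‖ₑ ≤ ‖b - c‖ₑ + ‖a - b‖ₑ := by
  rw [add_comm, ← sub_add_sub_cancel a b c]
  exact enorm_add_le _ _

theorem ae_eventually_mean_le {d : ℕ} {F : Type*} [NormedAddCommGroup F] {W : En d → F}
    (hW : LocallyIntegrable W) : ∀ᵐ x, ∀ η : ℝ≥0∞, 0 < η → ∃ δ > 0, ∀ s, 0 < s → s < δ →
      ∫⁻ z in ball x s, ‖W z - W x‖ₑ ≤ η * volume (ball (0 : En d) s) := by
  filter_upwards [(Besicovitch.vitaliFamily (volume : Measure (En d))).ae_tendsto_lintegral_enorm_sub_div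
      hW]
    with x hx η hη
  have h1 := (hx.comp (Besicovitch.tendsto_filterAt volume x)).eventually (gt_mem_nhds hη)
  rw [eventually_nhdsWithin_iff, Metric.eventually_nhds_iff] at h1
  obtain ⟨δ, hδ, h2⟩ := h1
  refine ⟨δ, hδ, fun s hs hsδ => ?_⟩
  have h3 := h2 (y := s) (by rw [Real.dist_eq, sub_zero, abs_of_pos hs]; exact hsδ) hs
  have h4 : volume (closedBall x s) = volume (ball (0 : En d) s) := by
    rw [Measure.addHaar_closedBall _ _ hs.le, Measure.addHaar_ball_of_pos _ _ hs]
  simp only [comp_apply] at h3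
  rw [h4, ENNReal.div_lt_iff (.inl (volume_ball_pos_ne_zero hs)) (.inl (volume_ball_ne_top _ _))]
    at h3
  exact (lintegral_mono_set ball_subset_closedBall).trans h3.le

theorem ball_mean_add_le {d : ℕ} {F : Type*} [NormedAddCommGroup F] {W : En d → F} {A : F}
    {η : ℝ≥0∞} {y : En d} {s : ℝ} (hA : ‖W y - A‖ₑ ≤ η)
    (h : ∫⁻ z in ball y s, ‖W z - W y‖ₑ ≤ η * volume (ball (0 : En d) s)) :
    ∫⁻ z in ball y s, ‖W z - A‖ₑ ≤ 2 * η * volume (ball (0 : En d) s) := by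
  have hv : volume (ball y s) = volume (ball (0 : En d) s) := by
    rw [Measure.addHaar_ball_center]
  calc ∫⁻ z in ball y s, ‖W z - A‖ₑ ≤ ∫⁻ z in ball y s, (‖W z - W y‖ₑ + η) := by
        refine lintegral_mono fun z => ?_
        rw [add_comm]
        exact (enorm_sub_le_add_enorm_sub _ (W y) _).trans (add_le_add hA le_rfl)
    _ = (∫⁻ z in ball y s, ‖W z - W y‖ₑ) + η * volume (ball (0 : En d) s) := by
        rw [lintegral_add_right _ measurable_const, setLIntegral_const, hv]
    _ ≤ _ := by rw [two_mul, add_mul]; exact add_le_add h le_rfl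

theorem enorm_sub_clm_le {d : ℕ} {f : En d → En d} {W : En d → (En d →L[ℝ] En d)}
    (hW : StronglyMeasurable W) {c : En d} {R : ℝ} {v : ℕ → En d → En d}
    (hv : ∀ k, ContDiff ℝ 1 (v k))
    (hlim : ∀ x ∈ ball c R, Tendsto (fun k => v k x) atTop (𝓝 (f x)))
    {x y : En d} {ρ : ℝ} (hρ : 0 < ρ) (hρR : ρ ≤ R) (hsub : ball x ρ ⊆ ball c R)
    (hy : y ∈ ball x ρ) {A : En d →L[ℝ] En d} {κ : ℝ≥0∞}
    (hgx : Tendsto (fun k => ballPotential R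
      ((ball c R).indicator (fun z => ‖fderiv ℝ (v k) z - W z‖ₑ)) x) atTop (𝓝 0))
    (hgy : Tendsto (fun k => ballPotential R
      ((ball c R).indicator (fun z => ‖fderiv ℝ (v k) z - W z‖ₑ)) y) atTop (𝓝 0))
    (hx1 : ∀ s, 0 < s → s < 2 * ρ →
      ∫⁻ z in ball x s, ‖W z - A‖ₑ ≤ κ * volume (ball (0 : En d) s))
    (hy1 : ∀ s, 0 < s → s < 2 * ρ →
      ∫⁻ z in ball y s, ‖W z - A‖ₑ ≤ κ * volume (ball (0 : En d) s)) :
    ‖f x - f y - A (x - y)‖ₑ ≤ 2 * (ENNReal.ofReal (2 * 2 ^ d * ρ) * κ) := by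
  have hWm : Measurable W := hW.measurable
  have hmono : ∀ w, Tendsto (fun k => ballPotential R
      ((ball c R).indicator (fun z => ‖fderiv ℝ (v k) z - W z‖ₑ)) w) atTop (𝓝 0) →
      Tendsto (fun k => ballPotential ρ
      ((ball x ρ).indicator (fun z => ‖fderiv ℝ (v k) z - W z‖ₑ)) w) atTop (𝓝 0) := by
    intro w hw
    refine tendsto_of_tendsto_of_tendsto_of_le_of_le tendsto_const_nhds hw
      (fun _ => zero_le) fun k => ballPotential_mono (fun z => ?_) hρR w
    exact indicator_le_indicator_of_subset hsub (fun _ => zero_le) z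
  have hvd : ∀ k z, fderiv ℝ (fun z => v k z - A z) z = fderiv ℝ (v k) z - A := fun k z => by
    rw [fderiv_fun_sub ((hv k).differentiable (by simp) z) A.differentiableAt, A.fderiv]
  have hpot : ∀ w, (∀ s, 0 < s → s < 2 * ρ →
      ∫⁻ z in ball w s, ‖W z - A‖ₑ ≤ κ * volume (ball (0 : En d) s)) →
      ballPotential ρ ((ball x ρ).indicator fun z => ‖W z - A‖ₑ) w ≤
        ENNReal.ofReal (2 * 2 ^ d * ρ) * κ := fun w hw =>
    ballPotential_le_of_mean_le fun s hs hs2 =>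
      (lintegral_mono fun z => indicator_le_self _ _ z).trans (hw s hs hs2)
  have key := enorm_sub_le_ballPotential_of_tendsto (u := fun z => f z - A z)
    (v := fun k z => v k z - A z) hρ (c := x)
    (fun k => ((hv k).sub A.contDiff).contDiffOn) (h := fun z => ‖W z - A‖ₑ)
    (g := fun k z => ‖fderiv ℝ (v k) z - W z‖ₑ) (hWm.sub_const A).enorm
    (fun k => (((hv k).continuous_fderiv (by simp)).measurable.sub hWm).enorm)
    (fun k z _ => by
      rw [hvd]
      exact enorm_sub_le_add_enorm_sub (F := En d →L[ℝ] En d) _ _ _)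
    (fun z hz => (hlim z (hsub hz)).sub_const _) (mem_ball_self hρ) hy (hmono x hgx) (hmono y hgy)
  have heq : f x - f y - A (x - y) = f x - A x - (f y - A y) := by rw [map_sub]; abel
  rw [heq, two_mul]
  exact key.trans (add_le_add (hpot x hx1) (hpot y hy1))

theorem exists_local_lipschitz_pieces {d : ℕ} {D : Set (En d)} {f : En d → En d}
    {W : En d → (En d →L[ℝ] En d)} (hS : SmoothApprox D f W) {c : En d} {R : ℝ} (hR : 0 < R)
    (hcD : closedBall c (2 * R) ⊆ D) :
    ∃ Z : Set (En d), volume Z = 0 ∧ ∀ ε : ℝ, 0 < ε → ∃ T : ℕ × ℕ × ℕ → Set (En d),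
      ball c R \ Z ⊆ ⋃ i, T i ∧ ∀ i, T i ⊆ ball c R ∧ ∀ x ∈ T i, ∀ y ∈ T i,
        ‖f x - f y - W x (x - y)‖ ≤ ε * ‖x - y‖ := by
  obtain ⟨v, hv, hlim, hsum⟩ := hS.exists_approx c R hR hcD
  set W' : En d → (En d →L[ℝ] En d) := (ball c R).indicator W with hW'
  have hWm' : StronglyMeasurable W' := hS.stronglyMeasurable.indicator measurableSet_ball
  have hsubK : ball c R ⊆ closedBall c (2 * R) :=
    ball_subset_closedBall.trans (closedBall_subset_closedBall (by linarith))
  have hWint : Integrable W' :=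
    integrable_indicator_of_integrableOn (F := En d →L[ℝ] En d) measurableSet_ball
      ((hS.locallyIntegrableOn.integrableOn_compact_subset hcD
        (isCompact_closedBall c _)).mono_set hsubK)
  have heqW : ∀ z ∈ ball c R, W' z = W z := fun z hz => indicator_of_mem hz W
  have hleb := ae_eventually_mean_le hWint.locallyIntegrable
  have hgm : ∀ k, Measurable fun z => ‖fderiv ℝ (v k) z - W' z‖ₑ := fun k =>
    (((hv k).continuous_fderiv (by simp)).measurable.sub hWm'.measurable).enorm
  have hgsum : ∑' k, ∫⁻ z, (ball c R).indicator (fun z => ‖fderiv ℝ (v k) z - W' z‖ₑ) z ≠ ∞ := by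
    convert hsum using 3 with k
    rw [lintegral_indicator measurableSet_ball]
    exact setLIntegral_congr_fun measurableSet_ball fun z hz => by simp only [heqW z hz]
  have hpot := ae_tendsto_ballPotential
    (fun k => (hgm k).indicator (measurableSet_ball (x := c) (ε := R))) hgsum R
  refine ⟨{x | ¬ _}, ae_iff.1 (hleb.and hpot), fun ε hε => ?_⟩
  set η : ℝ := ε / (16 * 2 ^ d) with hη
  have hηpos : 0 < η := by positivity
  have hηe : (0 : ℝ≥0∞) < ENNReal.ofReal η := ENNReal.ofReal_pos.2 hηpos
  let q := TopologicalSpace.denseSeq (En d →L[ℝ] En d)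
  let a := TopologicalSpace.denseSeq (En d)
  refine ⟨fun i => {x | ((∀ s, 0 < s → s < 1 / ((i.1 : ℝ) + 1) →
      ∫⁻ z in ball x s, ‖W' z - W' x‖ₑ ≤ ENNReal.ofReal η * volume (ball (0 : En d) s)) ∧
      Tendsto (fun k => ballPotential R ((ball c R).indicator
        (fun z => ‖fderiv ℝ (v k) z - W' z‖ₑ)) x) atTop (𝓝 0)) ∧
      x ∈ ball c R ∧ ball x (1 / ((i.1 : ℝ) + 1)) ⊆ ball c R ∧ 1 / ((i.1 : ℝ) + 1) ≤ R ∧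
      ‖W' x - q i.2.1‖ < η / 2 ∧ dist x (a i.2.2) < 1 / ((i.1 : ℝ) + 1) / 16}, ?_, ?_⟩
  · rintro x ⟨hxB, hxZ⟩
    have hx := not_not.1 hxZ
    obtain ⟨δ, hδ, h1⟩ := hx.1 _ hηe
    obtain ⟨r, hr, h2⟩ := Metric.isOpen_iff.1 isOpen_ball x hxB
    obtain ⟨k, hk⟩ := exists_nat_one_div_lt (lt_min hδ (lt_min hr hR))
    obtain ⟨hk1, hk2⟩ := lt_min_iff.1 hk
    obtain ⟨hk2, hk3⟩ := lt_min_iff.1 hk2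
    obtain ⟨j, hj⟩ := (TopologicalSpace.denseRange_denseSeq (En d →L[ℝ] En d)).exists_dist_lt
      (W' x) (half_pos hηpos)
    obtain ⟨l, hl⟩ := (TopologicalSpace.denseRange_denseSeq (En d)).exists_dist_lt
      x (show 0 < 1 / ((k : ℝ) + 1) / 16 by positivity)
    refine mem_iUnion.2 ⟨(k, j, l), ⟨fun s hs hsk => h1 s hs (hsk.trans hk1), hx.2⟩, hxB,
      (ball_subset_ball hk2.le).trans h2, hk3.le, ?_, hl⟩
    rwa [dist_eq_norm] at hj
  · rintro ⟨k, j, l⟩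
    refine ⟨fun x hx => hx.2.1, ?_⟩
    rintro x ⟨⟨hx1, hx2⟩, hxB, hxsub, hkR, hxq, hxa⟩ y ⟨⟨hy1, hy2⟩, hyB, -, -, hyq, hya⟩
    simp only at hx1 hy1 hxsub hkR hxa hya hxq hyq
    rcases eq_or_ne x y with rfl | hne
    · simp
    have hxy : dist x y < 1 / ((k : ℝ) + 1) / 8 := by
      have := dist_triangle_right x y (a l)
      linarith
    have hpos : 0 < dist x y := dist_pos.2 hne
    have hkey := enorm_sub_clm_le hWm' hv hlim (x := x) (y := y) (ρ := 2 * dist x y)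
      (by positivity) (by linarith)
      ((ball_subset_ball (by linarith)).trans hxsub)
      (by rw [mem_ball, dist_comm]; linarith) (A := W' x) (κ := 2 * ENNReal.ofReal η)
      hx2 hy2
      (fun s hs hsρ => ball_mean_add_le (F := En d →L[ℝ] En d)
        (by rw [sub_self, ← ofReal_norm, norm_zero]; simp)
        (hx1 s hs (by linarith)))
      (fun s hs hsρ => ball_mean_add_le (F := En d →L[ℝ] En d) (by
          rw [← ofReal_norm]
          refine ENNReal.ofReal_le_ofReal ?_
          have := norm_sub_le_norm_sub_add_norm_sub (W' y) (q j) (W' x)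
          rw [norm_sub_rev (q j)] at this
          linarith)
        (hy1 s hs (by linarith)))
    have h2 : ∀ t : ℝ, 0 < t → 2 * (ENNReal.ofReal (2 * 2 ^ d * (2 * t)) *
        (2 * ENNReal.ofReal η)) = ENNReal.ofReal (ε * t) := by
      intro t ht
      rw [show (2 : ℝ≥0∞) = ENNReal.ofReal 2 by simp, ← ENNReal.ofReal_mul (by norm_num),
        ← ENNReal.ofReal_mul (by positivity), ← ENNReal.ofReal_mul (by norm_num)]
      congr 1
      rw [hη]
      field_simp
      ring
    rw [h2 _ hpos, ← ofReal_norm, ENNReal.ofReal_le_ofReal_iff (by positivity), heqW x hxB,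
      dist_eq_norm] at hkey
    exact hkey

theorem exists_seq_ball_cover {d : ℕ} {D : Set (En d)} (hD : IsOpen D) (hne : D.Nonempty) :
    ∃ (c : ℕ → En d) (R : ℕ → ℝ), (∀ i, 0 < R i ∧ closedBall (c i) (2 * R i) ⊆ D) ∧
      D ⊆ ⋃ i, ball (c i) (R i) := by
  have h : ∀ x ∈ D, ∃ r > 0, closedBall x (2 * r) ⊆ D := fun x hx => by
    obtain ⟨r, hr, hrD⟩ := Metric.nhds_basis_closedBall.mem_iff.1 (hD.mem_nhds hx)
    exact ⟨r / 2, half_pos hr, by rwa [mul_div_cancel₀ r two_ne_zero]⟩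
  choose! r hr hrD using h
  obtain ⟨t, htD, htc, hDt⟩ := TopologicalSpace.countable_cover_nhdsWithin
    (f := fun x => ball x (r x)) fun x hx => mem_nhdsWithin_of_mem_nhds (ball_mem_nhds x (hr x hx))
  have htne : t.Nonempty := by
    rcases t.eq_empty_or_nonempty with rfl | h
    · obtain ⟨x, hx⟩ := hne
      simpa using hDt hx
    · exact h
  obtain ⟨c, rfl⟩ := htc.exists_eq_range htne
  refine ⟨c, fun i => r (c i), fun i => ⟨hr _ (htD ⟨i, rfl⟩), hrD _ (htD ⟨i, rfl⟩)⟩, ?_⟩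
  simpa using hDt

/-- Outside a null set, `f` is up to any `ε` affine with derivative `W` on countably many pieces. -/
theorem exists_lipschitz_pieces {d : ℕ} {D : Set (En d)} (hD : IsOpen D) (hne : D.Nonempty)
    {f : En d → En d} {W : En d → (En d →L[ℝ] En d)} (hS : SmoothApprox D f W) :
    ∃ Z : Set (En d), volume Z = 0 ∧ ∀ ε : ℝ, 0 < ε → ∃ T : ℕ → Set (En d),
      D \ Z ⊆ ⋃ i, T i ∧ ∀ i, T i ⊆ D ∧ ∀ x ∈ T i, ∀ y ∈ T i,
        ‖f x - f y - W x (x - y)‖ ≤ ε * ‖x - y‖ := by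
  obtain ⟨c, R, hcR, hcov⟩ := exists_seq_ball_cover hD hne
  choose Z hZ hT using fun i => exists_local_lipschitz_pieces hS (hcR i).1 (hcR i).2
  refine ⟨⋃ i, Z i, measure_iUnion_null hZ, fun ε hε => ?_⟩
  choose T hTcov hTi using fun i => hT i ε hε
  let e : ℕ ≃ ℕ × ℕ × ℕ × ℕ := (Denumerable.eqv _).symm
  refine ⟨fun i => T (e i).1 (e i).2, ?_, fun i => ⟨?_, (hTi (e i).1 (e i).2).2⟩⟩
  · rintro x ⟨hxD, hxZ⟩
    obtain ⟨i, hi⟩ := mem_iUnion.1 (hcov hxD)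
    obtain ⟨k, hk⟩ := mem_iUnion.1 (hTcov i ⟨hi, fun h => hxZ (mem_iUnion.2 ⟨i, h⟩)⟩)
    exact mem_iUnion.2 ⟨e.symm (i, k), by simpa using hk⟩
  · refine (hTi (e i).1 (e i).2).1.trans (Subset.trans ?_ (hcR (e i).1).2)
    exact ball_subset_closedBall.trans
      (closedBall_subset_closedBall (by linarith [(hcR (e i).1).1]))

/-- Graph parametrisation over the hyperplane `range L` of a cap of the sphere `S(x₀, t)`. -/
def capMap {m n : ℕ} (x₀ : En n) (L : En m →ₗᵢ[ℝ] En n) (e : En n) (t : ℝ) (z : En m) : En n :=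
  x₀ + L z + √(t ^ 2 - ‖z‖ ^ 2) • e

theorem exists_isometry_orthogonal {m n : ℕ} (hmn : n = m + 1) {e : En n} (he : ‖e‖ = 1) :
    ∃ L : En m →ₗᵢ[ℝ] En n, (∀ z, inner ℝ (L z) e = 0) ∧
      ∀ w, inner ℝ w e = 0 → ∃ z, L z = w := by
  have he0 : e ≠ 0 := fun h => by simp [h] at he
  have : Fact (Module.finrank ℝ (En n) = m + 1) := ⟨by simp [hmn]⟩
  have hfin : Module.finrank ℝ (ℝ ∙ e)ᗮ = m := Submodule.finrank_orthogonal_span_singleton he0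
  let b := (stdOrthonormalBasis ℝ (ℝ ∙ e)ᗮ).reindex (finCongr hfin)
  refine ⟨(ℝ ∙ e)ᗮ.subtypeₗᵢ.comp b.repr.symm.toLinearIsometry, fun z => ?_, fun w hw => ?_⟩
  · have h := (b.repr.symm z).2
    rw [Submodule.mem_orthogonal_singleton_iff_inner_left] at h
    exact h
  · refine ⟨b.repr ⟨w, Submodule.mem_orthogonal_singleton_iff_inner_left.2 hw⟩, ?_⟩
    simp

section Cap

variable {m n : ℕ} (x₀ : En n) {L : En m →ₗᵢ[ℝ] En n} {e : En n}

theorem continuous_capMap : Continuous fun q : ℝ × En m => capMap x₀ L e q.1 q.2 := by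
  unfold capMap
  have := L.continuous
  fun_prop

theorem norm_add_smul_sq (he : ‖e‖ = 1) (hLe : ∀ z, inner ℝ (L z) e = 0) (z : En m) (s : ℝ) :
    ‖L z + s • e‖ ^ 2 = ‖z‖ ^ 2 + s ^ 2 := by
  rw [norm_add_sq_real, inner_smul_right, hLe, L.norm_map, norm_smul, he]
  simp

theorem dist_capMap (he : ‖e‖ = 1) (hLe : ∀ z, inner ℝ (L z) e = 0) {t : ℝ} (ht : 0 ≤ t)
    {z : En m} (hz : ‖z‖ ≤ t) : dist (capMap x₀ L e t z) x₀ = t := by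
  rw [dist_eq_norm, capMap, add_assoc, add_sub_cancel_left,
    ← sq_eq_sq₀ (norm_nonneg _) ht, norm_add_smul_sq he hLe,
    Real.sq_sqrt (by nlinarith [norm_nonneg z])]
  ring

theorem inner_capMap (he : ‖e‖ = 1) (hLe : ∀ z, inner ℝ (L z) e = 0) (t : ℝ) (z : En m) :
    inner ℝ (capMap x₀ L e t z - x₀) e = √(t ^ 2 - ‖z‖ ^ 2) := by
  rw [capMap, add_assoc, add_sub_cancel_left, inner_add_left, hLe, inner_smul_left,
    real_inner_self_eq_norm_sq, he]
  simp

theorem exists_capMap_eq (he : ‖e‖ = 1) (hLe : ∀ z, inner ℝ (L z) e = 0)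
    (hsurj : ∀ w, inner ℝ w e = 0 → ∃ z, L z = w) {t : ℝ} {x : En n}
    (hx : dist x x₀ = t) (hxe : 0 ≤ inner ℝ (x - x₀) e) :
    ∃ z, ‖z‖ ≤ t ∧ capMap x₀ L e t z = x := by
  set s := inner ℝ (x - x₀) e with hs
  obtain ⟨z, hz⟩ := hsurj (x - x₀ - s • e) (by
    rw [inner_sub_left, inner_smul_left, real_inner_self_eq_norm_sq, he, ← hs]; simp)
  have h1 : x - x₀ = L z + s • e := by rw [hz]; abel
  have h2 : t ^ 2 = ‖z‖ ^ 2 + s ^ 2 := by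
    rw [← norm_add_smul_sq he hLe, ← h1, ← dist_eq_norm, hx]
  refine ⟨z, ?_, ?_⟩
  · rw [← hx] at h2 ⊢
    exact (sq_le_sq₀ (norm_nonneg z) dist_nonneg).1 (by nlinarith)
  · rw [capMap, show t ^ 2 - ‖z‖ ^ 2 = s ^ 2 by linarith, Real.sqrt_sq hxe, add_assoc, ← h1]
    abel

theorem exists_lipschitz_leftInverse_capMap (he : ‖e‖ = 1) (hLe : ∀ z, inner ℝ (L z) e = 0) :
    ∃ G : En n → ℝ × En m, LipschitzWith 1 G ∧
      ∀ t z, 0 ≤ t → ‖z‖ ≤ t → G (capMap x₀ L e t z) = (t, z) := by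
  let P : En n →L[ℝ] En m := ContinuousLinearMap.adjoint L.toContinuousLinearMap
  have hP : ‖P‖ ≤ 1 := by
    rw [LinearIsometryEquiv.norm_map]
    exact L.norm_toContinuousLinearMap_le
  have hPL : ∀ z, P (L z) = z := fun z => ext_inner_right ℝ fun w => by
    rw [ContinuousLinearMap.adjoint_inner_left]
    exact L.inner_map_map z w
  have hPe : P e = 0 := ext_inner_right ℝ fun w => by
    rw [ContinuousLinearMap.adjoint_inner_left, inner_zero_left, real_inner_comm]
    exact hLe w
  refine ⟨fun x => (dist x x₀, P (x - x₀)), ?_, fun t z ht hz => ?_⟩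
  · refine LipschitzWith.of_dist_le_mul fun x y => ?_
    rw [Prod.dist_eq, NNReal.coe_one, one_mul]
    refine max_le (dist_dist_dist_le_left x y x₀) ?_
    rw [dist_eq_norm, ← map_sub, sub_sub_sub_cancel_right, dist_eq_norm]
    exact (P.le_opNorm _).trans (mul_le_of_le_one_left (norm_nonneg _) hP)
  · simp only [dist_capMap x₀ he hLe ht hz, Prod.mk.injEq, true_and]
    rw [capMap, add_assoc, add_sub_cancel_left, map_add, map_smul, hPL, hPe, smul_zero, add_zero]

theorem exists_volume_capMap_preimage_le (hmn : n = m + 1) (he : ‖e‖ = 1)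
    (hLe : ∀ z, inner ℝ (L z) e = 0) :
    ∃ C : ℝ≥0∞, C ≠ ∞ ∧ ∀ A : Set (En n),
      volume ({q : ℝ × En m | ‖q.2‖ ≤ q.1} ∩ (fun q => capMap x₀ L e q.1 q.2) ⁻¹' A) ≤
        C * volume A := by
  have h1 : (Module.finrank ℝ (En n) : ℝ) = (n : ℝ) := by simp
  have h2 : (Module.finrank ℝ (ℝ × En m) : ℝ) = (n : ℝ) := by simp [hmn, add_comm]
  have i1 : (μH[(n : ℝ)] : Measure (En n)).IsAddHaarMeasure := by
    rw [← h1]; exact isAddHaarMeasure_hausdorffMeasure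
  have i2 : (μH[(n : ℝ)] : Measure (ℝ × En m)).IsAddHaarMeasure := by
    rw [← h2]; exact isAddHaarMeasure_hausdorffMeasure
  have i3 : (volume : Measure (ℝ × En m)).IsAddHaarMeasure := by
    rw [Measure.volume_eq_prod]; infer_instance
  have e1 := Measure.isAddLeftInvariant_eq_smul (μH[(n : ℝ)] : Measure (En n)) volume
  have e2 := Measure.isAddLeftInvariant_eq_smul (volume : Measure (ℝ × En m)) μH[(n : ℝ)]
  set C₁ := Measure.addHaarScalarFactor (μH[(n : ℝ)] : Measure (En n)) volume
  set C₂ := Measure.addHaarScalarFactor (volume : Measure (ℝ × En m)) μH[(n : ℝ)]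
  refine ⟨C₂ * C₁, ENNReal.mul_ne_top ENNReal.coe_ne_top ENNReal.coe_ne_top, fun A => ?_⟩
  obtain ⟨G, hG, hGc⟩ := exists_lipschitz_leftInverse_capMap x₀ he hLe
  set S := {q : ℝ × En m | ‖q.2‖ ≤ q.1} ∩ (fun q => capMap x₀ L e q.1 q.2) ⁻¹' A
  have hS : S ⊆ G '' A := fun q hq => ⟨_, hq.2, hGc _ _ ((norm_nonneg _).trans hq.1) hq.1⟩
  have h3 : μH[(n : ℝ)] S ≤ μH[(n : ℝ)] A := by
    refine (measure_mono hS).trans ?_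
    have := hG.hausdorffMeasure_image_le (d := (n : ℝ)) n.cast_nonneg A
    simpa using this
  rw [e2, Measure.smul_apply, ENNReal.smul_def, smul_eq_mul, mul_assoc]
  refine mul_le_mul_right ?_ _
  refine h3.trans (le_of_eq ?_)
  rw [e1, Measure.smul_apply, ENNReal.smul_def, smul_eq_mul]

theorem exists_lintegral_capMap_le (hmn : n = m + 1) (he : ‖e‖ = 1)
    (hLe : ∀ z, inner ℝ (L z) e = 0) :
    ∃ C : ℝ≥0∞, C ≠ ∞ ∧ ∀ F : En n → ℝ≥0∞, Measurable F →
      ∫⁻ t : ℝ, ∫⁻ z : En m in closedBall 0 t, F (capMap x₀ L e t z) ≤ C * ∫⁻ x, F x := by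
  obtain ⟨C, hC, hle⟩ := exists_volume_capMap_preimage_le x₀ hmn he hLe
  refine ⟨C, hC, fun F hF => ?_⟩
  set V := {q : ℝ × En m | ‖q.2‖ ≤ q.1}
  set Ψ : ℝ × En m → En n := fun q => capMap x₀ L e q.1 q.2
  have hV : MeasurableSet V := measurableSet_le (by fun_prop) (by fun_prop)
  have hΨ : Measurable Ψ := (continuous_capMap x₀).measurable
  have hmap : Measure.map Ψ (volume.restrict V) ≤ C • volume := by
    refine Measure.le_iff.2 fun A hA => ?_
    rw [Measure.map_apply hΨ hA, Measure.restrict_apply (hΨ hA), inter_comm]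
    exact hle A
  calc ∫⁻ t : ℝ, ∫⁻ z : En m in closedBall 0 t, F (capMap x₀ L e t z)
      = ∫⁻ q : ℝ × En m, V.indicator (fun q => F (Ψ q)) q := by
        rw [Measure.volume_eq_prod, lintegral_prod _
          (show Measurable (V.indicator fun q => F (Ψ q)) from
            (hF.comp hΨ).indicator hV).aemeasurable]
        refine lintegral_congr fun t => ?_
        rw [← lintegral_indicator measurableSet_closedBall]
        refine lintegral_congr fun z => ?_
        simp only [indicator, mem_closedBall_zero_iff]
        rfl
    _ = ∫⁻ x, F x ∂(Measure.map Ψ (volume.restrict V)) := by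
        rw [lintegral_indicator hV, lintegral_map hF hΨ]
    _ ≤ ∫⁻ x, F x ∂(C • volume) := lintegral_mono' hmap le_rfl
    _ = C * ∫⁻ x, F x := by rw [lintegral_smul_measure, smul_eq_mul]

theorem ae_lintegral_capMap_ne_top (hmn : n = m + 1) (he : ‖e‖ = 1)
    (hLe : ∀ z, inner ℝ (L z) e = 0) {F : En n → ℝ≥0∞} (hF : Measurable F)
    (hfin : ∫⁻ x, F x ≠ ∞) :
    ∀ᵐ t : ℝ, ∫⁻ z : En m in closedBall 0 t, F (capMap x₀ L e t z) ≠ ∞ := by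
  obtain ⟨C, hC, hle⟩ := exists_lintegral_capMap_le x₀ hmn he hLe
  have hmeas : Measurable fun t : ℝ => ∫⁻ z : En m in closedBall 0 t, F (capMap x₀ L e t z) := by
    have hV : MeasurableSet {q : ℝ × En m | ‖q.2‖ ≤ q.1} :=
      measurableSet_le (by fun_prop) (by fun_prop)
    have h := (((hF.comp (continuous_capMap x₀ (L := L) (e := e)).measurable).indicator
      hV).lintegral_prod_right' (ν := volume))
    convert h using 2 with t
    rw [← lintegral_indicator measurableSet_closedBall]
    refine lintegral_congr fun z => ?_
    simp only [indicator, mem_closedBall_zero_iff]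
    rfl
  have := ae_lt_top hmeas (ne_top_of_le_ne_top (ENNReal.mul_ne_top hC hfin) (hle F hF))
  filter_upwards [this] with t ht using ht.ne

theorem ae_volume_capMap_preimage_eq_zero (hmn : n = m + 1) (he : ‖e‖ = 1)
    (hLe : ∀ z, inner ℝ (L z) e = 0) {Z : Set (En n)} (hZ : volume Z = 0) :
    ∀ᵐ t : ℝ, volume {z : En m | ‖z‖ ≤ t ∧ capMap x₀ L e t z ∈ Z} = 0 := by
  obtain ⟨C, hC, hle⟩ := exists_volume_capMap_preimage_le x₀ hmn he hLe
  have h := hle Z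
  rw [hZ, mul_zero, nonpos_iff_eq_zero] at h
  exact Measure.ae_ae_of_ae_prod (measure_eq_zero_iff_ae_notMem.1 h) |>.mono fun t ht =>
    measure_eq_zero_iff_ae_notMem.2 ht

end Cap

theorem oscConst_ne_top {m : ℕ} {a : ℕ → ℝ≥0∞} (h : dyadicConst m a ≠ ∞) :
    oscConst m a ≠ ∞ := by
  unfold oscConst
  refine ENNReal.mul_ne_top (ENNReal.mul_ne_top (by simp) (ENNReal.add_ne_top.2 ⟨by simp, ?_⟩))
    (ENNReal.add_ne_top.2 ⟨by simp, h⟩)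
  exact ENNReal.inv_ne_top.2 (volume_ball_pos_ne_zero one_pos)

theorem hausdorffMeasure_image_slice_eq_zero {m n : ℕ} (hm : 2 ≤ m) {a : ℕ → ℝ≥0∞}
    (ha0 : ∀ k, a k ≠ 0) (hat : ∀ k, a k ≠ ∞) (ha : dyadicConst m a ≠ ∞)
    {f : En n → En n} {W : En n → (En n →L[ℝ] En n)} (hW : StronglyMeasurable W)
    {c : En n} {R : ℝ} (hf : ContinuousOn f (ball c R)) {v : ℕ → En n → En n}
    (hv : ∀ k, ContDiff ℝ 1 (v k))
    (hlim : ∀ x ∈ ball c R, Tendsto (fun k => v k x) atTop (𝓝 (f x)))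
    {Ω : Set (En m)} (hΩ : IsOpen Ω) {Φ : En m → En n} (hΦ : Continuous Φ)
    (hΦd : ContDiffOn ℝ 1 Φ Ω) {M : ℝ≥0∞} (hM : M ≠ ∞) (hΦM : ∀ z ∈ Ω, ‖fderiv ℝ Φ z‖ₑ ≤ M)
    (hΩB : ∀ z ∈ Ω, Φ z ∈ ball c R)
    (hsum : ∑' k, ∫⁻ z in Ω, ‖fderiv ℝ (v k) (Φ z) - W (Φ z)‖ₑ ≠ ∞)
    (hθ : ∫⁻ z in Ω, levelWeight a (fun x => ‖W x‖ₑ) (Φ z) ≠ ∞)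
    {Z : Set (En m)} (hZΩ : Z ⊆ Ω) (hZ : volume Z = 0) :
    μH[(m : ℝ)] ((fun z => f (Φ z)) '' Z) = 0 := by
  have hWm : Measurable W := hW.measurable
  refine hausdorffMeasure_image_eq_zero_of_osc (by omega) hΩ hZΩ hZ hθ
    (C := 2 * (M * oscConst m a))
    (ENNReal.mul_ne_top (by simp) (ENNReal.mul_ne_top hM (oscConst_ne_top ha))) ?_
  intro c' R' hR' hsub
  let g : ℕ → En m → ℝ≥0∞ := fun k z => ‖fderiv ℝ (v k) (Φ z) - W (Φ z)‖ₑ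
  let h : En m → ℝ≥0∞ := fun z => ‖W (Φ z)‖ₑ
  have hgm : ∀ k, Measurable (g k) := fun k =>
    ((((hv k).continuous_fderiv (by simp)).comp hΦ).measurable.sub
      (hWm.comp hΦ.measurable)).enorm
  have hhm : Measurable h := (hWm.comp hΦ.measurable).enorm
  have hpot := ae_tendsto_ballPotential (g := fun k => Ω.indicator (g k))
    (fun k => (hgm k).indicator hΩ.measurableSet) (by
      simp only [lintegral_indicator hΩ.measurableSet]; exact hsum) R'
  set B : ℝ≥0∞ := (∫⁻ z in ball c' R', levelWeight a (fun x => ‖W x‖ₑ) (Φ z)) ^ ((1 : ℝ) / m)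
  have hd : ∀ k, ∀ z ∈ Ω, ‖fderiv ℝ (fun w => v k (Φ w)) z‖ₑ ≤ M * h z + M * g k z := by
    intro k z hz
    have h1 := ((hv k).differentiable (by simp) (Φ z)).hasFDerivAt.comp z
      ((hΦd.contDiffAt (hΩ.mem_nhds hz)).differentiableAt (by simp)).hasFDerivAt
    have h2 : fderiv ℝ (fun w => v k (Φ w)) z = (fderiv ℝ (v k) (Φ z)).comp (fderiv ℝ Φ z) :=
      h1.fderiv
    rw [h2, ← mul_add, mul_comm]
    have h3 : ‖(fderiv ℝ (v k) (Φ z)).comp (fderiv ℝ Φ z)‖ₑ ≤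
        ‖fderiv ℝ (v k) (Φ z)‖ₑ * ‖fderiv ℝ Φ z‖ₑ := by
      rw [← ofReal_norm, ← ofReal_norm, ← ofReal_norm, ← ENNReal.ofReal_mul (norm_nonneg _)]
      exact ENNReal.ofReal_le_ofReal (ContinuousLinearMap.opNorm_comp_le _ _)
    refine h3.trans (mul_le_mul' ?_ (hΦM z hz))
    have := enorm_sub_le_add_enorm_sub (F := En n →L[ℝ] En n) (fderiv ℝ (v k) (Φ z)) (W (Φ z)) 0
    rwa [sub_zero, sub_zero] at this
  have hgoodlim : ∀ z, Tendsto (fun k => ballPotential R' (Ω.indicator (g k)) z) atTop (𝓝 0) →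
      Tendsto (fun k => ballPotential R' ((ball c' R').indicator fun w => M * g k w) z)
        atTop (𝓝 0) := by
    intro z hz
    have h1 : Tendsto (fun k => M * ballPotential R' (Ω.indicator (g k)) z) atTop (𝓝 0) := by
      have := ENNReal.Tendsto.const_mul (a := M) hz (.inr hM)
      rwa [mul_zero] at this
    refine tendsto_of_tendsto_of_tendsto_of_le_of_le tendsto_const_nhds h1
      (fun _ => zero_le) fun k => ?_
    simp only
    rw [← ballPotential_const_mul ((hgm k).indicator hΩ.measurableSet)]
    refine ballPotential_mono (fun w => ?_) le_rfl z
    by_cases hw : w ∈ ball c' R'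
    · rw [indicator_of_mem hw, indicator_of_mem (hsub hw)]
    · rw [indicator_of_notMem hw]; exact zero_le
  have hhpot : ∀ x, ballPotential R' ((ball c' R').indicator fun z => M * h z) x ≤
      M * oscConst m a * B := by
    intro x
    have e1 : ((ball c' R').indicator fun z => M * h z) =
        fun z => M * (ball c' R').indicator h z := by
      ext1 z; by_cases hz : z ∈ ball c' R' <;> simp [hz]
    rw [e1, ballPotential_const_mul (hhm.indicator measurableSet_ball), mul_assoc]
    gcongr
    exact ballPotential_le_levelWeight hm ha0 hat hhm (fun z => enorm_ne_top) R' c' x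
  have hae : ∀ x ∈ ball c' R', ∀ y ∈ ball c' R',
      Tendsto (fun k => ballPotential R' (Ω.indicator (g k)) x) atTop (𝓝 0) →
      Tendsto (fun k => ballPotential R' (Ω.indicator (g k)) y) atTop (𝓝 0) →
      edist (f (Φ x)) (f (Φ y)) ≤ 2 * (M * oscConst m a) * B := by
    intro x hx y hy hgx hgy
    have key := enorm_sub_le_ballPotential_of_tendsto (u := fun z => f (Φ z))
      (v := fun k z => v k (Φ z)) hR' (c := c')
      (fun k => (hv k).comp_contDiffOn (hΦd.mono hsub)) (h := fun z => M * h z)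
      (g := fun k z => M * g k z) (hhm.const_mul M) (fun k => (hgm k).const_mul M)
      (fun k z hz => hd k z (hsub hz)) (fun z hz => hlim _ (hΩB z (hsub hz))) hx hy
      (hgoodlim x hgx) (hgoodlim y hgy)
    rw [edist_eq_enorm_sub, mul_assoc 2, two_mul]
    exact key.trans (add_le_add (hhpot x) (hhpot y))
  have hdense : Dense {x | Tendsto (fun k => ballPotential R' (Ω.indicator (g k)) x)
      atTop (𝓝 0)} := Measure.dense_of_ae hpot
  have hu : ContinuousOn (fun z => f (Φ z)) (ball c' R') :=
    hf.comp hΦ.continuousOn fun z hz => hΩB z (hsub hz)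
  intro x hx y hy
  obtain ⟨xs, hxs, hxt⟩ := mem_closure_iff_seq_limit.1
    (hdense.open_subset_closure_inter isOpen_ball hx)
  obtain ⟨ys, hys, hyt⟩ := mem_closure_iff_seq_limit.1
    (hdense.open_subset_closure_inter isOpen_ball hy)
  have hx' := ((hu.continuousAt (isOpen_ball.mem_nhds hx)).tendsto).comp hxt
  have hy' := ((hu.continuousAt (isOpen_ball.mem_nhds hy)).tendsto).comp hyt
  exact le_of_tendsto (hx'.edist hy') (.of_forall fun k =>
    hae _ (hxs k).1 _ (hys k).1 (hxs k).2 (hys k).2)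

theorem abs_sqrt_sub_sqrt_le {m : ℕ} {t l : ℝ} (hl : 0 < l) {z w : En m} (hz : ‖z‖ < t)
    (hw : ‖w‖ < t) (hzl : l < √(t ^ 2 - ‖z‖ ^ 2)) (hwl : l < √(t ^ 2 - ‖w‖ ^ 2)) :
    |√(t ^ 2 - ‖z‖ ^ 2) - √(t ^ 2 - ‖w‖ ^ 2)| ≤ t / l * ‖z - w‖ := by
  have ha := Real.sq_sqrt (show 0 ≤ t ^ 2 - ‖z‖ ^ 2 by nlinarith [norm_nonneg z])
  have hb := Real.sq_sqrt (show 0 ≤ t ^ 2 - ‖w‖ ^ 2 by nlinarith [norm_nonneg w])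
  set a := √(t ^ 2 - ‖z‖ ^ 2)
  set b := √(t ^ 2 - ‖w‖ ^ 2)
  have h1 : |a - b| * (a + b) = |‖z‖ - ‖w‖| * (‖z‖ + ‖w‖) := by
    have h2 : (a - b) * (a + b) = -((‖z‖ - ‖w‖) * (‖z‖ + ‖w‖)) := by nlinarith
    rw [← abs_of_pos (show 0 < a + b by linarith), ← abs_mul, h2, abs_neg, abs_mul,
      abs_of_nonneg (show 0 ≤ ‖z‖ + ‖w‖ by positivity)]
  have h3 := abs_norm_sub_norm_le z w
  have h4 : |a - b| * (2 * l) ≤ ‖z - w‖ * (2 * t) := by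
    calc |a - b| * (2 * l) ≤ |a - b| * (a + b) :=
          mul_le_mul_of_nonneg_left (by linarith) (abs_nonneg _)
      _ = |‖z‖ - ‖w‖| * (‖z‖ + ‖w‖) := h1
      _ ≤ ‖z - w‖ * (2 * t) := by
          apply mul_le_mul h3 (by linarith) (by positivity) (norm_nonneg _)
  rw [div_mul_eq_mul_div, le_div_iff₀ hl]
  nlinarith

section Cap

variable {m n : ℕ} (x₀ : En n) {L : En m →ₗᵢ[ℝ] En n} {e : En n}

theorem continuous_sqrt_sub_norm (t : ℝ) :
    Continuous fun z : En m => √(t ^ 2 - ‖z‖ ^ 2) := by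
  fun_prop

theorem contDiffAt_capMap {t l : ℝ} (hl : 0 < l) {z : En m} (hzl : l < √(t ^ 2 - ‖z‖ ^ 2)) :
    ContDiffAt ℝ 1 (capMap x₀ L e t) z := by
  have h0 : t ^ 2 - ‖z‖ ^ 2 ≠ 0 := fun h => by rw [h, Real.sqrt_zero] at hzl; linarith
  have h1 : ContDiffAt ℝ 1 (fun z : En m => √(t ^ 2 - ‖z‖ ^ 2)) z :=
    (contDiffAt_const.sub (contDiff_norm_sq ℝ).contDiffAt).sqrt h0
  exact (contDiffAt_const.add L.toContinuousLinearMap.contDiff.contDiffAt).add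
    (h1.smul contDiffAt_const)

theorem enorm_fderiv_capMap_le (he : ‖e‖ = 1) {t l : ℝ} (hl : 0 < l) {z : En m} (hz : ‖z‖ < t)
    (hzl : l < √(t ^ 2 - ‖z‖ ^ 2)) :
    ‖fderiv ℝ (capMap x₀ L e t) z‖ₑ ≤ ENNReal.ofReal (1 + t / l) := by
  have ht : 0 < t := (norm_nonneg z).trans_lt hz
  rw [← ofReal_norm]
  refine ENNReal.ofReal_le_ofReal (norm_fderiv_le_of_lip' ℝ (by positivity) ?_)
  filter_upwards [continuous_norm.continuousAt.eventually_lt_const hz,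
    (continuous_sqrt_sub_norm t).continuousAt.eventually_const_lt hzl] with w hw hwl
  have h1 : capMap x₀ L e t w - capMap x₀ L e t z
      = L (w - z) + (√(t ^ 2 - ‖w‖ ^ 2) - √(t ^ 2 - ‖z‖ ^ 2)) • e := by
    rw [capMap, capMap, map_sub, sub_smul]; abel
  rw [h1, add_mul, one_mul]
  refine (norm_add_le _ _).trans (add_le_add (L.norm_map _).le ?_)
  rw [norm_smul, he, mul_one, Real.norm_eq_abs]
  exact abs_sqrt_sub_sqrt_le hl hw hz hwl hzl

theorem ae_hausdorffMeasure_image_cap_eq_zero (hm : 2 ≤ m) (hmn : n = m + 1) (he : ‖e‖ = 1)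
    (hLe : ∀ z, inner ℝ (L z) e = 0) (hsurj : ∀ w, inner ℝ w e = 0 → ∃ z, L z = w) {a : ℕ → ℝ≥0∞}
    (ha0 : ∀ k, a k ≠ 0) (hat : ∀ k, a k ≠ ∞) (ha : dyadicConst m a ≠ ∞)
    {f : En n → En n} {W : En n → (En n →L[ℝ] En n)} (hW : StronglyMeasurable W)
    {c : En n} {R : ℝ} (hf : ContinuousOn f (ball c R)) {v : ℕ → En n → En n}
    (hv : ∀ k, ContDiff ℝ 1 (v k))
    (hlim : ∀ x ∈ ball c R, Tendsto (fun k => v k x) atTop (𝓝 (f x)))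
    (hsum : ∑' k, ∫⁻ x in ball c R, ‖fderiv ℝ (v k) x - W x‖ₑ ≠ ∞)
    (hθ : ∫⁻ x in ball c R, levelWeight a (fun x => ‖W x‖ₑ) x ≠ ∞)
    {Z : Set (En n)} (hZ : volume Z = 0) {l : ℝ} (hl : 0 < l) :
    ∀ᵐ t : ℝ, μH[(m : ℝ)]
      (f '' {x | x ∈ Z ∧ x ∈ ball c R ∧ dist x x₀ = t ∧ l < inner ℝ (x - x₀) e}) = 0 := by
  have hWm : Measurable W := hW.measurable
  have hgm : ∀ k, Measurable fun x => ‖fderiv ℝ (v k) x - W x‖ₑ := fun k =>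
    (((hv k).continuous_fderiv (by simp)).measurable.sub hWm).enorm
  have hF1 := ae_lintegral_capMap_ne_top x₀ hmn he hLe
    (F := fun x => ∑' k, (ball c R).indicator (fun x => ‖fderiv ℝ (v k) x - W x‖ₑ) x)
    (Measurable.tsum fun k => (hgm k).indicator measurableSet_ball) (by
      rw [lintegral_tsum fun k => ((hgm k).indicator measurableSet_ball).aemeasurable]
      simpa only [lintegral_indicator measurableSet_ball] using hsum)
  have hF2 := ae_lintegral_capMap_ne_top x₀ hmn he hLe
    (F := (ball c R).indicator (levelWeight a (fun x => ‖W x‖ₑ)))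
    ((measurable_levelWeight hWm.enorm).indicator measurableSet_ball) (by
      simpa only [lintegral_indicator measurableSet_ball] using hθ)
  filter_upwards [hF1, hF2, ae_volume_capMap_preimage_eq_zero x₀ hmn he hLe hZ] with t h1 h2 h3
  set Ω : Set (En m) := {z | ‖z‖ < t ∧ l < √(t ^ 2 - ‖z‖ ^ 2) ∧ capMap x₀ L e t z ∈ ball c R}
    with hΩdef
  have hcont : Continuous (capMap x₀ L e t) :=
    (continuous_capMap x₀).comp (Continuous.prodMk_right t)
  have hΩ : IsOpen Ω := (isOpen_lt continuous_norm continuous_const).inter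
    ((isOpen_lt continuous_const (continuous_sqrt_sub_norm t)).inter
      (isOpen_ball.preimage hcont))
  have hsub : Ω ⊆ closedBall 0 t := fun z hz => by simpa using hz.1.le
  have hsub' : ∀ z ∈ Ω, capMap x₀ L e t z ∈ ball c R := fun z hz => hz.2.2
  refine measure_mono_null ?_ (hausdorffMeasure_image_slice_eq_zero (Ω := Ω) hm ha0 hat
      ha hW hf hv hlim
    hΩ hcont (fun z hz => (contDiffAt_capMap x₀ hl hz.2.1).contDiffWithinAt)
    (M := ENNReal.ofReal (1 + t / l)) ENNReal.ofReal_ne_top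
    (fun z hz => enorm_fderiv_capMap_le x₀ he hl hz.1 hz.2.1) hsub' ?_ ?_
    (Z := Ω ∩ {z | ‖z‖ ≤ t ∧ capMap x₀ L e t z ∈ Z}) inter_subset_left
    (measure_mono_null inter_subset_right h3))
  · rintro _ ⟨x, ⟨hxZ, hxB, hxt, hxe⟩, rfl⟩
    obtain ⟨z, hz, rfl⟩ := exists_capMap_eq x₀ he hLe hsurj hxt (hl.le.trans hxe.le)
    rw [inner_capMap x₀ he hLe] at hxe
    refine ⟨z, ⟨⟨lt_of_le_of_ne hz fun h => ?_, hxe, hxB⟩, hz, hxZ⟩, rfl⟩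
    rw [h, sub_self, Real.sqrt_zero] at hxe
    linarith
  · refine ne_top_of_le_ne_top h1 ?_
    rw [lintegral_tsum (f := fun k z => (ball c R).indicator
      (fun x => ‖fderiv ℝ (v k) x - W x‖ₑ) (capMap x₀ L e t z)) fun k =>
      (((hgm k).indicator measurableSet_ball).comp hcont.measurable).aemeasurable]
    refine ENNReal.tsum_le_tsum fun k => ?_
    refine le_trans (le_of_eq ?_) (lintegral_mono_set hsub)
    refine setLIntegral_congr_fun hΩ.measurableSet fun z hz => ?_
    exact (indicator_of_mem (s := ball c R)
      (hsub' z hz) (fun x => ‖fderiv ℝ (v k) x - W x‖ₑ)).symm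
  · refine ne_top_of_le_ne_top h2 ?_
    refine le_trans (le_of_eq ?_) (lintegral_mono_set hsub)
    refine setLIntegral_congr_fun hΩ.measurableSet fun z hz => ?_
    exact (indicator_of_mem (hsub' z hz) _).symm

end Cap

/-- A null set meets almost every sphere about `x₀` in a set with `H^{n-1}`-null image. -/
theorem ae_hausdorffMeasure_image_sphere_eq_zero {m n : ℕ} (hm : 2 ≤ m) (hmn : n = m + 1)
    {a : ℕ → ℝ≥0∞} (ha0 : ∀ k, a k ≠ 0) (hat : ∀ k, a k ≠ ∞) (ha : dyadicConst m a ≠ ∞)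
    {D : Set (En n)} (hD : IsOpen D) (hne : D.Nonempty)
    {f : En n → En n} {W : En n → (En n →L[ℝ] En n)} (hf : ContinuousOn f D)
    (hS : SmoothApprox D f W)
    (hθ : ∀ K ⊆ D, IsCompact K → ∫⁻ x in K, levelWeight a (fun x => ‖W x‖ₑ) x ≠ ∞)
    (x₀ : En n) {Z : Set (En n)} (hZ : volume Z = 0) :
    ∀ᵐ t : ℝ, 0 < t → μH[(m : ℝ)] (f '' (Z ∩ (D ∩ sphere x₀ t))) = 0 := by
  obtain ⟨c, R, hcR, hcov⟩ := exists_seq_ball_cover hD hne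
  let e : Fin n × Bool → En n := fun q =>
    (if q.2 then (1 : ℝ) else -1) • EuclideanSpace.single q.1 (1 : ℝ)
  have he : ∀ q, ‖e q‖ = 1 := fun q => by
    obtain ⟨i, s⟩ := q
    cases s <;> simp [e]
  have key : ∀ (i : ℕ) (q : Fin n × Bool) (j : ℕ), ∀ᵐ t : ℝ, μH[(m : ℝ)]
      (f '' {x | x ∈ Z ∧ x ∈ ball (c i) (R i) ∧ dist x x₀ = t ∧
        1 / ((j : ℝ) + 1) < inner ℝ (x - x₀) (e q)}) = 0 := by
    intro i q j
    obtain ⟨hRi, hsub⟩ := hcR i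
    have hBD : ball (c i) (R i) ⊆ D :=
      (ball_subset_closedBall.trans (closedBall_subset_closedBall (by linarith))).trans hsub
    obtain ⟨L, hL1, hL2⟩ := exists_isometry_orthogonal hmn (he q)
    obtain ⟨v, hv1, hv2, hv3⟩ := hS.exists_approx (c i) (R i) hRi hsub
    refine ae_hausdorffMeasure_image_cap_eq_zero x₀ hm hmn (he q) hL1 hL2 ha0 hat ha
      hS.stronglyMeasurable (hf.mono hBD) hv1 hv2 hv3 ?_ hZ (by positivity)
    refine ne_top_of_le_ne_top (hθ _ hsub (isCompact_closedBall _ _)) (lintegral_mono_set ?_)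
    exact ball_subset_closedBall.trans (closedBall_subset_closedBall (by linarith))
  have key' := ae_all_iff.2 fun i => ae_all_iff.2 fun q => ae_all_iff.2 fun j => key i q j
  filter_upwards [key'] with t ht ht0
  refine measure_mono_null ?_ (measure_iUnion_null fun i => measure_iUnion_null fun q =>
    measure_iUnion_null fun j => ht i q j)
  rintro _ ⟨x, ⟨hxZ, hxD, hxt⟩, rfl⟩
  obtain ⟨i, hi⟩ := mem_iUnion.1 (hcov hxD)
  have hx : x - x₀ ≠ 0 := fun h => by
    rw [mem_sphere, dist_eq_norm, h, norm_zero] at hxt; linarith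
  obtain ⟨q, hq⟩ : ∃ q, 0 < inner ℝ (x - x₀) (e q) := by
    by_contra! hcon
    refine hx ?_
    ext k
    have h1 := hcon (k, true)
    have h2 := hcon (k, false)
    simp [e, EuclideanSpace.inner_single_right] at h1 h2
    simp
    linarith
  obtain ⟨j, hj⟩ := exists_nat_one_div_lt hq
  simp only [mem_iUnion]
  exact ⟨i, q, j, x, ⟨hxZ, hi, hxt, hj⟩, rfl⟩

theorem norm_le_frobNorm {n : ℕ} (A : En n →L[ℝ] En n) : ‖A‖ ≤ frobNorm A := by
  refine A.opNorm_le_bound (Real.sqrt_nonneg _) fun v => ?_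
  rw [← sq_le_sq₀ (norm_nonneg _) (show 0 ≤ frobNorm A * ‖v‖ from
    mul_nonneg (Real.sqrt_nonneg _) (norm_nonneg _)), mul_pow, frobNorm,
    Real.sq_sqrt (by positivity), EuclideanSpace.norm_sq_eq, EuclideanSpace.norm_sq_eq,
    Finset.sum_mul]
  refine Finset.sum_le_sum fun i _ => ?_
  have hv : v = ∑ j, v j • EuclideanSpace.single j (1 : ℝ) := by
    ext k
    simp [Finset.sum_apply, Pi.single_apply]
  have h1 : A v i = ∑ j, A (EuclideanSpace.single j 1) i * v j := by
    conv_lhs => rw [hv]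
    simp [map_sum, mul_comm]
  rw [Real.norm_eq_abs, sq_abs, h1]
  simpa using Finset.sum_mul_sq_le_sq_mul_sq Finset.univ
    (fun j => A (EuclideanSpace.single j 1) i) (fun j => v j)

theorem levelWeight_le {n : ℕ} {φ : ℝ → ℝ} (hφ_mono : ∀ s t : ℝ, 0 < s → s ≤ t → φ s ≤ φ t)
    {W : En n → (En n →L[ℝ] En n)} (x : En n) :
    levelWeight (fun k => ENNReal.ofReal (φ (2 ^ k))) (fun x => ‖W x‖ₑ) x
      ≤ 1 + ENNReal.ofReal (φ (frobNorm (W x))) := by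
  refine add_le_add le_rfl ?_
  by_cases h : ∃ k : ℕ, 2 ^ k < ‖W x‖ₑ ∧ ‖W x‖ₑ ≤ 2 ^ (k + 1)
  · obtain ⟨k, hk⟩ := h
    rw [tsum_eq_single k]
    · rw [indicator_of_mem (by exact hk)]
      simp only [Pi.one_apply, mul_one]
      refine ENNReal.ofReal_le_ofReal (hφ_mono _ _ (by positivity) ?_)
      refine le_trans ?_ (norm_le_frobNorm (W x))
      have h2 := hk.1.le
      rw [← ofReal_norm, ENNReal.le_ofReal_iff_toReal_le (by simp) (norm_nonneg _)] at h2
      simpa using h2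
    · intro j hj
      rw [indicator_of_notMem, mul_zero]
      rintro ⟨hj1, hj2⟩
      have h12 : (1 : ℝ≥0∞) ≤ 2 := by norm_num
      rcases lt_or_gt_of_ne hj with h | h
      · exact absurd (hj2.trans (pow_le_pow_right₀ h12 h)) (not_le.2 hk.1)
      · exact absurd (hk.2.trans (pow_le_pow_right₀ h12 h)) (not_le.2 hj1)
  · have h0 : ∀ k : ℕ, ENNReal.ofReal (φ (2 ^ k)) *
        {w | 2 ^ k < ‖W w‖ₑ ∧ ‖W w‖ₑ ≤ 2 ^ (k + 1)}.indicator 1 x = 0 := fun k => by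
      rw [indicator_of_notMem, mul_zero]
      exact fun hk => h ⟨k, hk⟩
    simp [h0]

theorem setLIntegral_levelWeight_ne_top {n : ℕ} {D : Set (En n)} {φ : ℝ → ℝ}
    (hφ_mono : ∀ s t : ℝ, 0 < s → s ≤ t → φ s ≤ φ t)
    {Df W : En n → (En n →L[ℝ] En n)} (hDfW : Df =ᵐ[volume.restrict D] W)
    (hOrlicz : OrliczCond n D φ Df) {K : Set (En n)} (hKD : K ⊆ D) (hK : IsCompact K) :
    ∫⁻ x in K, levelWeight (fun k => ENNReal.ofReal (φ (2 ^ k))) (fun x => ‖W x‖ₑ) x ≠ ∞ := by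
  have h1 := hOrlicz K hK hKD
  have h2 : ∫⁻ x in K, (1 + ENNReal.ofReal (φ (frobNorm (Df x)))) < ∞ := by
    rw [lintegral_add_left measurable_const]
    simp only [lintegral_const, one_mul, Measure.restrict_apply_univ]
    exact ENNReal.add_lt_top.2 ⟨hK.measure_lt_top, h1⟩
  refine ne_top_of_le_ne_top h2.ne (lintegral_mono_ae ?_)
  filter_upwards [ae_restrict_of_ae_restrict_of_subset hKD hDfW] with x hx
  rw [hx]
  exact levelWeight_le hφ_mono x

/-- The largest factor by which an invertible linear map scales hyperplane area. -/
def hyperplaneJac {n : ℕ} (A : En n →L[ℝ] En n) : ℝ :=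
  |LinearMap.det (A : En n →ₗ[ℝ] En n)| / minStretch A

theorem minStretch_le {n : ℕ} (A : En n →L[ℝ] En n) {v : En n} (hv : ‖v‖ = 1) :
    minStretch A ≤ ‖A v‖ :=
  csInf_le ⟨0, by rintro _ ⟨w, -, rfl⟩; exact norm_nonneg _⟩ ⟨v, hv, rfl⟩

theorem minStretch_mul_norm_le {n : ℕ} (A : En n →L[ℝ] En n) (v : En n) :
    minStretch A * ‖v‖ ≤ ‖A v‖ := by
  by_cases hv : v = 0
  · simp [hv]
  have h0 : 0 < ‖v‖ := norm_pos_iff.2 hv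
  have h := minStretch_le A (v := (‖v‖)⁻¹ • v) (by simp [norm_smul, h0.ne'])
  rw [map_smul, norm_smul, norm_inv, norm_norm] at h
  calc minStretch A * ‖v‖ ≤ (‖v‖⁻¹ * ‖A v‖) * ‖v‖ := by gcongr
    _ = ‖A v‖ := by field_simp

theorem exists_norm_eq_one {n : ℕ} (hn : 0 < n) : ∃ v : En n, ‖v‖ = 1 :=
  ⟨EuclideanSpace.single ⟨0, hn⟩ 1, by simp⟩

theorem le_minStretch {n : ℕ} (hn : 0 < n) {A : En n →L[ℝ] En n} {c : ℝ}
    (h : ∀ v : En n, ‖v‖ = 1 → c ≤ ‖A v‖) : c ≤ minStretch A := by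
  obtain ⟨v, hv⟩ := exists_norm_eq_one hn
  exact le_csInf ⟨_, v, hv, rfl⟩ (by rintro _ ⟨w, hw, rfl⟩; exact h w hw)

theorem minStretch_nonneg {n : ℕ} (A : En n →L[ℝ] En n) : 0 ≤ minStretch A :=
  Real.sInf_nonneg (by rintro _ ⟨w, -, rfl⟩; exact norm_nonneg _)

theorem minStretch_pos {n : ℕ} (hn : 0 < n) {A : En n →L[ℝ] En n}
    (hA : LinearMap.det (A : En n →ₗ[ℝ] En n) ≠ 0) : 0 < minStretch A := by
  let e := LinearMap.equivOfDetNeZero (A : En n →ₗ[ℝ] En n) hA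
  let B : En n →L[ℝ] En n := e.symm.toLinearMap.toContinuousLinearMap
  have hB : ∀ v, B (A v) = v := fun v => e.symm_apply_apply v
  refine lt_of_lt_of_le (show 0 < (‖B‖ + 1)⁻¹ by positivity) (le_minStretch hn fun v hv => ?_)
  have h := B.le_opNorm (A v)
  rw [hB, hv] at h
  rw [inv_le_iff_one_le_mul₀ (by positivity)]
  nlinarith [norm_nonneg (A v)]

theorem minStretch_le_add {n : ℕ} (hn : 0 < n) (A B : En n →L[ℝ] En n) :
    minStretch A ≤ minStretch B + ‖A - B‖ := by
  rw [← sub_le_iff_le_add]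
  refine le_minStretch hn fun v hv => ?_
  have h1 := minStretch_le A hv
  have h2 := (A - B).le_opNorm v
  rw [hv, mul_one] at h2
  have h3 : A v = B v + (A - B) v := by simp
  have h4 := norm_add_le (B v) ((A - B) v)
  rw [← h3] at h4
  linarith

theorem continuous_minStretch {n : ℕ} (hn : 0 < n) :
    Continuous (minStretch : (En n →L[ℝ] En n) → ℝ) := by
  refine (LipschitzWith.of_dist_le_mul (K := 1) fun A B => ?_).continuous
  rw [NNReal.coe_one, one_mul, Real.dist_eq, dist_eq_norm, abs_sub_le_iff]
  have h1 := minStretch_le_add hn A B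
  have h2 := minStretch_le_add hn B A
  rw [norm_sub_rev B A] at h2
  constructor <;> linarith

theorem continuous_det_coe {n : ℕ} :
    Continuous fun A : En n →L[ℝ] En n => LinearMap.det (A : En n →ₗ[ℝ] En n) :=
  ContinuousLinearMap.continuous_det

theorem continuousAt_hyperplaneJac {n : ℕ} (hn : 0 < n) {A : En n →L[ℝ] En n}
    (hA : LinearMap.det (A : En n →ₗ[ℝ] En n) ≠ 0) : ContinuousAt hyperplaneJac A :=
  (continuous_det_coe.abs.continuousAt).div (continuous_minStretch hn).continuousAt
    (minStretch_pos hn hA).ne'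

theorem hyperplaneJac_pos {n : ℕ} (hn : 0 < n) {A : En n →L[ℝ] En n}
    (hA : LinearMap.det (A : En n →ₗ[ℝ] En n) ≠ 0) : 0 < hyperplaneJac A :=
  div_pos (abs_pos.2 hA) (minStretch_pos hn hA)

theorem measurable_hyperplaneJac {n : ℕ} (hn : 0 < n) :
    Measurable (hyperplaneJac : (En n →L[ℝ] En n) → ℝ) :=
  continuous_det_coe.abs.measurable.div (continuous_minStretch hn).measurable

theorem eventually_det_hyperplaneJac {n : ℕ} (hn : 0 < n) {A : En n →L[ℝ] En n}
    (hA : LinearMap.det (A : En n →ₗ[ℝ] En n) ≠ 0) {l : ℝ} (hl : 1 < l) :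
    ∀ᶠ B : En n →L[ℝ] En n in 𝓝 A, LinearMap.det (B : En n →ₗ[ℝ] En n) ≠ 0 ∧
      |LinearMap.det (B : En n →ₗ[ℝ] En n)| < l * |LinearMap.det (A : En n →ₗ[ℝ] En n)| ∧
      hyperplaneJac A < l * hyperplaneJac B := by
  have h1 : 0 < |LinearMap.det (A : En n →ₗ[ℝ] En n)| := abs_pos.2 hA
  have h2 := hyperplaneJac_pos hn hA
  refine (continuous_det_coe.continuousAt.eventually_ne hA).and
    (Filter.Eventually.and ?_ ?_)
  · exact continuous_det_coe.abs.continuousAt.eventually_lt_const (by nlinarith)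
  · exact (continuousAt_const.mul (continuousAt_hyperplaneJac hn hA)).eventually_const_lt
      (show hyperplaneJac A < l * hyperplaneJac A by nlinarith)

/-- The orthonormal basis obtained by completing an isometric copy of `ℝᵐ` by a unit normal. -/
theorem exists_orthonormalBasis_of_isometry {m n : ℕ} (hmn : n = m + 1) {L : En m →ₗᵢ[ℝ] En n}
    {e : En n} (he : ‖e‖ = 1) (hLe : ∀ z, inner ℝ (L z) e = 0) :
    ∃ b : OrthonormalBasis (Fin m ⊕ Unit) ℝ (En n),
      (∀ i, b (Sum.inl i) = L (EuclideanSpace.single i 1)) ∧ b (Sum.inr ()) = e := by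
  let v : Fin m ⊕ Unit → En n := Sum.elim (fun i => L (EuclideanSpace.single i 1)) fun _ => e
  have hv : Orthonormal ℝ v := by
    rw [orthonormal_iff_ite]
    rintro (i | i) (j | j)
    · simp [v, L.inner_map_map, EuclideanSpace.inner_single_left]
    · simp [v, hLe]
    · have h := hLe (EuclideanSpace.single j 1)
      rw [real_inner_comm] at h
      simp [v, h]
    · simp [v, he]
  have hcard : Fintype.card (Fin m ⊕ Unit) = Module.finrank ℝ (En n) := by simp [hmn]
  refine ⟨(basisOfOrthonormalOfCardEqFinrank hv hcard).toOrthonormalBasis (by simpa using hv),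
    fun i => ?_, ?_⟩ <;> simp [v]

theorem exists_unit_orthogonal {m n : ℕ} (hmn : n = m + 1) (T : En m →ₗ[ℝ] En n) :
    ∃ e : En n, ‖e‖ = 1 ∧ ∀ z, inner ℝ (T z) e = 0 := by
  have h1 : T.range ≠ ⊤ := fun h => by
    have h2 := T.finrank_range_le
    rw [h, finrank_top] at h2
    simp [hmn] at h2
  have h2 : T.rangeᗮ ≠ ⊥ := fun h => h1 ((Submodule.orthogonal_eq_bot_iff).1 h)
  obtain ⟨w, hw, hw0⟩ := Submodule.exists_mem_ne_zero_of_ne_bot h2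
  refine ⟨(‖w‖)⁻¹ • w, by simp [norm_smul, hw0], fun z => ?_⟩
  rw [inner_smul_right, (Submodule.mem_orthogonal _ _).1 hw _ (LinearMap.mem_range_self T z),
    mul_zero]

theorem abs_det_eq_mul {m n : ℕ} (A : En n →L[ℝ] En n) {B : En m →ₗ[ℝ] En m}
    {b b' : OrthonormalBasis (Fin m ⊕ Unit) ℝ (En n)} {L L' : En m →ₗᵢ[ℝ] En n}
    (hL : ∀ i, b (Sum.inl i) = L (EuclideanSpace.single i 1))
    (hL' : ∀ i, b' (Sum.inl i) = L' (EuclideanSpace.single i 1))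
    (hL'e : ∀ z, inner ℝ (L' z) (b' (Sum.inr ())) = 0)
    (hB : ∀ z, A (L z) = L' (B z)) :
    |LinearMap.det (A : En n →ₗ[ℝ] En n)|
      = |LinearMap.det B| * |inner ℝ (b' (Sum.inr ())) (A (b (Sum.inr ())))| := by
  let U : En n ≃ₗᵢ[ℝ] En n := b'.equiv b (Equiv.refl _)
  have hU : ∀ i, U (b' i) = b i := fun i => by simp [U]
  let s := (EuclideanSpace.basisFun (Fin m) ℝ).toBasis
  have hM : LinearMap.toMatrix b.toBasis b.toBasis
      (U.toLinearEquiv.toLinearMap ∘ₗ (A : En n →ₗ[ℝ] En n))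
      = Matrix.fromBlocks (LinearMap.toMatrix s s B)
        (Matrix.of fun i _ => inner ℝ (b' (Sum.inl i)) (A (b (Sum.inr ())))) 0
        (Matrix.of fun _ _ => inner ℝ (b' (Sum.inr ())) (A (b (Sum.inr ())))) := by
    have h0 : ∀ i j, LinearMap.toMatrix b.toBasis b.toBasis
        (U.toLinearEquiv.toLinearMap ∘ₗ (A : En n →ₗ[ℝ] En n)) i j = inner ℝ (b' i) (A (b j)) := by
      intro i j
      rw [LinearMap.toMatrix_apply, OrthonormalBasis.coe_toBasis_repr_apply,
        OrthonormalBasis.repr_apply_apply, ← hU i]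
      simp
    ext (i | i) (j | j)
    · rw [h0, hL, hB, hL', L'.inner_map_map, Matrix.fromBlocks_apply₁₁, LinearMap.toMatrix_apply]
      simp [s, EuclideanSpace.inner_single_left]
    · simp [h0]
    · rw [h0, hL, hB, real_inner_comm]
      simp [hL'e]
    · simp [h0]
  have hdet := congrArg Matrix.det hM
  rw [LinearMap.det_toMatrix, Matrix.det_fromBlocks_zero₂₁, LinearMap.det_toMatrix,
    LinearMap.det_comp] at hdet
  have hUdet : |LinearMap.det (U.toLinearEquiv.toLinearMap)| = 1 := by
    rw [← LinearMap.normDet_eq_abs_det]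
    exact U.toLinearIsometry.normDet_eq_one
  have := congrArg abs hdet
  rw [abs_mul, abs_mul, hUdet, one_mul] at this
  simpa using this

theorem exists_factor_through_isometry {m n : ℕ} (hmn : n = m + 1) (A : En n →L[ℝ] En n)
    (L : En m →ₗᵢ[ℝ] En n) : ∃ (B : En m →ₗ[ℝ] En m) (L' : En m →ₗᵢ[ℝ] En n) (e : En n),
      ‖e‖ = 1 ∧ (∀ z, inner ℝ (L' z) e = 0) ∧ (∀ w, inner ℝ w e = 0 → ∃ z, L' z = w) ∧
        ∀ z, A (L z) = L' (B z) := by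
  let T : En m →ₗ[ℝ] En n := (A : En n →ₗ[ℝ] En n) ∘ₗ L.toLinearMap
  obtain ⟨e, he, hTe⟩ := exists_unit_orthogonal hmn T
  obtain ⟨L', hL'e, hL's⟩ := exists_isometry_orthogonal hmn he
  let E := LinearEquiv.ofInjective L'.toLinearMap L'.injective
  have hT : ∀ z, T z ∈ L'.toLinearMap.range := fun z => hL's _ (hTe z)
  refine ⟨E.symm.toLinearMap ∘ₗ T.codRestrict _ hT, L', e, he, hL'e, hL's, fun z => ?_⟩
  have h := congrArg Subtype.val (E.apply_symm_apply (T.codRestrict _ hT z))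
  exact h.symm

theorem abs_det_mul_minStretch_le {m n : ℕ} (hmn : n = m + 1) (A : En n →L[ℝ] En n)
    {B : En m →ₗ[ℝ] En m} {L L' : En m →ₗᵢ[ℝ] En n} {e : En n} (he : ‖e‖ = 1)
    (hL'e : ∀ z, inner ℝ (L' z) e = 0) (hL's : ∀ w, inner ℝ w e = 0 → ∃ z, L' z = w)
    (hB : ∀ z, A (L z) = L' (B z)) :
    |LinearMap.det B| * minStretch A ≤ |LinearMap.det (A : En n →ₗ[ℝ] En n)| := by
  by_cases hB0 : LinearMap.det B = 0
  · simp [hB0]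
  obtain ⟨ν, hν, hLν⟩ := exists_unit_orthogonal hmn L.toLinearMap
  obtain ⟨b, hb1, hb2⟩ := exists_orthonormalBasis_of_isometry hmn hν hLν
  obtain ⟨b', hb1', hb2'⟩ := exists_orthonormalBasis_of_isometry hmn he hL'e
  rw [abs_det_eq_mul A hb1 hb1' (by rw [hb2']; exact hL'e) hB, hb2, hb2']
  refine mul_le_mul_of_nonneg_left ?_ (abs_nonneg _)
  set a : ℝ := inner ℝ e (A ν) with ha
  obtain ⟨w, hw⟩ := hL's (A ν - a • e) (by
    rw [inner_sub_left, inner_smul_left, real_inner_self_eq_norm_sq, he, real_inner_comm, ← ha]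
    simp)
  obtain ⟨z, rfl⟩ := (LinearMap.equivOfDetNeZero B hB0).surjective w
  have h1 : A (ν - L z) = a • e := by
    rw [map_sub, hB]
    have : (LinearMap.equivOfDetNeZero B hB0) z = B z := rfl
    rw [← this, hw]; abel
  have h2 : 1 ≤ ‖ν - L z‖ := by
    have h3 := real_inner_le_norm (ν - L z) ν
    have h4 : inner ℝ (L z) ν = 0 := hLν z
    rw [inner_sub_left, h4, real_inner_self_eq_norm_sq, hν] at h3
    simpa using h3
  calc minStretch A = minStretch A * 1 := (mul_one _).symm
    _ ≤ minStretch A * ‖ν - L z‖ := mul_le_mul_of_nonneg_left h2 (minStretch_nonneg A)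
    _ ≤ ‖A (ν - L z)‖ := minStretch_mul_norm_le A _
    _ = |a| := by rw [h1, norm_smul, he, mul_one, Real.norm_eq_abs]

/-- An invertible linear map scales hyperplane area by at most `hyperplaneJac`. -/
theorem hausdorffMeasure_image_hyperplane_le {m n : ℕ} (hmn : n = m + 1) {A : En n →L[ℝ] En n}
    (hA : LinearMap.det (A : En n →ₗ[ℝ] En n) ≠ 0) (L : En m →ₗᵢ[ℝ] En n) (F : Set (En m)) :
    μH[(m : ℝ)] ((fun z => A (L z)) '' F) ≤ ENNReal.ofReal (hyperplaneJac A) * μH[(m : ℝ)] F := by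
  obtain ⟨B, L', e, he, hL'e, hL's, hB⟩ := exists_factor_through_isometry hmn A L
  have h1 : (fun z => A (L z)) '' F = L' '' (B '' F) := by
    simp only [hB, image_image]
  have h2 := B.hausdorffMeasure_image F
  rw [finrank_euclideanSpace_fin] at h2
  rw [h1, L'.isometry.hausdorffMeasure_image (Or.inl (by positivity)), h2,
    LinearMap.normDet_eq_abs_det]
  gcongr
  rw [hyperplaneJac, le_div_iff₀ (minStretch_pos (by omega) hA)]
  exact abs_det_mul_minStretch_le hmn A he hL'e hL's hB

theorem hausdorffMeasure_image_le_of_edist_le {X Y Z : Type*} [EMetricSpace X]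
    [EMetricSpace Y] [MeasurableSpace Y] [BorelSpace Y]
    [EMetricSpace Z] [MeasurableSpace Z] [BorelSpace Z] {f : X → Y} {g : X → Z} {F : Set X}
    {K : ℝ≥0} {d : ℝ} (hd : 0 ≤ d)
    (h : ∀ u ∈ F, ∀ v ∈ F, edist (f u) (f v) ≤ K * edist (g u) (g v)) :
    μH[d] (f '' F) ≤ (K : ℝ≥0∞) ^ d * μH[d] (g '' F) := by
  rcases F.eq_empty_or_nonempty with rfl | ⟨x, hx⟩
  · simp
  have : Nonempty X := ⟨x⟩
  have hinv : ∀ u ∈ F, invFunOn g F (g u) ∈ F ∧ g (invFunOn g F (g u)) = g u := fun u hu =>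
    ⟨invFunOn_mem ⟨u, hu, rfl⟩, invFunOn_eq ⟨u, hu, rfl⟩⟩
  have heq : ∀ u ∈ F, f (invFunOn g F (g u)) = f u := fun u hu => by
    have h1 := h _ (hinv u hu).1 u hu
    rw [(hinv u hu).2, edist_self, mul_zero] at h1
    exact edist_le_zero.1 h1
  have hL : LipschitzOnWith K (fun y => f (invFunOn g F y)) (g '' F) := by
    rintro _ ⟨u, hu, rfl⟩ _ ⟨v, hv, rfl⟩
    simp only [heq u hu, heq v hv]
    exact h u hu v hv
  have h2 := hL.hausdorffMeasure_image_le hd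
  have h3 : (fun y => f (invFunOn g F y)) '' (g '' F) = f '' F := by
    rw [image_image]
    exact image_congr heq
  rwa [h3] at h2

theorem abs_inner_sub_le {n : ℕ} {x₀ x u v : En n} {r η : ℝ} (hr : 0 < r)
    (hu : dist u x₀ = r) (hv : dist v x₀ = r) (hux : dist u x ≤ η) (hvx : dist v x ≤ η) :
    |inner ℝ (u - v) (r⁻¹ • (x - x₀))| ≤ η / r * ‖u - v‖ := by
  have h1 : inner ℝ (u - v) ((u - x₀) + (v - x₀)) = (0 : ℝ) := by
    have h2 : u - v = (u - x₀) - (v - x₀) := by abel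
    rw [h2, inner_sub_left, inner_add_right, inner_add_right, real_inner_self_eq_norm_sq,
      real_inner_self_eq_norm_sq, ← dist_eq_norm, ← dist_eq_norm, hu, hv,
      real_inner_comm (u - x₀) (v - x₀)]
    ring
  have h2 : (u - x₀) + (v - x₀) = (2 : ℝ) • (x - x₀) + ((u - x) + (v - x)) := by
    rw [two_smul]; abel
  rw [h2, inner_add_right, inner_smul_right] at h1
  have h3 := abs_real_inner_le_norm (u - v) ((u - x) + (v - x))
  have h4 : ‖(u - x) + (v - x)‖ ≤ 2 * η := by
    refine (norm_add_le _ _).trans ?_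
    rw [← dist_eq_norm, ← dist_eq_norm]; linarith
  have h5 : |inner ℝ (u - v) (x - x₀)| ≤ ‖u - v‖ * η := by
    have h6 : inner ℝ (u - v) (x - x₀) = -(inner ℝ (u - v) ((u - x) + (v - x))) / 2 := by linarith
    rw [h6, abs_div, abs_neg, abs_two]
    nlinarith [norm_nonneg (u - v)]
  rw [inner_smul_right, abs_mul, abs_of_pos (inv_pos.2 hr)]
  calc r⁻¹ * |inner ℝ (u - v) (x - x₀)| ≤ r⁻¹ * (‖u - v‖ * η) := by gcongr
    _ = η / r * ‖u - v‖ := by ring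

theorem hausdorffMeasure_image_le_of_subset_ball {m n : ℕ} (hmn : n = m + 1) {A : En n →L[ℝ] En n}
    (hA : LinearMap.det (A : En n →ₗ[ℝ] En n) ≠ 0) {x₀ x : En n} {r η l l' : ℝ} (hr : 0 < r)
    (hl : 0 < l) (hη : ‖A‖ * (η / r) * l' ≤ (l' - l) * minStretch A) (hll' : l < l')
    (hx : dist x x₀ = r) {F : Set (En n)} (hF : F ⊆ sphere x₀ r) (hFx : F ⊆ closedBall x η)
    {f : En n → En n} (hf : ∀ u ∈ F, ∀ v ∈ F, ‖f u - f v‖ ≤ l * ‖A (u - v)‖) :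
    μH[(m : ℝ)] (f '' F) ≤ ENNReal.ofReal l' ^ (m : ℝ) *
      (ENNReal.ofReal (hyperplaneJac A) * μH[(m : ℝ)] F) := by
  have hl' : 0 < l' := hl.trans hll'
  have hS := minStretch_pos (by omega) hA
  set ν : En n := r⁻¹ • (x - x₀) with hν
  have hν1 : ‖ν‖ = 1 := by
    rw [hν, norm_smul, ← dist_eq_norm, hx, norm_inv, Real.norm_eq_abs, abs_of_pos hr,
      inv_mul_cancel₀ hr.ne']
  obtain ⟨L, hLν, hLs⟩ := exists_isometry_orthogonal hmn hν1
  have hP : ∀ w : En n, ∃ z, L z = w - (inner ℝ w ν : ℝ) • ν := fun w => hLs _ (by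
    rw [inner_sub_left, inner_smul_left, real_inner_self_eq_norm_sq, hν1]; simp)
  choose P hP using hP
  have hPsub : ∀ u v, L (P u - P v) = (u - v) - (inner ℝ (u - v) ν : ℝ) • ν := fun u v => by
    rw [map_sub, hP, hP, inner_sub_left, sub_smul]; abel
  have hPLip : LipschitzOnWith 1 P F := by
    refine LipschitzOnWith.of_dist_le_mul fun u _ v _ => ?_
    rw [NNReal.coe_one, one_mul, dist_eq_norm, dist_eq_norm, ← L.norm_map, hPsub,
      ← sq_le_sq₀ (norm_nonneg _) (norm_nonneg _), norm_sub_sq_real, inner_smul_right,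
      norm_smul, hν1, Real.norm_eq_abs, mul_one, sq_abs]
    nlinarith [sq_nonneg (inner ℝ (u - v) ν : ℝ)]
  have hkey : ∀ u ∈ F, ∀ v ∈ F, ‖f u - f v‖ ≤ l' * ‖A (L (P u)) - A (L (P v))‖ := by
    intro u hu v hv
    rw [← map_sub, ← map_sub, hPsub]
    set i : ℝ := inner ℝ (u - v) ν
    have h1 : |i| ≤ η / r * ‖u - v‖ := abs_inner_sub_le hr (hF hu) (hF hv) (hFx hu) (hFx hv)
    have h2 := minStretch_mul_norm_le A (u - v)
    have h3 : ‖A (i • ν)‖ ≤ ‖A‖ * (η / r * ‖u - v‖) := by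
      refine (A.le_opNorm _).trans ?_
      rw [norm_smul, hν1, mul_one, Real.norm_eq_abs]
      gcongr
    have h4 : ‖A (u - v)‖ ≤ ‖A ((u - v) - i • ν)‖ + ‖A (i • ν)‖ := by
      rw [map_sub]
      simpa using norm_add_le (A (u - v) - A (i • ν)) (A (i • ν))
    have h5 : l' * ‖A (i • ν)‖ ≤ (l' - l) * ‖A (u - v)‖ := by
      calc l' * ‖A (i • ν)‖ ≤ l' * (‖A‖ * (η / r * ‖u - v‖)) := by gcongr
        _ = (‖A‖ * (η / r) * l') * ‖u - v‖ := by ring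
        _ ≤ ((l' - l) * minStretch A) * ‖u - v‖ := by gcongr
        _ = (l' - l) * (minStretch A * ‖u - v‖) := by ring
        _ ≤ (l' - l) * ‖A (u - v)‖ := mul_le_mul_of_nonneg_left h2 (by linarith)
    have h6 := hf u hu v hv
    nlinarith
  have h1 := hausdorffMeasure_image_le_of_edist_le (f := f) (g := fun u => A (L (P u))) (F := F)
    (K := l'.toNNReal) (d := m) (by positivity) fun u hu v hv => by
      rw [edist_dist, edist_dist, dist_eq_norm, dist_eq_norm]
      refine (ENNReal.ofReal_le_ofReal (hkey u hu v hv)).trans ?_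
      rw [ENNReal.ofReal_mul hl'.le]
      rfl
  refine h1.trans ?_
  gcongr
  · rfl
  have h2 := hausdorffMeasure_image_hyperplane_le hmn hA L (P '' F)
  rw [image_image] at h2
  refine h2.trans ?_
  gcongr
  simpa using hPLip.hausdorffMeasure_image_le (d := m) (by positivity)

theorem exists_measurable_partition {n : ℕ} {η : ℝ} (hη : 0 < η) :
    ∃ B : ℕ → Set (En n), (∀ i, MeasurableSet (B i)) ∧ Pairwise (Disjoint on B) ∧
      (⋃ i, B i) = univ ∧ ∀ i, ∀ x ∈ B i, ∀ y ∈ B i, dist x y ≤ η := by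
  let C : ℕ → Set (En n) := fun i => ball (TopologicalSpace.denseSeq (En n) i) (η / 2)
  refine ⟨disjointed C, fun i => .disjointed (fun j => measurableSet_ball) i, disjoint_disjointed C,
    ?_, fun i x hx y hy => ?_⟩
  · rw [iUnion_disjointed, eq_univ_iff_forall]
    intro x
    obtain ⟨i, hi⟩ := (TopologicalSpace.denseRange_denseSeq (En n)).exists_dist_lt x
      (half_pos hη)
    exact mem_iUnion.2 ⟨i, hi⟩
  · have h1 : x ∈ C i := disjointed_subset C i hx
    have h2 : y ∈ C i := disjointed_subset C i hy
    rw [mem_ball] at h1 h2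
    have := dist_triangle_right x y (TopologicalSpace.denseSeq (En n) i)
    linarith

theorem hausdorffMeasure_image_sphere_le {m n : ℕ} (hmn : n = m + 1) {A : En n →L[ℝ] En n}
    (hA : LinearMap.det (A : En n →ₗ[ℝ] En n) ≠ 0) {x₀ : En n} {r l l' : ℝ} (hr : 0 < r)
    (hl : 0 < l) (hll' : l < l') {F : Set (En n)} (hF : F ⊆ sphere x₀ r) (hFm : MeasurableSet F)
    {f : En n → En n} (hf : ∀ u ∈ F, ∀ v ∈ F, ‖f u - f v‖ ≤ l * ‖A (u - v)‖) :
    μH[(m : ℝ)] (f '' F) ≤ ENNReal.ofReal l' ^ (m : ℝ) *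
      (ENNReal.ofReal (hyperplaneJac A) * μH[(m : ℝ)] F) := by
  have hl' : 0 < l' := hl.trans hll'
  have hS := minStretch_pos (by omega) hA
  set η : ℝ := (l' - l) * minStretch A * r / ((‖A‖ + 1) * l') with hη
  have hη0 : 0 < η := by
    have : 0 < l' - l := by linarith
    positivity
  have hηle : ‖A‖ * (η / r) * l' ≤ (l' - l) * minStretch A := by
    have h1 : (‖A‖ + 1) * (η / r) * l' = (l' - l) * minStretch A := by
      have : ‖A‖ + 1 ≠ 0 := by positivity
      rw [hη]; field_simp
    have : 0 < η / r * l' := by positivity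
    nlinarith
  obtain ⟨B, hBm, hBd, hBu, hBη⟩ := exists_measurable_partition (n := n) hη0
  have hFB : F = ⋃ i, F ∩ B i := by rw [← inter_iUnion, hBu, inter_univ]
  have hsum : μH[(m : ℝ)] F = ∑' i, μH[(m : ℝ)] (F ∩ B i) := by
    conv_lhs => rw [hFB]
    exact measure_iUnion (fun i j hij => (hBd hij).mono inter_subset_right inter_subset_right)
      fun i => hFm.inter (hBm i)
  conv_lhs => rw [hFB, image_iUnion]
  rw [hsum, ← ENNReal.tsum_mul_left, ← ENNReal.tsum_mul_left]
  refine (measure_iUnion_le _).trans (ENNReal.tsum_le_tsum fun i => ?_)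
  rcases (F ∩ B i).eq_empty_or_nonempty with h | ⟨x, hxF, hxB⟩
  · simp [h]
  exact hausdorffMeasure_image_le_of_subset_ball hmn hA hr hl hηle hll' (hF hxF)
    (inter_subset_left.trans hF) (fun u hu => hBη i u hu.2 x hxB)
    fun u hu v hv => hf u hu.1 v hv.1

theorem setLIntegral_image_le {X Y : Type*} [MeasurableSpace X] [MeasurableSpace Y]
    {μ : Measure X} {ν : Measure Y} {f : X → Y} (hf : Measurable f) {F : Set X}
    {c : ℝ≥0∞} (h : ∀ F' ⊆ F, MeasurableSet F' → ν (f '' F') ≤ c * μ F')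
    (hF : MeasurableSet F) {g : Y → ℝ≥0∞} (hg : Measurable g) :
    ∫⁻ y in f '' F, g y ∂ν ≤ c * ∫⁻ x in F, g (f x) ∂μ := by
  have hle : ν.restrict (f '' F) ≤ c • (μ.restrict F).map f := by
    refine Measure.le_iff.2 fun s hs => ?_
    rw [Measure.restrict_apply hs, Measure.smul_apply, Measure.map_apply hf hs,
      Measure.restrict_apply (hf hs), inter_comm, ← image_inter_preimage, inter_comm]
    exact h _ inter_subset_right ((hf hs).inter hF)
  calc ∫⁻ y in f '' F, g y ∂ν ≤ ∫⁻ y, g y ∂(c • (μ.restrict F).map f) := lintegral_mono' hle le_rfl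
    _ = c * ∫⁻ x in F, g (f x) ∂μ := by
      rw [lintegral_smul_measure, lintegral_map hg hf, smul_eq_mul]

theorem setLIntegral_le_image {X Y : Type*} [MeasurableSpace X] [MeasurableSpace Y]
    {μ : Measure X} {ν : Measure Y} {f : X → Y} (hf : Measurable f) {F : Set X}
    {c d : ℝ≥0∞} (h : ∀ F' ⊆ F, MeasurableSet F' → d * μ F' ≤ c * ν (f '' F'))
    (hF : MeasurableSet F) {g : Y → ℝ≥0∞} (hg : Measurable g) :
    d * ∫⁻ x in F, g (f x) ∂μ ≤ c * ∫⁻ y in f '' F, g y ∂ν := by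
  have hle : d • (μ.restrict F).map f ≤ c • ν.restrict (f '' F) := by
    refine Measure.le_iff.2 fun s hs => ?_
    rw [Measure.smul_apply, Measure.smul_apply, Measure.restrict_apply hs, Measure.map_apply hf hs,
      Measure.restrict_apply (hf hs), inter_comm s, ← image_inter_preimage, inter_comm F]
    exact h _ inter_subset_right ((hf hs).inter hF)
  calc d * ∫⁻ x in F, g (f x) ∂μ = ∫⁻ y, g y ∂(d • (μ.restrict F).map f) := by
        rw [lintegral_smul_measure, lintegral_map hg hf, smul_eq_mul]
    _ ≤ ∫⁻ y, g y ∂(c • ν.restrict (f '' F)) := lintegral_mono' hle le_rfl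
    _ = c * ∫⁻ y in f '' F, g y ∂ν := by rw [lintegral_smul_measure, smul_eq_mul]

theorem norm_sub_clm_le_closure {n : ℕ} {D T : Set (En n)} {f : En n → En n}
    (hf : ContinuousOn f D) (hTD : T ⊆ D) (A : En n →L[ℝ] En n) {s : ℝ}
    (h : ∀ x ∈ T, ∀ y ∈ T, ‖f x - f y - A (x - y)‖ ≤ s * ‖x - y‖) :
    ∀ x ∈ closure T ∩ D, ∀ y ∈ closure T ∩ D, ‖f x - f y - A (x - y)‖ ≤ s * ‖x - y‖ := by
  intro x hx y hy
  have hfx : ContinuousWithinAt (fun q : En n × En n => f q.1) (T ×ˢ T) (x, y) :=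
    ((hf x hx.2).mono hTD).comp continuousWithinAt_fst (fun q hq => hq.1)
  have hfy : ContinuousWithinAt (fun q : En n × En n => f q.2) (T ×ˢ T) (x, y) :=
    ((hf y hy.2).mono hTD).comp continuousWithinAt_snd (fun q hq => hq.2)
  have hA : ContinuousWithinAt (fun q : En n × En n => A (q.1 - q.2)) (T ×ˢ T) (x, y) :=
    (A.continuous.comp (continuous_fst.sub continuous_snd)).continuousWithinAt
  have hN : ContinuousWithinAt (fun q : En n × En n => s * ‖q.1 - q.2‖) (T ×ˢ T) (x, y) :=
    (continuous_const.mul (continuous_fst.sub continuous_snd).norm).continuousWithinAt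
  refine ContinuousWithinAt.closure_le (s := T ×ˢ T) (x := (x, y)) ?_
    ((hfx.sub hfy).sub hA).norm hN fun q hq => h q.1 hq.1 q.2 hq.2
  rw [closure_prod_eq]
  exact ⟨hx.1, hy.1⟩

theorem norm_le_mul_of_norm_sub_le {E : Type*} [NormedAddCommGroup E] {a b : E} {l : ℝ}
    (hl : 1 < l) (h : ‖a - b‖ ≤ (1 - l⁻¹) * ‖b‖) : ‖a‖ ≤ l * ‖b‖ ∧ ‖b‖ ≤ l * ‖a‖ := by
  have h0 : l * l⁻¹ = 1 := mul_inv_cancel₀ (by linarith)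
  have hi : 0 < l⁻¹ := by positivity
  have h1 : ‖a‖ ≤ ‖a - b‖ + ‖b‖ := by simpa using norm_add_le (a - b) b
  have h2 : ‖b‖ ≤ ‖a‖ + ‖a - b‖ := by
    have := norm_sub_le a (a - b)
    simpa using this
  have hb := norm_nonneg b
  constructor
  · have : 2 - l⁻¹ ≤ l := by nlinarith [sq_nonneg (l - 1)]
    nlinarith
  · have h3 : l⁻¹ * ‖b‖ ≤ ‖a‖ := by nlinarith
    calc ‖b‖ = l * (l⁻¹ * ‖b‖) := by rw [← mul_assoc, h0, one_mul]
      _ ≤ l * ‖a‖ := by gcongr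

/-- `f` is `Z`-almost covered by pieces on which `W` is its derivative up to any given error. -/
def HasLipschitzPieces {n : ℕ} (D : Set (En n)) (f : En n → En n)
    (W : En n → (En n →L[ℝ] En n)) (Z : Set (En n)) : Prop :=
  ∀ ε : ℝ, 0 < ε → ∃ T : ℕ → Set (En n), D \ Z ⊆ ⋃ i, T i ∧
    ∀ i, T i ⊆ D ∧ ∀ x ∈ T i, ∀ y ∈ T i, ‖f x - f y - W x (x - y)‖ ≤ ε * ‖x - y‖

theorem HasLipschitzPieces.exists_small_pieces {n : ℕ} {D : Set (En n)} (hD : IsOpen D)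
    {f : En n → En n} (hf : ContinuousOn f D) {W : En n → (En n →L[ℝ] En n)} {Z : Set (En n)}
    (h : HasLipschitzPieces D f W Z) {ε : ℝ} (hε : 0 < ε) :
    ∃ P : ℕ → Set (En n), (∀ k, MeasurableSet (P k)) ∧ (∀ k, P k ⊆ D) ∧ Pairwise (Disjoint on P) ∧
      (D ∩ {x | W x = 0}) \ Z ⊆ ⋃ k, P k ∧
      ∀ k, ∀ x ∈ P k, ∀ y ∈ P k, ‖f x - f y‖ ≤ ε * ‖x - y‖ := by
  obtain ⟨T, hT1, hT2⟩ := h ε hε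
  let P : ℕ → Set (En n) := fun k => closure (T k ∩ {x | W x = 0}) ∩ D
  refine ⟨disjointed P, fun k => .disjointed (fun i => isClosed_closure.measurableSet.inter
    hD.measurableSet) k, fun k => (disjointed_subset P k).trans inter_subset_right,
    disjoint_disjointed P, ?_, fun k x hx y hy => ?_⟩
  · rw [iUnion_disjointed]
    rintro x ⟨⟨hxD, hx0⟩, hxZ⟩
    obtain ⟨i, hi⟩ := mem_iUnion.1 (hT1 ⟨hxD, hxZ⟩)
    exact mem_iUnion.2 ⟨i, subset_closure ⟨hi, hx0⟩, hxD⟩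
  · have := norm_sub_clm_le_closure hf (T := T k ∩ {x | W x = 0}) (fun z hz => (hT2 k).1 hz.1) 0
      (s := ε) (fun u hu v hv => by
        have h1 := (hT2 k).2 u hu.1 v hv.1
        rwa [show W u = 0 from hu.2] at h1)
      x (disjointed_subset P k hx) y (disjointed_subset P k hy)
    simpa using this

theorem HasLipschitzPieces.exists_pieces {n : ℕ} (hn : 0 < n) {D : Set (En n)} (hD : IsOpen D)
    {f : En n → En n} (hf : ContinuousOn f D) {W : En n → (En n →L[ℝ] En n)} (hW : Measurable W)
    {Z : Set (En n)} (h : HasLipschitzPieces D f W Z) {l : ℝ} (hl : 1 < l) :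
    ∃ (E : ℕ → Set (En n)) (A : ℕ → (En n →L[ℝ] En n)), (∀ k, MeasurableSet (E k)) ∧
      (∀ k, E k ⊆ D) ∧ Pairwise (Disjoint on E) ∧
      (D ∩ {x | LinearMap.det (W x : En n →ₗ[ℝ] En n) ≠ 0}) \ Z ⊆ ⋃ k, E k ∧
      (∀ k, LinearMap.det (A k : En n →ₗ[ℝ] En n) ≠ 0) ∧
      (∀ k, ∀ x ∈ E k, |LinearMap.det (W x : En n →ₗ[ℝ] En n)|
          ≤ l * |LinearMap.det (A k : En n →ₗ[ℝ] En n)| ∧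
        hyperplaneJac (A k) ≤ l * hyperplaneJac (W x)) ∧
      ∀ k, ∀ x ∈ E k, ∀ y ∈ E k,
        ‖f x - f y‖ ≤ l * ‖A k (x - y)‖ ∧ ‖A k (x - y)‖ ≤ l * ‖f x - f y‖ := by
  set G : Set (En n →L[ℝ] En n) := {A | LinearMap.det (A : En n →ₗ[ℝ] En n) ≠ 0} with hG
  have hσ : 0 < 1 - l⁻¹ := by
    have := inv_lt_one_of_one_lt₀ hl
    linarith
  let s : (En n →L[ℝ] En n) → ℝ := fun A => (1 - l⁻¹) * minStretch A / 2
  have hs : ∀ A ∈ G, 0 < s A := fun A hA => by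
    have := minStretch_pos hn hA
    positivity
  have hU : ∀ A : En n →L[ℝ] En n, ∃ U : Set (En n →L[ℝ] En n), A ∈ G → IsOpen U ∧ A ∈ U ∧ ∀ B ∈ U,
      ‖B - A‖ < s A ∧ |LinearMap.det (B : En n →ₗ[ℝ] En n)|
          < l * |LinearMap.det (A : En n →ₗ[ℝ] En n)| ∧
        hyperplaneJac A < l * hyperplaneJac B := by
    intro A
    by_cases hA : A ∈ G
    · have h1 := (eventually_det_hyperplaneJac hn hA hl).and (ball_mem_nhds A (hs A hA))
      obtain ⟨U, hU1, hU2, hU3⟩ := _root_.eventually_nhds_iff.1 h1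
      exact ⟨U, fun _ => ⟨hU2, hU3, fun B hB => ⟨by
        rw [← dist_eq_norm]; exact (hU1 B hB).2, (hU1 B hB).1.2⟩⟩⟩
    · exact ⟨∅, fun h => absurd h hA⟩
  choose U hU using hU
  obtain ⟨t, htG, htc, htU⟩ := TopologicalSpace.countable_cover_nhdsWithin (f := U) (s := G)
    fun A hA => mem_nhdsWithin_of_mem_nhds ((hU A hA).1.mem_nhds (hU A hA).2.1)
  have hGne : (ContinuousLinearMap.id ℝ (En n)) ∈ G := by simp [hG]
  have htne : t.Nonempty := by
    obtain ⟨A, hA, -⟩ := mem_iUnion₂.1 (htU hGne)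
    exact ⟨A, hA⟩
  obtain ⟨A, rfl⟩ := htc.exists_eq_range htne
  have hAG : ∀ j, A j ∈ G := fun j => htG (mem_range_self j)
  have hT : ∀ j, ∃ T : ℕ → Set (En n), D \ Z ⊆ ⋃ i, T i ∧ ∀ i, T i ⊆ D ∧ ∀ x ∈ T i, ∀ y ∈ T i,
      ‖f x - f y - W x (x - y)‖ ≤ s (A j) * ‖x - y‖ := fun j => h _ (hs _ (hAG j))
  choose T hT1 hT2 using hT
  let E : ℕ → Set (En n) := fun k =>
    closure (T k.unpair.1 k.unpair.2 ∩ W ⁻¹' U (A k.unpair.1)) ∩ D ∩ W ⁻¹' U (A k.unpair.1)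
  refine ⟨disjointed E, fun k => A k.unpair.1, fun k => .disjointed (fun i =>
    (isClosed_closure.measurableSet.inter hD.measurableSet).inter
      (hW (hU _ (hAG _)).1.measurableSet)) k,
    fun k x hx => (disjointed_subset E k hx).1.2, disjoint_disjointed E, ?_, fun k => hAG _,
    fun k x hx => ?_, fun k x hx y hy => ?_⟩
  · rw [iUnion_disjointed]
    rintro x ⟨⟨hxD, hx0⟩, hxZ⟩
    obtain ⟨_, ⟨j, rfl⟩, hj⟩ := mem_iUnion₂.1 (htU (show W x ∈ G from hx0))
    obtain ⟨i, hi⟩ := mem_iUnion.1 (hT1 j ⟨hxD, hxZ⟩)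
    refine mem_iUnion.2 ⟨Nat.pair j i, ?_⟩
    simp only [E, Nat.unpair_pair]
    exact ⟨⟨subset_closure ⟨hi, hj⟩, hxD⟩, hj⟩
  · obtain ⟨-, h2, h3⟩ := (hU _ (hAG k.unpair.1)).2.2 _ (disjointed_subset E k hx).2
    exact ⟨h2.le, h3.le⟩
  · set j := k.unpair.1
    refine norm_le_mul_of_norm_sub_le hl ?_
    have h1 := norm_sub_clm_le_closure hf (T := T j k.unpair.2 ∩ W ⁻¹' U (A j))
      (fun z hz => (hT2 j _).1 hz.1) (A j) (s := 2 * s (A j)) (fun u hu v hv => by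
        have h1 := (hT2 j _).2 u hu.1 v hv.1
        have h2 := ((W u - A j).le_opNorm (u - v)).trans
          (mul_le_mul_of_nonneg_right ((hU _ (hAG j)).2.2 _ hu.2).1.le (norm_nonneg _))
        have h3 := norm_add_le (f u - f v - W u (u - v)) ((W u - A j) (u - v))
        have h4 : f u - f v - W u (u - v) + (W u - A j) (u - v) = f u - f v - A j (u - v) := by
          rw [sub_apply]; abel
        rw [h4] at h3
        linarith)
      x (disjointed_subset E k hx).1 y (disjointed_subset E k hy).1
    refine h1.trans ?_
    calc 2 * s (A j) * ‖x - y‖ = (1 - l⁻¹) * (minStretch (A j) * ‖x - y‖) := by ring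
      _ ≤ (1 - l⁻¹) * ‖A j (x - y)‖ :=
        mul_le_mul_of_nonneg_left (minStretch_mul_norm_le _ _) hσ.le

theorem le_of_forall_le_ofReal_pow_mul {a b : ℝ≥0∞} (k : ℕ)
    (h : ∀ l : ℝ, 1 < l → a ≤ ENNReal.ofReal (l ^ k) * b) : a ≤ b := by
  have h1 : Tendsto (fun l : ℝ => ENNReal.ofReal (l ^ k) * b) (𝓝[>] 1) (𝓝 (1 * b)) := by
    refine ENNReal.Tendsto.mul_const ?_ (Or.inl one_ne_zero)
    have h2 : Continuous fun l : ℝ => ENNReal.ofReal (l ^ k) :=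
      ENNReal.continuous_ofReal.comp (continuous_pow k)
    simpa using (h2.tendsto 1).mono_left nhdsWithin_le_nhds
  rw [one_mul] at h1
  exact ge_of_tendsto h1 (eventually_mem_nhdsWithin.mono fun l hl => h l hl)

theorem tsum_indicator_image_le_encard {n : ℕ} {D : Set (En n)} {E : ℕ → Set (En n)}
    (hE : ∀ k, MeasurableSet (E k)) (hED : ∀ k, E k ⊆ D) (hd : Pairwise (Disjoint on E))
    (hD : MeasurableSet D) {f : En n → En n} (hf : Measurable f) (y : En n) :
    ∑' k, (f '' E k).indicator (1 : En n → ℝ≥0∞) y ≤ ((D ∩ f ⁻¹' {y}).encard : ℝ≥0∞) := by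
  have hy := hf (measurableSet_singleton y)
  rw [← Measure.count_apply (hD.inter hy)]
  calc ∑' k, (f '' E k).indicator (1 : En n → ℝ≥0∞) y
      ≤ ∑' k, Measure.count (E k ∩ f ⁻¹' {y}) := by
        refine ENNReal.tsum_le_tsum fun k => ?_
        by_cases h : y ∈ f '' E k
        · obtain ⟨x, hx, rfl⟩ := h
          rw [indicator_of_mem (mem_image_of_mem f hx), Pi.one_apply,
            ← Measure.count_singleton x]
          exact measure_mono (by rintro _ rfl; exact ⟨hx, rfl⟩)
        · rw [indicator_of_notMem h]
          exact zero_le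
    _ = Measure.count (⋃ k, E k ∩ f ⁻¹' {y}) :=
        (measure_iUnion (fun i j hij => (hd hij).mono inter_subset_left inter_subset_left)
          fun k => (hE k).inter hy).symm
    _ ≤ Measure.count (D ∩ f ⁻¹' {y}) :=
        measure_mono (iUnion_subset fun k => inter_subset_inter_left _ (hED k))

theorem encard_le_tsum_indicator_image {n : ℕ} {D : Set (En n)} {E : ℕ → Set (En n)}
    {f : En n → En n} (hinj : ∀ k, InjOn f (E k)) (hD : MeasurableSet D) (hf : Measurable f)
    (hE : ∀ k, MeasurableSet (E k)) {y : En n} (hy : D ∩ f ⁻¹' {y} ⊆ ⋃ k, E k) :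
    ((D ∩ f ⁻¹' {y}).encard : ℝ≥0∞) ≤ ∑' k, (f '' E k).indicator (1 : En n → ℝ≥0∞) y := by
  have hym := hf (measurableSet_singleton y)
  rw [← Measure.count_apply (hD.inter hym)]
  have h1 : D ∩ f ⁻¹' {y} ⊆ ⋃ k, E k ∩ f ⁻¹' {y} := fun x hx => by
    obtain ⟨k, hk⟩ := mem_iUnion.1 (hy hx)
    exact mem_iUnion.2 ⟨k, hk, hx.2⟩
  refine (measure_mono h1).trans ((measure_iUnion_le _).trans (ENNReal.tsum_le_tsum fun k => ?_))
  rw [Measure.count_apply ((hE k).inter hym)]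
  by_cases h : y ∈ f '' E k
  · rw [indicator_of_mem h, Pi.one_apply]
    have : (E k ∩ f ⁻¹' {y}).encard ≤ 1 := encard_le_one_iff.2 fun a b ha hb =>
      hinj k ha.1 hb.1 (ha.2.trans hb.2.symm)
    exact_mod_cast this
  · have : E k ∩ f ⁻¹' {y} = ∅ := by
      ext x
      simp only [mem_inter_iff, mem_preimage, mem_singleton_iff, mem_empty_iff_false, iff_false]
      exact fun hx => h ⟨x, hx.1, hx.2⟩
    simp [this]

theorem lintegral_mul_tsum_indicator {X : Type*} [MeasurableSpace X] {μ : Measure X}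
    {F : ℕ → Set X} (hF : ∀ k, MeasurableSet (F k)) {g : X → ℝ≥0∞} (hg : Measurable g) :
    ∫⁻ y, g y * ∑' k, (F k).indicator (1 : X → ℝ≥0∞) y ∂μ = ∑' k, ∫⁻ y in F k, g y ∂μ := by
  have h1 : ∀ y, g y * ∑' k, (F k).indicator (1 : X → ℝ≥0∞) y = ∑' k, (F k).indicator g y := by
    intro y
    rw [← ENNReal.tsum_mul_left]
    congr 1 with k
    by_cases h : y ∈ F k <;> simp [h]
  simp only [h1]
  rw [lintegral_tsum fun k => (hg.indicator (hF k)).aemeasurable]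
  congr 1 with k
  exact lintegral_indicator (hF k) _

theorem injOn_of_norm_clm_le {n : ℕ} (hn : 0 < n) {f : En n → En n} {A : En n →L[ℝ] En n}
    (hA : LinearMap.det (A : En n →ₗ[ℝ] En n) ≠ 0) {l : ℝ} {E : Set (En n)}
    (h : ∀ x ∈ E, ∀ y ∈ E, ‖A (x - y)‖ ≤ l * ‖f x - f y‖) : InjOn f E := by
  intro x hx y hy hxy
  have h1 := (minStretch_mul_norm_le A (x - y)).trans (h x hx y hy)
  rw [hxy, sub_self, norm_zero, mul_zero] at h1
  have h2 := minStretch_pos hn hA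
  have h3 : ‖x - y‖ ≤ 0 := by
    by_contra! h3
    nlinarith
  exact sub_eq_zero.1 (norm_le_zero_iff.1 h3)

theorem abs_det_mul_volume_le {n : ℕ} {f : En n → En n} {A : En n →L[ℝ] En n} {l : ℝ} (hl : 0 < l)
    {F : Set (En n)} (h : ∀ x ∈ F, ∀ y ∈ F, ‖A (x - y)‖ ≤ l * ‖f x - f y‖) :
    ENNReal.ofReal |LinearMap.det (A : En n →ₗ[ℝ] En n)| * volume F
      ≤ ENNReal.ofReal (l ^ n) * volume (f '' F) := by
  have hcast : (n : ℝ) = Module.finrank ℝ (En n) := by simp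
  have hH : (μH[(n : ℝ)] : Measure (En n)).IsAddHaarMeasure := by
    rw [hcast]; infer_instance
  have hc := Measure.isAddLeftInvariant_eq_smul (volume : Measure (En n)) μH[(n : ℝ)]
  set c := Measure.addHaarScalarFactor (volume : Measure (En n)) μH[(n : ℝ)]
  have h1 := hausdorffMeasure_image_le_of_edist_le (f := fun x => A x) (g := f) (F := F)
    (K := l.toNNReal) (d := n) (by positivity) fun u hu v hv => by
      rw [edist_dist, edist_dist, dist_eq_norm, dist_eq_norm, ← map_sub]
      refine (ENNReal.ofReal_le_ofReal (h u hu v hv)).trans ?_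
      rw [ENNReal.ofReal_mul hl.le]
      rfl
  have h2 := Measure.addHaar_image_linearMap volume (A : En n →ₗ[ℝ] En n) F
  rw [← h2, hc, Measure.smul_apply, Measure.smul_apply, ENNReal.smul_def, ENNReal.smul_def,
    smul_eq_mul, smul_eq_mul, mul_left_comm]
  gcongr
  refine h1.trans (le_of_eq ?_)
  rw [ENNReal.rpow_natCast, ENNReal.ofReal_pow hl.le]
  rfl

/-- Change of variables inequality with multiplicity. -/
theorem lintegral_comp_mul_det_le {n : ℕ} (hn : 0 < n) {D : Set (En n)} (hD : IsOpen D)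
    {f : En n → En n} (hfm : Measurable f) (hf : ContinuousOn f D)
    {W : En n → (En n →L[ℝ] En n)} (hW : Measurable W) {Z : Set (En n)} (hZ : volume Z = 0)
    (h : HasLipschitzPieces D f W Z) {N : ℝ≥0∞}
    (hN : ∀ y, ((D ∩ f ⁻¹' {y}).encard : ℝ≥0∞) ≤ N) {g : En n → ℝ≥0∞} (hg : Measurable g) :
    ∫⁻ x in D, g (f x) * ENNReal.ofReal |LinearMap.det (W x : En n →ₗ[ℝ] En n)|
      ≤ N * ∫⁻ y, g y := by
  refine le_of_forall_le_ofReal_pow_mul (n + 1) fun l hl => ?_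
  have hl0 : 0 < l := by linarith
  obtain ⟨E, A, hEm, hED, hEd, hEc, hA, hEW, hEf⟩ := h.exists_pieces hn hD hf hW hl
  have hinj : ∀ k, InjOn f (E k) := fun k =>
    injOn_of_norm_clm_le hn (hA k) fun x hx y hy => (hEf k x hx y hy).2
  have him : ∀ k, MeasurableSet (f '' E k) := fun k =>
    (hEm k).image_of_measurable_injOn hfm (hinj k)
  set H : En n → ℝ≥0∞ := fun x =>
    g (f x) * ENNReal.ofReal |LinearMap.det (W x : En n →ₗ[ℝ] En n)| with hH
  have hk : ∀ k, ∫⁻ x in E k, H x ≤ ENNReal.ofReal (l ^ (n + 1)) * ∫⁻ y in f '' E k, g y := by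
    intro k
    calc ∫⁻ x in E k, H x
        ≤ ∫⁻ x in E k, ENNReal.ofReal l *
            (ENNReal.ofReal |LinearMap.det (A k : En n →ₗ[ℝ] En n)| * g (f x)) := by
          refine setLIntegral_mono' (hEm k) fun x hx => ?_
          simp only [hH]
          rw [← mul_assoc, ← ENNReal.ofReal_mul hl0.le, mul_comm (g (f x))]
          exact mul_le_mul_left (ENNReal.ofReal_le_ofReal (hEW k x hx).1) _
      _ = ENNReal.ofReal l * (ENNReal.ofReal |LinearMap.det (A k : En n →ₗ[ℝ] En n)| *
            ∫⁻ x in E k, g (f x)) := by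
          rw [lintegral_const_mul' _ _ ENNReal.ofReal_ne_top,
            lintegral_const_mul' _ _ ENNReal.ofReal_ne_top]
      _ ≤ ENNReal.ofReal l * (ENNReal.ofReal (l ^ n) * ∫⁻ y in f '' E k, g y) := by
          refine mul_le_mul_right ?_ _
          exact setLIntegral_le_image hfm (fun F' hF' _ => abs_det_mul_volume_le hl0
            fun x hx y hy => (hEf k x (hF' hx) y (hF' hy)).2) (hEm k) hg
      _ = ENNReal.ofReal (l ^ (n + 1)) * ∫⁻ y in f '' E k, g y := by
          rw [← mul_assoc, ← ENNReal.ofReal_mul hl0.le, pow_succ']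
  have hDU : ∫⁻ x in D, H x ≤ ∫⁻ x in ⋃ k, E k, H x := by
    rw [← lintegral_indicator hD.measurableSet, ← lintegral_indicator (.iUnion hEm)]
    refine lintegral_mono_ae ?_
    have hZ' : ∀ᵐ x, x ∉ Z := measure_eq_zero_iff_ae_notMem.1 hZ
    filter_upwards [hZ'] with x hx
    by_cases hxD : x ∈ D
    · by_cases hdet : LinearMap.det (W x : En n →ₗ[ℝ] En n) = 0
      · rw [indicator_of_mem hxD]
        simp [hH, hdet]
      · rw [indicator_of_mem hxD, indicator_of_mem (hEc ⟨⟨hxD, hdet⟩, hx⟩)]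
    · rw [indicator_of_notMem hxD]
      exact zero_le
  calc ∫⁻ x in D, H x ≤ ∫⁻ x in ⋃ k, E k, H x := hDU
    _ = ∑' k, ∫⁻ x in E k, H x := lintegral_iUnion hEm hEd _
    _ ≤ ∑' k, ENNReal.ofReal (l ^ (n + 1)) * ∫⁻ y in f '' E k, g y := ENNReal.tsum_le_tsum hk
    _ = ENNReal.ofReal (l ^ (n + 1)) *
          ∫⁻ y, g y * ∑' k, (f '' E k).indicator (1 : En n → ℝ≥0∞) y := by
        rw [ENNReal.tsum_mul_left, lintegral_mul_tsum_indicator him hg]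
    _ ≤ ENNReal.ofReal (l ^ (n + 1)) * ∫⁻ y, g y * N := by
        gcongr with y
        exact (tsum_indicator_image_le_encard hEm hED hEd hD.measurableSet hfm y).trans (hN y)
    _ = ENNReal.ofReal (l ^ (n + 1)) * (N * ∫⁻ y, g y) := by
        rw [lintegral_mul_const _ hg, mul_comm N]

/-- Area inequality on spheres with multiplicity. -/
theorem lintegral_mul_encard_sphere_le {m n : ℕ} (hmn : n = m + 1) {D : Set (En n)}
    (hD : IsOpen D) {f : En n → En n} (hfm : Measurable f) (hf : ContinuousOn f D)
    {W : En n → (En n →L[ℝ] En n)} (hW : Measurable W) {Z : Set (En n)}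
    (h : HasLipschitzPieces D f W Z) {x₀ : En n} {r : ℝ} (hr : 0 < r)
    (hnull : μH[(m : ℝ)] (f '' ((Z ∪ {x | LinearMap.det (W x : En n →ₗ[ℝ] En n) = 0}) ∩
      (D ∩ sphere x₀ r))) = 0) {g : En n → ℝ≥0∞} (hg : Measurable g) :
    ∫⁻ y, g y * ((D ∩ sphere x₀ r ∩ f ⁻¹' {y}).encard : ℝ≥0∞) ∂μH[(m : ℝ)]
      ≤ ∫⁻ x in D ∩ sphere x₀ r, g (f x) * ENNReal.ofReal (hyperplaneJac (W x)) ∂μH[(m : ℝ)] := by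
  have hn : 0 < n := by omega
  refine le_of_forall_le_ofReal_pow_mul (2 * m + 1) fun l hl => ?_
  have hl0 : 0 < l := by linarith
  obtain ⟨E, A, hEm, hED, hEd, hEc, hA, hEW, hEf⟩ := h.exists_pieces hn hD hf hW hl
  set S : Set (En n) := D ∩ sphere x₀ r with hS
  have hSm : MeasurableSet S := hD.measurableSet.inter isClosed_sphere.measurableSet
  have hFm : ∀ k, MeasurableSet (E k ∩ S) := fun k => (hEm k).inter hSm
  have hinj : ∀ k, InjOn f (E k ∩ S) := fun k =>
    (injOn_of_norm_clm_le hn (hA k) fun x hx y hy => (hEf k x hx y hy).2).mono inter_subset_left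
  have him : ∀ k, MeasurableSet (f '' (E k ∩ S)) := fun k =>
    (hFm k).image_of_measurable_injOn hfm (hinj k)
  have hk : ∀ k, ∫⁻ y in f '' (E k ∩ S), g y ∂μH[(m : ℝ)] ≤ ENNReal.ofReal (l ^ (2 * m + 1)) *
      ∫⁻ x in E k ∩ S, g (f x) * ENNReal.ofReal (hyperplaneJac (W x)) ∂μH[(m : ℝ)] := by
    intro k
    calc ∫⁻ y in f '' (E k ∩ S), g y ∂μH[(m : ℝ)]
        ≤ (ENNReal.ofReal (l ^ 2) ^ (m : ℝ) * ENNReal.ofReal (hyperplaneJac (A k))) *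
            ∫⁻ x in E k ∩ S, g (f x) ∂μH[(m : ℝ)] := by
          refine setLIntegral_image_le hfm (fun F' hF' hF'm => ?_) (hFm k) hg
          rw [mul_assoc]
          exact hausdorffMeasure_image_sphere_le hmn (hA k) hr hl0 (by nlinarith)
            (fun x hx => (hF' hx).2.2) hF'm
            fun u hu v hv => (hEf k u (hF' hu).1 v (hF' hv).1).1
      _ = ENNReal.ofReal (l ^ (2 * m)) *
            ∫⁻ x in E k ∩ S, ENNReal.ofReal (hyperplaneJac (A k)) * g (f x) ∂μH[(m : ℝ)] := by
          rw [lintegral_const_mul' _ _ ENNReal.ofReal_ne_top, ENNReal.rpow_natCast,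
            ← ENNReal.ofReal_pow (by positivity), ← pow_mul, mul_assoc]
      _ ≤ ENNReal.ofReal (l ^ (2 * m)) * ∫⁻ x in E k ∩ S, ENNReal.ofReal l *
            (g (f x) * ENNReal.ofReal (hyperplaneJac (W x))) ∂μH[(m : ℝ)] := by
          refine mul_le_mul_right (setLIntegral_mono' (hFm k) fun x hx => ?_) _
          rw [mul_left_comm, mul_comm, ← ENNReal.ofReal_mul hl0.le]
          gcongr
          exact (hEW k x hx.1).2
      _ = _ := by
          rw [lintegral_const_mul' _ _ ENNReal.ofReal_ne_top, ← mul_assoc,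
            ← ENNReal.ofReal_mul (by positivity), pow_succ]
  have hcard : ∀ᵐ y ∂(μH[(m : ℝ)] : Measure (En n)), ((S ∩ f ⁻¹' {y}).encard : ℝ≥0∞) ≤
      ∑' k, (f '' (E k ∩ S)).indicator (1 : En n → ℝ≥0∞) y := by
    filter_upwards [measure_eq_zero_iff_ae_notMem.1 hnull] with y hy
    refine encard_le_tsum_indicator_image hinj hSm hfm hFm fun x hx => ?_
    have hxbad : x ∉ Z ∪ {x | LinearMap.det (W x : En n →ₗ[ℝ] En n) = 0} := fun hb =>
      hy ⟨x, ⟨hb, hx.1⟩, hx.2⟩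
    obtain ⟨k, hxk⟩ := mem_iUnion.1 (hEc ⟨⟨hx.1.1, fun h0 => hxbad (Or.inr h0)⟩,
      fun hz => hxbad (Or.inl hz)⟩)
    exact mem_iUnion.2 ⟨k, hxk, hx.1⟩
  calc ∫⁻ y, g y * ((S ∩ f ⁻¹' {y}).encard : ℝ≥0∞) ∂μH[(m : ℝ)]
      ≤ ∫⁻ y, g y * ∑' k, (f '' (E k ∩ S)).indicator (1 : En n → ℝ≥0∞) y ∂μH[(m : ℝ)] :=
        lintegral_mono_ae (hcard.mono fun y hy => mul_le_mul_right hy _)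
    _ = ∑' k, ∫⁻ y in f '' (E k ∩ S), g y ∂μH[(m : ℝ)] := lintegral_mul_tsum_indicator him hg
    _ ≤ ∑' k, ENNReal.ofReal (l ^ (2 * m + 1)) *
          ∫⁻ x in E k ∩ S, g (f x) * ENNReal.ofReal (hyperplaneJac (W x)) ∂μH[(m : ℝ)] :=
        ENNReal.tsum_le_tsum hk
    _ = ENNReal.ofReal (l ^ (2 * m + 1)) *
          ∫⁻ x in ⋃ k, E k ∩ S, g (f x) * ENNReal.ofReal (hyperplaneJac (W x)) ∂μH[(m : ℝ)] := by
        rw [ENNReal.tsum_mul_left, lintegral_iUnion hFm fun i j hij =>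
          (hEd hij).mono inter_subset_left inter_subset_left]
    _ ≤ _ := by
        gcongr
        exact iUnion_subset fun k => inter_subset_right

theorem hausdorffMeasure_sphere_cap_ne_top {m n : ℕ} {L : En m →ₗᵢ[ℝ] En n} {e : En n}
    (he : ‖e‖ = 1) (hLe : ∀ z, inner ℝ (L z) e = 0)
    (hsurj : ∀ w, inner ℝ w e = 0 → ∃ z, L z = w) (x₀ : En n) {r l : ℝ} (hl : 0 < l) :
    μH[(m : ℝ)] {x | dist x x₀ = r ∧ l < inner ℝ (x - x₀) e} ≠ ∞ := by
  have hcast : (m : ℝ) = Module.finrank ℝ (En m) := by simp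
  have hH : (μH[(m : ℝ)] : Measure (En m)).IsAddHaarMeasure := by
    rw [hcast]; infer_instance
  by_cases hr : r ≤ 0
  · have : {x | dist x x₀ = r ∧ l < inner ℝ (x - x₀) e} = ∅ := by
      ext x
      simp only [mem_ofPred_eq, mem_empty_iff_false, iff_false, not_and, not_lt]
      intro hx
      have h1 : x - x₀ = 0 := by
        rw [← norm_le_zero_iff, ← dist_eq_norm, hx]; exact hr
      rw [h1, inner_zero_left]
      exact hl.le
    simp [this]
  push Not at hr
  set F : Set (En m) := {z | ‖z‖ < r ∧ l < √(r ^ 2 - ‖z‖ ^ 2)} with hF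
  have hsub : {x | dist x x₀ = r ∧ l < inner ℝ (x - x₀) e} ⊆ capMap x₀ L e r '' F := by
    rintro x ⟨hx, hxl⟩
    obtain ⟨z, hz, rfl⟩ := exists_capMap_eq x₀ he hLe hsurj hx (hl.trans hxl).le
    rw [inner_capMap x₀ he hLe] at hxl
    refine ⟨z, ⟨lt_of_le_of_ne hz fun h => ?_, hxl⟩, rfl⟩
    rw [h, sub_self, Real.sqrt_zero] at hxl
    linarith
  refine ne_top_of_le_ne_top ?_ (measure_mono hsub)
  have h1 := hausdorffMeasure_image_le_of_edist_le (f := capMap x₀ L e r) (g := id) (F := F)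
    (K := (1 + r / l).toNNReal) (d := m) (by positivity) fun z hz w hw => by
      rw [edist_dist, edist_dist, dist_eq_norm, id, id, dist_eq_norm]
      have h2 : capMap x₀ L e r z - capMap x₀ L e r w
          = L (z - w) + (√(r ^ 2 - ‖z‖ ^ 2) - √(r ^ 2 - ‖w‖ ^ 2)) • e := by
        rw [capMap, capMap, map_sub, sub_smul]; abel
      have h3 : ‖capMap x₀ L e r z - capMap x₀ L e r w‖ ≤ (1 + r / l) * ‖z - w‖ := by
        rw [h2, add_mul, one_mul]
        refine (norm_add_le _ _).trans (add_le_add (L.norm_map _).le ?_)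
        rw [norm_smul, he, mul_one, Real.norm_eq_abs]
        exact abs_sqrt_sub_sqrt_le hl hz.1 hw.1 hz.2 hw.2
      refine (ENNReal.ofReal_le_ofReal h3).trans ?_
      rw [ENNReal.ofReal_mul (by positivity)]
      rfl
  refine ne_top_of_le_ne_top (ENNReal.mul_ne_top ?_ ?_) h1
  · exact ENNReal.rpow_ne_top_of_nonneg (by positivity) ENNReal.coe_ne_top
  · rw [image_id]
    refine ne_top_of_le_ne_top (isCompact_closedBall (0 : En m) r).measure_ne_top
      (measure_mono fun z hz => ?_)
    rw [mem_closedBall_zero_iff]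
    exact hz.1.le

theorem exists_countable_cover_sphere {m n : ℕ} (hmn : n = m + 1) (x₀ : En n) {r : ℝ}
    (hr : 0 < r) : ∃ C : (Fin n × Bool) × ℕ → Set (En n), (∀ i, MeasurableSet (C i)) ∧
      (∀ i, μH[(m : ℝ)] (C i) ≠ ∞) ∧ sphere x₀ r ⊆ ⋃ i, C i := by
  let e : Fin n × Bool → En n := fun q =>
    (if q.2 then (1 : ℝ) else -1) • EuclideanSpace.single q.1 (1 : ℝ)
  have he : ∀ q, ‖e q‖ = 1 := fun q => by
    obtain ⟨i, s⟩ := q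
    cases s <;> simp [e]
  refine ⟨fun i => {x | dist x x₀ = r ∧ 1 / ((i.2 : ℝ) + 1) < inner ℝ (x - x₀) (e i.1)},
    fun i => ?_, fun i => ?_, fun x hx => ?_⟩
  · have h1 : Continuous fun x : En n => dist x x₀ := by fun_prop
    have h2 : Continuous fun x : En n => inner ℝ (x - x₀) (e i.1) := by fun_prop
    exact (measurableSet_eq_fun h1.measurable measurable_const).inter
      (measurableSet_lt measurable_const h2.measurable)
  · obtain ⟨L, hL1, hL2⟩ := exists_isometry_orthogonal hmn (he i.1)
    exact hausdorffMeasure_sphere_cap_ne_top (he i.1) hL1 hL2 x₀ (by positivity)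
  · have hx0 : x - x₀ ≠ 0 := fun h => by
      rw [mem_sphere, dist_eq_norm, h, norm_zero] at hx; linarith
    obtain ⟨q, hq⟩ : ∃ q, 0 < inner ℝ (x - x₀) (e q) := by
      by_contra! hcon
      refine hx0 ?_
      ext k
      have h1 := hcon (k, true)
      have h2 := hcon (k, false)
      simp [e, EuclideanSpace.inner_single_right] at h1 h2
      simp
      linarith
    obtain ⟨j, hj⟩ := exists_nat_one_div_lt hq
    exact mem_iUnion.2 ⟨(q, j), hx, hj⟩

/-- A Sard-type statement: the part of a sphere where the derivative vanishes has null image. -/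
theorem HasLipschitzPieces.hausdorffMeasure_image_sphere_eq_zero {m n : ℕ} (hm : 0 < m)
    (hmn : n = m + 1) {D : Set (En n)} (hD : IsOpen D) {f : En n → En n}
    (hf : ContinuousOn f D) {W : En n → (En n →L[ℝ] En n)} {Z : Set (En n)}
    (h : HasLipschitzPieces D f W Z) (x₀ : En n) {r : ℝ} (hr : 0 < r) :
    μH[(m : ℝ)] (f '' (({x | W x = 0} \ Z) ∩ (D ∩ sphere x₀ r))) = 0 := by
  obtain ⟨C, hCm, hCt, hCc⟩ := exists_countable_cover_sphere hmn x₀ hr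
  have key : ∀ i, μH[(m : ℝ)] (f '' (({x | W x = 0} \ Z) ∩ (D ∩ C i))) = 0 := by
    intro i
    have hle : ∀ ε : ℝ, 0 < ε → μH[(m : ℝ)] (f '' (({x | W x = 0} \ Z) ∩ (D ∩ C i)))
        ≤ ENNReal.ofReal (ε ^ m) * μH[(m : ℝ)] (C i) := by
      intro ε hε
      obtain ⟨P, hPm, -, hPd, hPc, hPf⟩ := h.exists_small_pieces hD hf hε
      calc μH[(m : ℝ)] (f '' (({x | W x = 0} \ Z) ∩ (D ∩ C i)))
          ≤ μH[(m : ℝ)] (⋃ k, f '' (P k ∩ C i)) := by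
            refine measure_mono ?_
            rintro _ ⟨x, ⟨⟨hx1, hx2⟩, hx3, hx4⟩, rfl⟩
            obtain ⟨k, hk⟩ := mem_iUnion.1 (hPc ⟨⟨hx3, hx1⟩, hx2⟩)
            exact mem_iUnion.2 ⟨k, mem_image_of_mem f ⟨hk, hx4⟩⟩
        _ ≤ ∑' k, μH[(m : ℝ)] (f '' (P k ∩ C i)) := measure_iUnion_le _
        _ ≤ ∑' k, ENNReal.ofReal (ε ^ m) * μH[(m : ℝ)] (P k ∩ C i) := by
            refine ENNReal.tsum_le_tsum fun k => ?_
            have h1 := hausdorffMeasure_image_le_of_edist_le (f := f) (g := id) (F := P k ∩ C i)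
              (K := ε.toNNReal) (d := m) (by positivity) fun u hu v hv => by
                rw [edist_dist, edist_dist, dist_eq_norm, id, id, dist_eq_norm]
                refine (ENNReal.ofReal_le_ofReal (hPf k u hu.1 v hv.1)).trans ?_
                rw [ENNReal.ofReal_mul hε.le]
                rfl
            rw [image_id, ENNReal.rpow_natCast] at h1
            rw [ENNReal.ofReal_pow hε.le]
            exact h1
        _ = ENNReal.ofReal (ε ^ m) * μH[(m : ℝ)] (⋃ k, P k ∩ C i) := by
            rw [ENNReal.tsum_mul_left, measure_iUnion
              (fun a b hab => (hPd hab).mono inter_subset_left inter_subset_left)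
              fun k => (hPm k).inter (hCm i)]
        _ ≤ ENNReal.ofReal (ε ^ m) * μH[(m : ℝ)] (C i) :=
            mul_le_mul_right (measure_mono (iUnion_subset fun k => inter_subset_right)) _
    have h1 : Tendsto (fun ε : ℝ => ENNReal.ofReal (ε ^ m) * μH[(m : ℝ)] (C i)) (𝓝[>] 0)
        (𝓝 (0 * μH[(m : ℝ)] (C i))) := by
      refine ENNReal.Tendsto.mul_const ?_ (Or.inr (hCt i))
      have h2 : Continuous fun ε : ℝ => ENNReal.ofReal (ε ^ m) :=
        ENNReal.continuous_ofReal.comp (continuous_pow m)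
      have h3 := (h2.tendsto 0).mono_left (nhdsWithin_le_nhds (s := Ioi 0))
      simpa [hm.ne'] using h3
    rw [zero_mul] at h1
    exact le_antisymm (ge_of_tendsto h1 (eventually_mem_nhdsWithin.mono fun ε hε => hle ε hε))
      zero_le
  refine measure_mono_null ?_ (measure_iUnion_null key)
  rintro _ ⟨x, ⟨hx1, hx2, hx3⟩, rfl⟩
  obtain ⟨i, hi⟩ := mem_iUnion.1 (hCc hx3)
  exact mem_iUnion.2 ⟨i, mem_image_of_mem f ⟨hx1, hx2, hi⟩⟩

theorem hausdorffMeasure_sphere_inter_open_pos {m n : ℕ} (hmn : n = m + 1) {D : Set (En n)}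
    (hD : IsOpen D) {x₀ : En n} {r : ℝ} (hr : 0 < r) (hne : (sphere x₀ r ∩ D).Nonempty) :
    0 < μH[(m : ℝ)] (sphere x₀ r ∩ D) := by
  have hcast : (m : ℝ) = Module.finrank ℝ (En m) := by simp
  have hH : (μH[(m : ℝ)] : Measure (En m)).IsAddHaarMeasure := by
    rw [hcast]; infer_instance
  obtain ⟨x, hxr, hxD⟩ := hne
  have hxn : ‖x - x₀‖ = r := by rw [← dist_eq_norm]; exact hxr
  set e : En n := r⁻¹ • (x - x₀) with he_def
  have he : ‖e‖ = 1 := by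
    rw [norm_smul, hxn, norm_inv, Real.norm_eq_abs, abs_of_pos hr, inv_mul_cancel₀ hr.ne']
  obtain ⟨L, hL1, hL2⟩ := exists_isometry_orthogonal hmn he
  obtain ⟨G, hG, hGc⟩ := exists_lipschitz_leftInverse_capMap x₀ he hL1
  have hc : capMap x₀ L e r 0 = x := by
    rw [capMap, map_zero, norm_zero, add_zero, zero_pow two_ne_zero, sub_zero,
      Real.sqrt_sq hr.le, he_def, smul_smul, mul_inv_cancel₀ hr.ne', one_smul,
      add_sub_cancel]
  have hcont : Continuous (capMap x₀ L e r) :=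
    (continuous_capMap x₀ (L := L) (e := e)).comp (Continuous.prodMk_right r)
  set U : Set (En m) := ball 0 r ∩ capMap x₀ L e r ⁻¹' D with hU
  have hUo : IsOpen U := isOpen_ball.inter (hD.preimage hcont)
  have hU0 : (0 : En m) ∈ U := ⟨mem_ball_self hr, by rw [mem_preimage, hc]; exact hxD⟩
  have hUim : U ⊆ (fun y => (G y).2) '' (sphere x₀ r ∩ D) := by
    intro z hz
    have hzr : ‖z‖ ≤ r := (mem_ball_zero_iff.1 hz.1).le
    refine ⟨capMap x₀ L e r z, ⟨dist_capMap x₀ he hL1 hr.le hzr, hz.2⟩, ?_⟩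
    simp only [hGc r z hr.le hzr]
  have hG2 : LipschitzWith 1 fun y => (G y).2 := by
    have := LipschitzWith.prod_snd.comp hG
    rwa [one_mul] at this
  have h1 := hG2.hausdorffMeasure_image_le (d := (m : ℝ)) m.cast_nonneg (sphere x₀ r ∩ D)
  simp only [ENNReal.coe_one, ENNReal.one_rpow, one_mul] at h1
  exact (hUo.measure_pos μH[(m : ℝ)] ⟨0, hU0⟩).trans_le ((measure_mono hUim).trans h1)

theorem volume_setOf_dist_mem_eq_zero {n : ℕ} (hn : 0 < n) (x₀ : En n) {R : Set ℝ}
    (hR0 : volume R = 0) : volume {x : En n | dist x x₀ ∈ R} = 0 := by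
  have : Nonempty (Fin n) := ⟨⟨0, hn⟩⟩
  set g : ℝ → ℝ := R.indicator 1 with hg
  have hg0 : g =ᵐ[volume] 0 := by
    filter_upwards [measure_eq_zero_iff_ae_notMem.1 hR0] with y hy
    simp [hg, hy]
  have hint : Integrable (fun x : En n => g ‖x‖) := by
    rw [integrable_fun_norm_addHaar]
    refine Integrable.congr (integrable_zero _ _ _) ?_
    filter_upwards [ae_restrict_of_ae hg0] with y hy
    simp [hy]
  have h0 : ∫ x : En n, g ‖x‖ = 0 := by
    rw [integral_fun_norm_addHaar, integral_eq_zero_of_ae, smul_zero, smul_zero]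
    filter_upwards [ae_restrict_of_ae hg0] with y hy
    simp [hy]
  have h1 := (integral_eq_zero_iff_of_nonneg (fun x => indicator_nonneg (by simp) _) hint).1 h0
  have h2 : volume {x : En n | ‖x‖ ∈ R} = 0 := by
    refine measure_mono_null (fun x hx => ?_) (ae_iff.1 h1)
    simp only [mem_ofPred_eq] at hx ⊢
    simp [indicator_of_mem hx]
  have h3 : {x : En n | dist x x₀ ∈ R} = (fun x => x + -x₀) ⁻¹' {x | ‖x‖ ∈ R} := by
    ext x
    simp [dist_eq_norm, ← sub_eq_add_neg]
  rw [h3, measure_preimage_add_right, h2]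

theorem Surface.mult_eq_indicator {k n : ℕ} {S : Surface k n} (h : InjOn S.toFun S.dom) :
    S.mult = S.image.indicator 1 := by
  ext y
  by_cases hy : y ∈ S.image
  · obtain ⟨z, hz, rfl⟩ := hy
    rw [indicator_of_mem (show S.toFun z ∈ S.image from mem_image_of_mem _ hz), Surface.mult]
    have : S.dom ∩ S.toFun ⁻¹' {S.toFun z} = {z} := by
      ext w
      exact ⟨fun hw => h hw.1 hz hw.2, by rintro rfl; exact ⟨hz, rfl⟩⟩
    simp [this]
  · rw [indicator_of_notMem hy, Surface.mult]
    have : S.dom ∩ S.toFun ⁻¹' {y} = ∅ := by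
      ext w
      simp only [mem_inter_iff, mem_preimage, mem_singleton_iff, mem_empty_iff_false, iff_false]
      rintro ⟨hw, rfl⟩
      exact hy (mem_image_of_mem _ hw)
    simp [this]

theorem Surface.sIntegral_eq_setLIntegral {k n : ℕ} {S : Surface k n} (h : InjOn S.toFun S.dom)
    (hS : MeasurableSet S.image) (ρ : En n → ℝ≥0∞) :
    S.sIntegral ρ = ∫⁻ y in S.image, ρ y ∂μH[(k : ℝ)] := by
  rw [Surface.sIntegral, Surface.mult_eq_indicator h, ← lintegral_indicator hS]
  congr 1 with y
  by_cases hy : y ∈ S.image <;> simp [hy]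

theorem Surface.mult_eq_encard_of_injOn {k n : ℕ} {S S' : Surface k n} {f : En n → En n}
    (h : InjOn S.toFun S.dom) (hdom : S'.dom = S.dom)
    (hfun : ∀ z ∈ S.dom, S'.toFun z = f (S.toFun z)) (y : En n) :
    S'.mult y = ((S.image ∩ f ⁻¹' {y}).encard : ℝ≥0∞) := by
  have h1 : S.image ∩ f ⁻¹' {y} = S.toFun '' (S'.dom ∩ S'.toFun ⁻¹' {y}) := by
    ext x
    constructor
    · rintro ⟨⟨z, hz, rfl⟩, hx⟩
      exact ⟨z, ⟨hdom ▸ hz, (hfun z hz).trans hx⟩, rfl⟩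
    · rintro ⟨z, ⟨hz, hzy⟩, rfl⟩
      rw [hdom] at hz
      exact ⟨⟨z, hz, rfl⟩, (hfun z hz).symm.trans hzy⟩
  rw [Surface.mult, h1, InjOn.encard_image]
  exact h.mono fun z hz => hdom ▸ hz.1

theorem surfModulus_eq_zero_of_null_radii {n : ℕ} (hn : 3 ≤ n) {D : Set (En n)} (hD : IsOpen D)
    (x₀ : En n) {p : ℝ} (hp : 0 < p) {R : Set ℝ} (hR : volume R = 0)
    {Γ : Set (Surface (n - 1) n)}
    (hΓ : ∀ S ∈ Γ, InjOn S.toFun S.dom ∧ ∃ r ∈ R, 0 < r ∧ (sphere x₀ r ∩ D).Nonempty ∧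
      S.image = sphere x₀ r ∩ D) : surfModulus p Γ = 0 := by
  set A : Set (En n) := {x | dist x x₀ ∈ toMeasurable volume R} with hA
  have hd : Measurable fun x : En n => dist x x₀ :=
    (continuous_id.dist continuous_const).measurable
  have hAm : MeasurableSet A := hd (measurableSet_toMeasurable _ _)
  have hA0 : volume A = 0 := volume_setOf_dist_mem_eq_zero (by omega) x₀
    (by rwa [measure_toMeasurable])
  have hm : (0 : ℝ) < ((n - 1 : ℕ) : ℝ) := by
    have : 0 < n - 1 := by omega
    exact_mod_cast this
  refine le_antisymm (iInf₂_le_of_le (A.indicator fun _ => ∞)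
    ⟨measurable_const.indicator hAm, fun S hS => ?_⟩ (le_of_eq ?_)) zero_le
  · obtain ⟨hinj, r, hrR, hr, hne, him⟩ := hΓ S hS
    have hSm : MeasurableSet S.image := by
      rw [him]; exact isClosed_sphere.measurableSet.inter hD.measurableSet
    rw [Surface.sIntegral_eq_setLIntegral hinj hSm]
    have hpos : 0 < μH[((n - 1 : ℕ) : ℝ)] S.image := by
      rw [him]
      exact hausdorffMeasure_sphere_inter_open_pos (by omega) hD hr hne
    calc (1 : ℝ≥0∞) ≤ ∞ * μH[((n - 1 : ℕ) : ℝ)] S.image := by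
          rw [ENNReal.top_mul hpos.ne']; exact le_top
      _ = ∫⁻ _ in S.image, ∞ ∂μH[((n - 1 : ℕ) : ℝ)] := by
          rw [lintegral_const, Measure.restrict_apply_univ]
      _ ≤ _ := by
          refine setLIntegral_mono' hSm fun y hy => ?_
          have hyA : y ∈ A := by
            rw [him] at hy
            have : dist y x₀ = r := hy.1
            rw [hA, mem_ofPred_eq, this]
            exact subset_toMeasurable _ _ hrR
          rw [indicator_of_mem hyA, ENNReal.top_rpow_of_pos hm]
  · rw [lintegral_eq_zero_iff ((measurable_const.indicator hAm).pow_const _)]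
    filter_upwards [measure_eq_zero_iff_ae_notMem.1 hA0] with x hx
    rw [indicator_of_notMem hx, ENNReal.zero_rpow_of_pos hp, Pi.zero_apply]

theorem sphere_inter_nonempty {n : ℕ} {D : Set (En n)} (hD : IsConnected D) {x₀ : En n}
    (hx₀ : x₀ ∈ closure D) {r : ℝ} (hr : 0 < r) (hx : ∃ x ∈ D, r < dist x x₀) :
    (sphere x₀ r ∩ D).Nonempty := by
  obtain ⟨x, hxD, hxr⟩ := hx
  obtain ⟨y, hyD, hyr⟩ := Metric.mem_closure_iff.1 hx₀ r hr
  rw [dist_comm] at hyr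
  have hc : ContinuousOn (fun z => dist z x₀) D := by fun_prop
  obtain ⟨z, hzD, hz⟩ := hD.isPreconnected.intermediate_value hyD hxD hc ⟨hyr.le, hxr.le⟩
  exact ⟨z, hz, hzD⟩

/-- The pointwise identity relating the density to the inner dilatation. -/
theorem hyperplaneJac_rpow_div_le {n : ℕ} (hn : 3 ≤ n) {p α : ℝ} (hp : (n : ℝ) - 1 < p)
    (hα : α = p / (p - n + 1)) (A : En n →L[ℝ] En n) (N : ℝ≥0∞) :
    ENNReal.ofReal (hyperplaneJac A) ^ (p / ((n : ℝ) - 1)) /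
        (N * innerDil α A ^ ((p - (n : ℝ) + 1) / ((n : ℝ) - 1)))
      ≤ ENNReal.ofReal |LinearMap.det (A : En n →ₗ[ℝ] En n)| / N := by
  have hn3 : (3 : ℝ) ≤ n := by exact_mod_cast hn
  have hm : (0 : ℝ) < (n : ℝ) - 1 := by linarith
  have hq : 0 < p - (n : ℝ) + 1 := by linarith
  have hp0 : 0 < p := by linarith
  by_cases hA : LinearMap.det (A : En n →ₗ[ℝ] En n) = 0
  · rw [hyperplaneJac, hA, abs_zero, zero_div, ENNReal.ofReal_zero,
      ENNReal.zero_rpow_of_pos (by positivity), ENNReal.zero_div]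
    exact zero_le
  have hl := minStretch_pos (show 0 < n by omega) hA
  have hd : 0 < |LinearMap.det (A : En n →ₗ[ℝ] En n)| := abs_pos.2 hA
  rw [innerDil, if_pos hA, hyperplaneJac]
  set d := |LinearMap.det (A : En n →ₗ[ℝ] En n)|
  set l := minStretch A
  set m : ℝ := (n : ℝ) - 1 with hm_def
  have hpm : p - (n : ℝ) + 1 = p - m := by rw [hm_def]; ring
  rw [hpm] at hq hα ⊢
  rw [ENNReal.ofReal_rpow_of_pos (by positivity), ENNReal.ofReal_rpow_of_pos (by positivity)]
  have key : (d / l) ^ (p / m) = d * (d / l ^ α) ^ ((p - m) / m) := by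
    have e1 : α * ((p - m) / m) = p / m := by rw [hα]; field_simp
    have e2 : p / m = 1 + (p - m) / m := by field_simp; ring
    rw [Real.div_rpow hd.le hl.le, Real.div_rpow hd.le (by positivity), ← Real.rpow_mul hl.le, e1,
      mul_div_assoc', ← Real.rpow_one_add' hd.le (by rw [← e2]; positivity), ← e2]
  have hK : 0 < (d / l ^ α) ^ ((p - m) / m) := by positivity
  rw [key, ENNReal.ofReal_mul hd.le, ENNReal.mul_div_mul_right _ _ (by simpa using hK)
    ENNReal.ofReal_ne_top]

theorem measurable_indicator_of_continuousOn {n : ℕ} {D : Set (En n)} (hD : MeasurableSet D)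
    {f : En n → En n} (hf : ContinuousOn f D) : Measurable (D.indicator f) := by
  classical
  rw [← piecewise_eq_indicator]
  exact hf.measurable_piecewise continuousOn_const hD

theorem HasLipschitzPieces.congr {n : ℕ} {D : Set (En n)} {f g : En n → En n}
    {W : En n → (En n →L[ℝ] En n)} {Z : Set (En n)} (h : HasLipschitzPieces D f W Z)
    (hfg : EqOn f g D) : HasLipschitzPieces D g W Z := fun ε hε => by
  obtain ⟨T, hT, hT'⟩ := h ε hε
  refine ⟨T, hT, fun i => ⟨(hT' i).1, fun x hx y hy => ?_⟩⟩
  rw [← hfg ((hT' i).1 hx), ← hfg ((hT' i).1 hy)]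
  exact (hT' i).2 x hx y hy

theorem HasLipschitzPieces.mono {n : ℕ} {D : Set (En n)} {f : En n → En n}
    {W : En n → (En n →L[ℝ] En n)} {Z Z' : Set (En n)} (h : HasLipschitzPieces D f W Z)
    (hZ : Z ⊆ Z') : HasLipschitzPieces D f W Z' := fun ε hε => by
  obtain ⟨T, hT, hT'⟩ := h ε hε
  exact ⟨T, (sdiff_subset_sdiff_right hZ).trans hT, hT'⟩

/-- Piecewise differentiability of the map, together with the fact that its singular set has null
image on almost all spheres. -/
theorem exists_hasLipschitzPieces_of_orlicz {n : ℕ} (hn : 3 ≤ n) {D : Set (En n)} (hD : IsOpen D)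
    (hne : D.Nonempty) {φ : ℝ → ℝ} (hφ_pos : ∀ t : ℝ, 0 < t → 0 < φ t)
    (hφ_mono : ∀ s t : ℝ, 0 < s → s ≤ t → φ s ≤ φ t)
    (hφ_int : ∫⁻ t in Ioi (1 : ℝ), ENNReal.ofReal ((t / φ t) ^ (1 / ((n : ℝ) - 2))) < ∞)
    {f : En n → En n} (hf : ContinuousOn f D)
    (hf_discrete : ∀ y : En n, ∀ x ∈ D ∩ f ⁻¹' {y},
      ∃ U : Set (En n), IsOpen U ∧ x ∈ U ∧ U ∩ (D ∩ f ⁻¹' {y}) = {x})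
    {Df : En n → (En n →L[ℝ] En n)} (hDf : IsWeakDerivOn n D f Df)
    (hOrlicz : OrliczCond n D φ Df)
    (hfin_dist : ∀ᵐ x ∂(volume.restrict D),
      LinearMap.det ((Df x) : En n →ₗ[ℝ] En n) = 0 → Df x = 0) :
    ∃ (W : En n → (En n →L[ℝ] En n)) (Z : Set (En n)), Measurable W ∧ volume Z = 0 ∧
      Df =ᵐ[volume.restrict D] W ∧ HasLipschitzPieces D f W Z ∧
      ∀ x₀, ∀ᵐ r : ℝ, 0 < r → μH[((n - 1 : ℕ) : ℝ)]
        (f '' ((Z ∪ {x | LinearMap.det (W x : En n →ₗ[ℝ] En n) = 0}) ∩ (D ∩ sphere x₀ r))) = 0 := by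
  obtain ⟨W, hS, hDfW⟩ := exists_smoothApprox hD hf hf_discrete hDf
  obtain ⟨Z, hZ, hpieces⟩ := exists_lipschitz_pieces hD hne hS
  have hdist : ∀ᵐ x, x ∈ D → LinearMap.det (W x : En n →ₗ[ℝ] En n) = 0 → W x = 0 := by
    rw [← ae_restrict_iff'₀ hD.measurableSet.nullMeasurableSet]
    filter_upwards [hfin_dist, hDfW] with x hx hxW
    rwa [hxW] at hx
  set Z' : Set (En n) :=
    {x | ¬ (x ∈ D → LinearMap.det (W x : En n →ₗ[ℝ] En n) = 0 → W x = 0)} with hZ'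
  have hZ'0 : volume Z' = 0 := ae_iff.1 hdist
  have hP : HasLipschitzPieces D f W (Z ∪ Z') :=
    HasLipschitzPieces.mono (Z := Z) hpieces subset_union_left
  refine ⟨W, Z ∪ Z', hS.stronglyMeasurable.measurable, measure_union_null hZ hZ'0, hDfW, hP,
    fun x₀ => ?_⟩
  have hmn : n = (n - 1) + 1 := by omega
  have hnull := ae_hausdorffMeasure_image_sphere_eq_zero (m := n - 1) (by omega) hmn
    (a := fun k => ENNReal.ofReal (φ (2 ^ k)))
    (fun k => (ENNReal.ofReal_pos.2 (hφ_pos _ (by positivity))).ne')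
    (fun k => ENNReal.ofReal_ne_top) (dyadicConst_ne_top hn hφ_pos hφ_mono hφ_int) hD hne hf hS
    (fun K hKD hK => setLIntegral_levelWeight_ne_top hφ_mono hDfW hOrlicz hKD hK) x₀
    (measure_union_null hZ hZ'0)
  filter_upwards [hnull] with r hr hr0
  have h2 := hP.hausdorffMeasure_image_sphere_eq_zero (m := n - 1) (by omega) hmn hD hf x₀ hr0
  refine measure_mono_null ?_ (measure_union_null (hr hr0) h2)
  rw [← image_union]
  refine image_mono ?_
  rintro x ⟨hx, hxD⟩
  by_cases hxZ : x ∈ Z ∪ Z'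
  · exact Or.inl ⟨hxZ, hxD⟩
  · have hdet : LinearMap.det (W x : En n →ₗ[ℝ] En n) = 0 := hx.resolve_left hxZ
    have h3 : x ∉ Z' := fun h => hxZ (Or.inr h)
    simp only [hZ', mem_ofPred_eq, not_not] at h3
    exact Or.inr ⟨⟨h3 hxD.1 hdet, hxZ⟩, hxD⟩

/-- The density obtained by pulling back `ρ` by `f`, weighted by the codimension one Jacobian. -/
def pullbackDensity {n : ℕ} (D : Set (En n)) (f : En n → En n)
    (W : En n → (En n →L[ℝ] En n)) (ρ : En n → ℝ≥0∞) (x : En n) : ℝ≥0∞ :=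
  ρ (D.indicator f x) * ENNReal.ofReal (hyperplaneJac (W x)) ^ (1 / ((n : ℝ) - 1))

theorem one_le_sIntegral_pullbackDensity {n : ℕ} (hn : 3 ≤ n) {D : Set (En n)} (hD : IsOpen D)
    {f : En n → En n} (hf : ContinuousOn f D) {W : En n → (En n →L[ℝ] En n)} (hW : Measurable W)
    {Z : Set (En n)} (hP : HasLipschitzPieces D (D.indicator f) W Z) {x₀ : En n} {r ε r₀ : ℝ}
    (hr : 0 < r) (hrI : r ∈ Ioo ε r₀)
    (hnull : μH[((n - 1 : ℕ) : ℝ)] (D.indicator f ''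
      ((Z ∪ {x | LinearMap.det (W x : En n →ₗ[ℝ] En n) = 0}) ∩ (D ∩ sphere x₀ r))) = 0)
    {ρ : En n → ℝ≥0∞} (hρ : admissibleS (surfImage f (sphereFamily n D x₀ ε r₀)) ρ)
    {S : Surface (n - 1) n} (hinj : InjOn S.toFun S.dom) (him : S.image = sphere x₀ r ∩ D) :
    1 ≤ S.sIntegral (fun y => pullbackDensity D f W ρ y ^ ((n - 1 : ℕ) : ℝ)) := by
  have hmn : n = (n - 1) + 1 := by omega
  have hcast : ((n - 1 : ℕ) : ℝ) = (n : ℝ) - 1 := by rw [Nat.cast_sub (by omega)]; simp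
  have hpos : (0 : ℝ) < (n : ℝ) - 1 := by
    have : (3 : ℝ) ≤ n := by exact_mod_cast hn
    linarith
  have hfm : Measurable (D.indicator f) := measurable_indicator_of_continuousOn hD.measurableSet hf
  have hmaps : MapsTo S.toFun S.dom D := fun z hz => by
    have : S.toFun z ∈ S.image := mem_image_of_mem _ hz
    rw [him] at this
    exact this.2
  let S' : Surface (n - 1) n := ⟨S.dom, S.isOpen_dom, f ∘ S.toFun, hf.comp S.contOn hmaps⟩
  have h1 := hρ.2 S' ⟨S, ⟨r, hrI, hinj, him⟩, rfl, fun z _ => rfl⟩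
  have hSm : MeasurableSet S.image := by
    rw [him]; exact isClosed_sphere.measurableSet.inter hD.measurableSet
  have hfi : ContinuousOn (D.indicator f) D := hf.congr fun x hx => indicator_of_mem hx f
  have h2 := lintegral_mul_encard_sphere_le hmn hD hfm hfi hW hP hr hnull
    (g := fun y => ρ y ^ ((n - 1 : ℕ) : ℝ)) (hρ.1.pow_const _)
  rw [Surface.sIntegral_eq_setLIntegral hinj hSm]
  refine h1.trans (le_trans (le_of_eq ?_) (h2.trans (le_of_eq ?_)))
  · rw [Surface.sIntegral]
    congr 1 with y
    rw [Surface.mult_eq_encard_of_injOn (S := S) (S' := S') hinj rfl fun z _ => rfl, him,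
      inter_comm (sphere x₀ r) D]
    have : D ∩ sphere x₀ r ∩ f ⁻¹' {y} = D ∩ sphere x₀ r ∩ D.indicator f ⁻¹' {y} := by
      ext x
      simp only [mem_inter_iff, mem_preimage, mem_singleton_iff, and_congr_right_iff]
      rintro ⟨hx, -⟩
      rw [indicator_of_mem hx]
    rw [this]
  · rw [him, inter_comm]
    congr 1 with x
    rw [pullbackDensity, ENNReal.mul_rpow_of_nonneg _ _ (by rw [hcast]; exact hpos.le),
      ← ENNReal.rpow_mul, hcast, one_div, inv_mul_cancel₀ hpos.ne', ENNReal.rpow_one]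

/-- Every open discrete map `f : D → ℝⁿ` of finite distortion of
Orlicz–Sobolev class `W^{1,φ}_loc` (with `∫₁^∞ (t/φ(t))^{1/(n-2)} dt < ∞`) and
`N(f,D) < ∞` is a lower `Q`-mapping w.r.t. the `p`-modulus (`p > n-1`) at every
`x₀ ∈ closure D`, with `Q(x) = N(f,D) · K_{I,α}(x,f)^{(p-n+1)/(n-1)}`, `α = p/(p-n+1)`. -/
theorem orlicz_sobolev_is_lower_Q_map
    (n : ℕ) (hn : 3 ≤ n) (D : Set (En n)) (hD : IsOpen D) (hDconn : IsConnected D)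
    (φ : ℝ → ℝ) (hφ_pos : ∀ t : ℝ, 0 < t → 0 < φ t)
    (hφ_mono : ∀ s t : ℝ, 0 < s → s ≤ t → φ s ≤ φ t)
    (hφ_int : ∫⁻ t in Ioi (1 : ℝ), ENNReal.ofReal ((t / φ t) ^ (1 / ((n : ℝ) - 2))) < ∞)
    (p α : ℝ) (hp : (n : ℝ) - 1 < p) (hα : α = p / (p - n + 1))
    (f : En n → En n) (hf_cont : ContinuousOn f D)
    (hf_open : ∀ U ⊆ D, IsOpen U → IsOpen (f '' U))
    (hf_discrete : ∀ y : En n, ∀ x ∈ D ∩ f ⁻¹' {y},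
      ∃ U : Set (En n), IsOpen U ∧ x ∈ U ∧ U ∩ (D ∩ f ⁻¹' {y}) = {x})
    (Df : En n → (En n →L[ℝ] En n))
    (hDf : IsWeakDerivOn n D f Df) (hOrlicz : OrliczCond n D φ Df)
    (hfin_dist : ∀ᵐ x ∂(volume.restrict D),
      LinearMap.det ((Df x) : En n →ₗ[ℝ] En n) = 0 → Df x = 0)
    (hN : (⨆ y : En n, ((D ∩ f ⁻¹' {y}).encard : ℝ≥0∞)) < ∞) :
    ∀ x₀ ∈ closure D,
      IsLowerQMapAt n D
        (fun x => (⨆ y : En n, ((D ∩ f ⁻¹' {y}).encard : ℝ≥0∞)) *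
          innerDil α (Df x) ^ ((p - (n : ℝ) + 1) / ((n : ℝ) - 1)))
        p f x₀ := by
  have hn3 : (3 : ℝ) ≤ n := by exact_mod_cast hn
  have hm : (0 : ℝ) < (n : ℝ) - 1 := by linarith
  have hp0 : 0 < p := by linarith
  intro x₀ hx₀ ε r₀ hε hεr hfar
  obtain ⟨W, Z, hW, hZ, hDfW, hP, hsph⟩ := exists_hasLipschitzPieces_of_orlicz hn hD hDconn.nonempty
    hφ_pos hφ_mono hφ_int hf_cont hf_discrete hDf hOrlicz hfin_dist
  have hEq : EqOn f (D.indicator f) D := fun x hx => (indicator_of_mem hx f).symm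
  have hP' := hP.congr hEq
  have hfm : Measurable (D.indicator f) :=
    measurable_indicator_of_continuousOn hD.measurableSet hf_cont
  have hfi : ContinuousOn (D.indicator f) D := hf_cont.congr hEq.symm
  set N : ℝ≥0∞ := ⨆ y : En n, ((D ∩ f ⁻¹' {y}).encard : ℝ≥0∞) with hNdef
  have hN0 : N ≠ 0 := by
    obtain ⟨x, hx⟩ := hDconn.nonempty
    refine ne_of_gt (lt_of_lt_of_le ?_ (le_iSup _ (f x)))
    have h1 : (D ∩ f ⁻¹' {f x}).encard ≠ 0 := encard_ne_zero.2 ⟨x, hx, rfl⟩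
    simpa [pos_iff_ne_zero] using h1
  have hNle : ∀ y, ((D ∩ D.indicator f ⁻¹' {y}).encard : ℝ≥0∞) ≤ N := fun y => by
    refine le_trans (le_of_eq ?_) (le_iSup _ y)
    congr 2
    ext x
    simp only [mem_inter_iff, mem_preimage, mem_singleton_iff, and_congr_right_iff]
    intro hx
    rw [indicator_of_mem hx]
  refine le_iInf₂ fun ρ hρ => ?_
  have hρ'm : Measurable (pullbackDensity D f W ρ) :=
    (hρ.1.comp hfm).mul ((ENNReal.measurable_ofReal.comp
      ((measurable_hyperplaneJac (by omega)).comp hW)).pow_const _)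
  refine iInf₂_le_of_le (pullbackDensity D f W ρ) ⟨hρ'm, ?_⟩ ?_
  · refine surfModulus_eq_zero_of_null_radii hn hD x₀ hp0 (ae_iff.1 (hsph x₀)) ?_
    rintro S ⟨⟨r, hr, hinj, him⟩, hS⟩
    have hr0 : 0 < r := hε.trans hr.1
    obtain ⟨x, hxD, hx⟩ := hfar
    refine ⟨hinj, r, fun hgood => hS ?_, hr0,
      sphere_inter_nonempty hDconn hx₀ hr0 ⟨x, hxD, hr.2.trans hx⟩, him⟩
    refine one_le_sIntegral_pullbackDensity hn hD hf_cont hW hP' hr0 hr ?_ hρ hinj him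
    rw [← (hEq.mono fun x hx => hx.2.1).image_eq]
    exact hgood hr0
  · have hI := lintegral_comp_mul_det_le (by omega) hD hfm hfi hW hZ hP' hNle
      (g := fun y => ρ y ^ p) (hρ.1.pow_const _)
    calc _ ≤ ∫⁻ x in D, pullbackDensity D f W ρ x ^ p /
            (N * innerDil α (Df x) ^ ((p - (n : ℝ) + 1) / ((n : ℝ) - 1))) :=
          lintegral_mono_set inter_subset_left
      _ ≤ ∫⁻ x in D, ρ (D.indicator f x) ^ p *
            ENNReal.ofReal |LinearMap.det (W x : En n →ₗ[ℝ] En n)| * N⁻¹ := by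
          refine lintegral_mono_ae ?_
          filter_upwards [hDfW] with x hx
          rw [hx, pullbackDensity, ENNReal.mul_rpow_of_nonneg _ _ hp0.le, ← ENNReal.rpow_mul,
            one_div_mul_eq_div, mul_div_assoc, mul_assoc, ← div_eq_mul_inv]
          exact mul_le_mul_right (hyperplaneJac_rpow_div_le hn hp hα (W x) N) _
      _ = (∫⁻ x in D, ρ (D.indicator f x) ^ p *
            ENNReal.ofReal |LinearMap.det (W x : En n →ₗ[ℝ] En n)|) * N⁻¹ :=
          lintegral_mul_const' _ _ (ENNReal.inv_ne_top.2 hN0)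
      _ ≤ N * (∫⁻ y, ρ y ^ p) * N⁻¹ := mul_le_mul_left hI _
      _ = ∫⁻ y, ρ y ^ p := by
          rw [mul_comm N, mul_assoc, ENNReal.mul_inv_cancel hN0 hN.ne, mul_one]
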